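/- Let (u, p) be a C^∞ solution of the stationary incompressible Navier–Stokes equations on ℝ³. Let 0 < γ < 3 ≤ p < +∞ be such that η(γ,p) = γ/p − 3/p + 2/3 ≤ 0. If u belongs to M^p_{γ,0}(ℝ³), then u ≡ 0 and p is a constant function. -/

import Mathlib

open MeasureTheory Filter Metric Real

noncomputable section

/-- Three-dimensional Euclidean space. -/
abbrev E3 : Type := EuclideanSpace ℝ (Fin 3)

/-- Partial derivative `∂_j f` of a scalar field. -/
def pd (j : Fin 3) (f : E3 → ℝ) (x : E3) : ℝ :=
  fderiv ℝ f x (EuclideanSpace.single j 1)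

/-- Laplacian of a scalar field. -/
def lap (f : E3 → ℝ) (x : E3) : ℝ := ∑ j, pd j (pd j f) x

/-- The annulus `C(R/2, R)`. -/
def ann (R : ℝ) : Set E3 := {x : E3 | R / 2 < ‖x‖ ∧ ‖x‖ < R}

/-- Euclidean length `|u(x)|` of a vector field. -/
def vecNorm (u : E3 → Fin 3 → ℝ) (x : E3) : ℝ := Real.sqrt (∑ i, (u x i) ^ 2)

/-- The stationary incompressible Navier–Stokes equations:
`−Δu + (u·∇)u + ∇p = 0`, `div u = 0`. -/
def StatNS (u : E3 → Fin 3 → ℝ) (P : E3 → ℝ) : Prop :=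
  (∀ x : E3, ∀ i : Fin 3,
    -(lap (fun y => u y i) x) + (∑ j, u x j * pd j (fun y => u y i) x)
      + pd i P x = 0) ∧
  (∀ x : E3, ∑ j, pd j (fun y => u y j) x = 0)

/-- Membership in the local Morrey space `M^p_γ(ℝ³)`. -/
def MemMorrey (p γ : ℝ) (f : E3 → ℝ) : Prop :=
  LocallyIntegrable (fun x => |f x| ^ p) volume ∧
  ∃ C : ℝ, ∀ R : ℝ, 1 ≤ R → R ^ (-γ) * ∫ x in ball (0 : E3) R, |f x| ^ p ≤ C

/-- Membership in `M^p_{γ,0}(ℝ³)`. -/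
def MemMorrey0 (p γ : ℝ) (f : E3 → ℝ) : Prop :=
  MemMorrey p γ f ∧
  Tendsto (fun R : ℝ => R ^ (-γ) * ∫ x in ann R, |f x| ^ p) atTop (nhds 0)

open scoped ContDiff Convolution

section PartialDerivatives

lemma ContDiff.pd {f : E3 → ℝ} (hf : ContDiff ℝ ∞ f) (j : Fin 3) : ContDiff ℝ ∞ (pd j f) := by
  unfold _root_.pd
  exact (hf.fderiv_right (m := ∞) (by simp)).clm_apply contDiff_const

lemma ContDiff.lap {f : E3 → ℝ} (hf : ContDiff ℝ ∞ f) : ContDiff ℝ ∞ (lap f) := by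
  unfold _root_.lap
  exact ContDiff.sum fun j _ => (hf.pd j).pd j

lemma ContDiff.differentiable_infty {E F : Type*} [NormedAddCommGroup E] [NormedSpace ℝ E]
    [NormedAddCommGroup F] [NormedSpace ℝ F] {f : E → F} (hf : ContDiff ℝ ∞ f) :
    Differentiable ℝ f :=
  hf.differentiable (by simp)

lemma HasCompactSupport.pd {f : E3 → ℝ} (hf : HasCompactSupport f) (j : Fin 3) :
    HasCompactSupport (pd j f) :=
  hf.fderiv_apply (𝕜 := ℝ) (EuclideanSpace.single j 1)

lemma HasCompactSupport.lap {f : E3 → ℝ} (hf : HasCompactSupport f) :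
    HasCompactSupport (lap f) := by
  have : _root_.lap f = _root_.pd 0 (_root_.pd 0 f) + _root_.pd 1 (_root_.pd 1 f)
      + _root_.pd 2 (_root_.pd 2 f) := by
    ext x; simp [_root_.lap, Fin.sum_univ_three]
  rw [this]
  exact (((hf.pd 0).pd 0).add ((hf.pd 1).pd 1)).add ((hf.pd 2).pd 2)

lemma pd_add {f g : E3 → ℝ} (hf : Differentiable ℝ f) (hg : Differentiable ℝ g) (j : Fin 3) :
    pd j (fun x => f x + g x) = fun x => pd j f x + pd j g x := by
  ext x
  simp only [pd]
  rw [fderiv_fun_add (hf x) (hg x)]; rfl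

lemma pd_sub {f g : E3 → ℝ} (hf : Differentiable ℝ f) (hg : Differentiable ℝ g) (j : Fin 3) :
    pd j (fun x => f x - g x) = fun x => pd j f x - pd j g x := by
  ext x
  simp only [pd]
  rw [fderiv_fun_sub (hf x) (hg x)]; rfl

lemma pd_neg {f : E3 → ℝ} (j : Fin 3) :
    pd j (fun x => - f x) = fun x => - pd j f x := by
  ext x
  simp only [pd]
  rw [fderiv_fun_neg]; rfl

lemma pd_mul {f g : E3 → ℝ} (hf : Differentiable ℝ f) (hg : Differentiable ℝ g) (j : Fin 3) :
    pd j (fun x => f x * g x) = fun x => pd j f x * g x + f x * pd j g x := by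
  ext x
  simp only [pd]
  rw [fderiv_fun_mul (hf x) (hg x)]
  simp; ring

lemma pd_const_mul {f : E3 → ℝ} (hf : Differentiable ℝ f) (c : ℝ) (j : Fin 3) :
    pd j (fun x => c * f x) = fun x => c * pd j f x := by
  ext x
  simp only [pd]
  rw [fderiv_const_mul (hf x)]
  simp

lemma pd_sum {ι : Type*} {s : Finset ι} {f : ι → E3 → ℝ} (hf : ∀ i ∈ s, Differentiable ℝ (f i))
    (j : Fin 3) : pd j (fun x => ∑ i ∈ s, f i x) = fun x => ∑ i ∈ s, pd j (f i) x := by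
  ext x
  simp only [pd]
  rw [fderiv_fun_sum (fun i hi => hf i hi x)]
  simp

lemma pd_add_const {f : E3 → ℝ} (c : ℝ) (j : Fin 3) :
    pd j (fun x => f x + c) = pd j f := by
  ext x
  simp only [pd]
  rw [fderiv_add_const]

lemma pd_comp_smul {f : E3 → ℝ} (hf : Differentiable ℝ f) (c : ℝ) (j : Fin 3) :
    pd j (fun x => f (c • x)) = fun x => c * pd j f (c • x) := by
  ext x
  simp only [pd]
  have h : HasFDerivAt (fun x : E3 => f (c • x))
      ((fderiv ℝ f (c • x)).comp (c • ContinuousLinearMap.id ℝ E3)) x :=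
    (hf (c • x)).hasFDerivAt.comp x ((hasFDerivAt_id x).const_smul c)
  rw [h.fderiv]
  simp

lemma pd_comp_const_sub {f : E3 → ℝ} (hf : Differentiable ℝ f) (c : E3) (j : Fin 3) :
    pd j (fun z => f (c - z)) = fun z => - pd j f (c - z) := by
  ext x
  simp only [pd]
  have h : HasFDerivAt (fun x : E3 => f (c - x))
      ((fderiv ℝ f (c - x)).comp (- ContinuousLinearMap.id ℝ E3)) x :=
    (hf (c - x)).hasFDerivAt.comp x ((hasFDerivAt_id x).const_sub c)
  rw [h.fderiv]
  simp

lemma pd_eq_deriv_comp {φ φ' : ℝ → ℝ} {f : E3 → ℝ} (hf : Differentiable ℝ f)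
    (hφ : ∀ x, HasDerivAt φ (φ' (f x)) (f x)) (j : Fin 3) :
    pd j (fun x => φ (f x)) = fun x => φ' (f x) * pd j f x := by
  ext x
  simp only [pd]
  have h := (hφ x).comp_hasFDerivAt x (hf x).hasFDerivAt
  rw [show (fun x => φ (f x)) = φ ∘ f from rfl, h.fderiv]
  simp

lemma pd_comm {f : E3 → ℝ} (hf : ContDiff ℝ ∞ f) (i j : Fin 3) :
    pd i (pd j f) = pd j (pd i f) := by
  ext x
  have hd : Differentiable ℝ (fderiv ℝ f) :=
    (hf.fderiv_right (m := ∞) (by simp)).differentiable_infty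
  have key : ∀ i j : Fin 3, pd i (pd j f) x =
      fderiv ℝ (fderiv ℝ f) x (EuclideanSpace.single i 1) (EuclideanSpace.single j 1) := by
    intro i j
    change fderiv ℝ (fun y => fderiv ℝ f y (EuclideanSpace.single j 1)) x _ = _
    rw [fderiv_clm_apply (hd x) (differentiableAt_const _)]
    simp
  rw [key, key]
  exact (hf.contDiffAt.isSymmSndFDerivAt (by simp; exact ENat.LEInfty.out)).eq _ _

lemma pd_lap {f : E3 → ℝ} (hf : ContDiff ℝ ∞ f) (i : Fin 3) :
    pd i (lap f) = lap (pd i f) := by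
  unfold lap
  rw [pd_sum fun j _ => ((hf.pd j).pd j).differentiable_infty]
  ext x
  refine Finset.sum_congr rfl fun j _ => ?_
  rw [pd_comm (hf.pd j) i j, pd_comm hf i j]

lemma lap_sub {f g : E3 → ℝ} (hf : ContDiff ℝ ∞ f) (hg : ContDiff ℝ ∞ g) :
    lap (fun x => f x - g x) = fun x => lap f x - lap g x := by
  ext x
  simp only [lap, ← Finset.sum_sub_distrib]
  refine Finset.sum_congr rfl fun j _ => ?_
  rw [pd_sub hf.differentiable_infty hg.differentiable_infty,
    pd_sub (hf.pd j).differentiable_infty (hg.pd j).differentiable_infty]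

lemma lap_comp_smul {f : E3 → ℝ} (hf : ContDiff ℝ ∞ f) (c : ℝ) :
    lap (fun x => f (c • x)) = fun x => c ^ 2 * lap f (c • x) := by
  ext x
  simp only [lap, Finset.mul_sum]
  refine Finset.sum_congr rfl fun j _ => ?_
  have h1 : Differentiable ℝ fun x : E3 => pd j f (c • x) :=
    ((hf.pd j).comp (contDiff_const_smul c)).differentiable_infty
  rw [pd_comp_smul hf.differentiable_infty, pd_const_mul h1,
    pd_comp_smul (hf.pd j).differentiable_infty]
  ring

lemma lap_const_mul {f : E3 → ℝ} (hf : ContDiff ℝ ∞ f) (c : ℝ) :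
    lap (fun x => c * f x) = fun x => c * lap f x := by
  ext x
  simp only [lap, Finset.mul_sum]
  refine Finset.sum_congr rfl fun j _ => ?_
  rw [pd_const_mul hf.differentiable_infty, pd_const_mul (hf.pd j).differentiable_infty]

lemma ContDiff.integrable_of_compact {f : E3 → ℝ} (hf : ContDiff ℝ ∞ f)
    (hc : HasCompactSupport f) : Integrable f :=
  hf.continuous.integrable_of_hasCompactSupport hc

/-- Integration by parts for a product with compact support. -/
lemma integral_mul_pd {f g : E3 → ℝ} (hf : ContDiff ℝ ∞ f) (hg : ContDiff ℝ ∞ g)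
    (hc : HasCompactSupport g) (j : Fin 3) :
    ∫ x, f x * pd j g x = - ∫ x, pd j f x * g x :=
  integral_mul_fderiv_eq_neg_fderiv_mul_of_integrable
    (((hf.pd j).mul hg).integrable_of_compact hc.mul_left)
    ((hf.mul (hg.pd j)).integrable_of_compact (hc.pd j).mul_left)
    ((hf.mul hg).integrable_of_compact hc.mul_left)
    (fun x _ => hf.differentiable_infty x) (fun x _ => hg.differentiable_infty x)

/-- Green's identity for a product with compact support. -/
lemma integral_mul_lap {f g : E3 → ℝ} (hf : ContDiff ℝ ∞ f) (hg : ContDiff ℝ ∞ g)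
    (hc : HasCompactSupport g) : ∫ x, f x * lap g x = ∫ x, lap f x * g x := by
  simp only [lap, Finset.mul_sum, Finset.sum_mul]
  rw [integral_finsetSum _ fun j _ =>
      (hf.mul ((hg.pd j).pd j)).integrable_of_compact ((hc.pd j).pd j).mul_left,
    integral_finsetSum _ fun j _ =>
      (((hf.pd j).pd j).mul hg).integrable_of_compact hc.mul_left]
  refine Finset.sum_congr rfl fun j _ => ?_
  have h1 := integral_mul_pd hf (hg.pd j) (hc.pd j) j
  have h2 := integral_mul_pd (hf.pd j) hg hc j
  linarith

end PartialDerivatives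

section Convolution

/-- The convolution `k * h` of a kernel `k` with a function `h`. -/
def cv (k h : E3 → ℝ) (x : E3) : ℝ := ∫ z, k (x - z) * h z

lemma cv_eq_convolution (k h : E3 → ℝ) :
    cv k h = (h ⋆[ContinuousLinearMap.mul ℝ ℝ, volume] k) := by
  ext x
  simp [cv, convolution, mul_comm]

lemma integrable_cv_integrand {k h : E3 → ℝ} (hk : Continuous k) (hh : ContDiff ℝ ∞ h)
    (hc : HasCompactSupport h) (x : E3) : Integrable fun z => k (x - z) * h z :=
  ((hk.comp (continuous_const.sub continuous_id)).mul hh.continuous).integrable_of_hasCompactSupport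
    hc.mul_left

lemma contDiff_cv {k h : E3 → ℝ} (hk : Continuous k) (hh : ContDiff ℝ ∞ h)
    (hc : HasCompactSupport h) : ContDiff ℝ ∞ (cv k h) := by
  rw [cv_eq_convolution]
  exact hc.contDiff_convolution_left _ hh hk.locallyIntegrable

lemma pd_cv {k h : E3 → ℝ} (hk : Continuous k) (hh : ContDiff ℝ ∞ h)
    (hc : HasCompactSupport h) (j : Fin 3) : pd j (cv k h) = cv k (pd j h) := by
  ext x
  have e : ∀ f : E3 → ℝ, cv k f = (k ⋆[ContinuousLinearMap.mul ℝ ℝ, volume] f) := by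
    intro f
    ext y
    rw [convolution_eq_swap]
    simp [cv]
  rw [e, e, pd, (hc.hasFDerivAt_convolution_right (ContinuousLinearMap.mul ℝ ℝ)
    hk.locallyIntegrable (hh.of_le (by simp)) x).fderiv,
    convolution_precompR_apply _ hk.locallyIntegrable (hc.fderiv ℝ)
    (hh.continuous_fderiv (by simp))]
  rfl

lemma cv_pd {k h : E3 → ℝ} (hk : ContDiff ℝ ∞ k) (hh : ContDiff ℝ ∞ h)
    (hc : HasCompactSupport h) (j : Fin 3) : cv k (pd j h) = cv (pd j k) h := by
  ext x
  simp only [cv]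
  rw [integral_mul_pd (f := fun z => k (x - z)) (hk.comp (contDiff_const.sub contDiff_id)) hh hc,
    pd_comp_const_sub hk.differentiable_infty, ← integral_neg]
  simp

lemma cv_add_left {k l h : E3 → ℝ} (hk : Continuous k) (hl : Continuous l)
    (hh : ContDiff ℝ ∞ h) (hc : HasCompactSupport h) (x : E3) :
    cv (fun z => k z + l z) h x = cv k h x + cv l h x := by
  simp only [cv, add_mul]
  exact integral_add (integrable_cv_integrand hk hh hc x) (integrable_cv_integrand hl hh hc x)

lemma cv_sub_left {k l h : E3 → ℝ} (hk : Continuous k) (hl : Continuous l)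
    (hh : ContDiff ℝ ∞ h) (hc : HasCompactSupport h) (x : E3) :
    cv (fun z => k z - l z) h x = cv k h x - cv l h x := by
  simp only [cv, sub_mul]
  exact integral_sub (integrable_cv_integrand hk hh hc x) (integrable_cv_integrand hl hh hc x)

lemma cv_sum_right {k : E3 → ℝ} {h : Fin 3 → E3 → ℝ} (hk : Continuous k)
    (hh : ∀ j, ContDiff ℝ ∞ (h j)) (hc : ∀ j, HasCompactSupport (h j)) (x : E3) :
    cv k (fun z => ∑ j, h j z) x = ∑ j, cv k (h j) x := by
  simp only [cv, Finset.mul_sum]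
  exact integral_finsetSum _ fun j _ => integrable_cv_integrand hk (hh j) (hc j) x

lemma lap_cv {k h : E3 → ℝ} (hk : Continuous k) (hh : ContDiff ℝ ∞ h)
    (hc : HasCompactSupport h) : lap (cv k h) = cv k (lap h) := by
  ext x
  have : lap h = fun z => ∑ j, pd j (pd j h) z := rfl
  rw [this, cv_sum_right hk (fun j => (hh.pd j).pd j) (fun j => (hc.pd j).pd j)]
  refine Finset.sum_congr rfl fun j _ => ?_
  rw [pd_cv hk hh hc, pd_cv hk (hh.pd j) (hc.pd j)]

lemma cv_lap {k h : E3 → ℝ} (hk : ContDiff ℝ ∞ k) (hh : ContDiff ℝ ∞ h)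
    (hc : HasCompactSupport h) : cv k (lap h) = cv (lap k) h := by
  ext x
  simp only [cv]
  rw [integral_mul_lap (f := fun z => k (x - z)) (hk.comp (contDiff_const.sub contDiff_id)) hh hc]
  congr with z
  congr 1
  simp only [lap]
  refine Finset.sum_congr rfl fun j _ => ?_
  have h1 : Differentiable ℝ fun z : E3 => pd j k (x - z) :=
    ((hk.pd j).comp (contDiff_const.sub contDiff_id)).differentiable_infty
  rw [pd_comp_const_sub hk.differentiable_infty, pd_neg,
    pd_comp_const_sub (hk.pd j).differentiable_infty]
  simp

/-- A convolution vanishes outside the sum of the supports. -/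
lemma cv_eq_zero {k h : E3 → ℝ} {r s : ℝ} (hk : ∀ z, r ≤ ‖z‖ → k z = 0)
    (hh : ∀ z, s ≤ ‖z‖ → h z = 0) {x : E3} (hx : r + s ≤ ‖x‖) : cv k h x = 0 := by
  have : (fun z => k (x - z) * h z) = fun _ => 0 := by
    ext z
    rcases le_or_gt s ‖z‖ with h1 | h1
    · rw [hh z h1, mul_zero]
    · rw [hk _ _, zero_mul]
      have := norm_sub_norm_le x z
      linarith
  rw [cv, this, integral_zero]

lemma abs_cv_le {k h : E3 → ℝ} {s C : ℝ} (hh : ContDiff ℝ ∞ h) (hc : HasCompactSupport h)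
    (hs : ∀ z, s ≤ ‖z‖ → h z = 0) {x : E3} (hk : ∀ z, ‖z‖ ≤ ‖x‖ + s → |k z| ≤ C) :
    |cv k h x| ≤ C * ∫ z, |h z| := by
  rw [cv, ← Real.norm_eq_abs, ← integral_const_mul]
  refine norm_integral_le_of_norm_le ((hh.integrable_of_compact hc).abs.const_mul C)
    (Eventually.of_forall fun z => ?_)
  rw [norm_mul, Real.norm_eq_abs, Real.norm_eq_abs]
  rcases le_or_gt s ‖z‖ with h1 | h1
  · simp [hs z h1]
  · refine mul_le_mul_of_nonneg_right (hk _ ?_) (abs_nonneg _)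
    have := norm_sub_le x z
    linarith

lemma hasCompactSupport_of_norm {f : E3 → ℝ} {r : ℝ} (hf : ∀ z, r ≤ ‖z‖ → f z = 0) :
    HasCompactSupport f := by
  refine HasCompactSupport.of_support_subset_isCompact (isCompact_closedBall (0 : E3) r) ?_
  intro z hz
  by_contra h
  refine hz (hf z ?_)
  simp at h
  exact h.le

end Convolution

section HeatKernel

/-- The heat kernel on `ℝ³`, parametrized by the inverse time `σ = 1 / (4 * t)`. -/
def heatK (σ : ℝ) (z : E3) : ℝ := √(σ / π) ^ 3 * rexp (-σ * ‖z‖ ^ 2)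

lemma contDiff_heatK (σ : ℝ) : ContDiff ℝ ∞ (heatK σ) := by
  unfold heatK
  exact contDiff_const.mul (contDiff_const.mul (contDiff_norm_sq ℝ)).exp

lemma heatK_pos {σ : ℝ} (hσ : 0 < σ) (z : E3) : 0 < heatK σ z := by
  unfold heatK; positivity

lemma sqrt_pow_three_eq_rpow {a : ℝ} (ha : 0 ≤ a) : √a ^ 3 = a ^ (3 / 2 : ℝ) := by
  rw [Real.sqrt_eq_rpow, ← Real.rpow_natCast, ← Real.rpow_mul ha]
  norm_num

lemma integral_gaussian_E3 {b : ℝ} (hb : 0 < b) (c : E3) :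
    ∫ z : E3, rexp (-b * ‖z - c‖ ^ 2) = √(π / b) ^ 3 := by
  rw [integral_sub_right_eq_self (fun z : E3 => rexp (-b * ‖z‖ ^ 2)),
    GaussianFourier.integral_rexp_neg_mul_sq_norm hb, sqrt_pow_three_eq_rpow (by positivity)]
  simp

lemma integrable_gaussian_E3 {b : ℝ} (hb : 0 < b) (c : E3) :
    Integrable fun z : E3 => rexp (-b * ‖z - c‖ ^ 2) := by
  by_contra h
  have h1 := integral_undef h
  rw [integral_gaussian_E3 hb] at h1
  have : 0 < √(π / b) ^ 3 := by positivity
  linarith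

lemma integral_heatK {σ : ℝ} (hσ : 0 < σ) : ∫ z, heatK σ z = 1 := by
  have h := integral_gaussian_E3 hσ 0
  simp only [sub_zero] at h
  simp only [heatK]
  rw [integral_const_mul, h, ← mul_pow, ← Real.sqrt_mul (by positivity)]
  have : σ / π * (π / σ) = 1 := by field_simp
  rw [this]; simp

lemma integrable_heatK {σ : ℝ} (hσ : 0 < σ) : Integrable (heatK σ) := by
  have h := integrable_gaussian_E3 hσ 0
  simp only [sub_zero] at h
  exact h.const_mul _

lemma heatK_le {σ : ℝ} (hσ : 0 ≤ σ) (z : E3) : heatK σ z ≤ √(σ / π) ^ 3 := by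
  unfold heatK
  refine mul_le_of_le_one_right (by positivity) (Real.exp_le_one_iff.mpr ?_)
  have : 0 ≤ σ * ‖z‖ ^ 2 := by positivity
  linarith

/-- The semigroup property of the heat kernel. -/
lemma integral_heatK_mul_heatK {σ : ℝ} (hσ : 0 < σ) (a b : E3) :
    ∫ x, heatK σ (x - a) * heatK σ (x - b) =
      √(σ / (2 * π)) ^ 3 * rexp (-(σ / 2) * ‖a - b‖ ^ 2) := by
  have hpt : ∀ x : E3, heatK σ (x - a) * heatK σ (x - b) =
      ((√(σ / π) ^ 3) ^ 2 * rexp (-(σ / 2) * ‖a - b‖ ^ 2)) *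
        rexp (-(2 * σ) * ‖x - (1 / 2 : ℝ) • (a + b)‖ ^ 2) := by
    intro x
    have e1 : ‖x - a‖ ^ 2 + ‖x - b‖ ^ 2 =
        ‖a - b‖ ^ 2 / 2 + 2 * ‖x - (1 / 2 : ℝ) • (a + b)‖ ^ 2 := by
      simp only [EuclideanSpace.real_norm_sq_eq, Fin.sum_univ_three, PiLp.sub_apply,
        PiLp.smul_apply, PiLp.add_apply, smul_eq_mul]
      ring
    simp only [heatK]
    have e2 : rexp (-σ * ‖x - a‖ ^ 2) * rexp (-σ * ‖x - b‖ ^ 2) = rexp (-(σ / 2) * ‖a - b‖ ^ 2) *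
        rexp (-(2 * σ) * ‖x - (1 / 2 : ℝ) • (a + b)‖ ^ 2) := by
      rw [← Real.exp_add, ← Real.exp_add]
      congr 1
      linear_combination (-σ) * e1
    linear_combination (√(σ / π) ^ 3) ^ 2 * e2
  simp_rw [hpt]
  rw [integral_const_mul, integral_gaussian_E3 (by positivity)]
  have : √(σ / π) ^ 2 * √(π / (2 * σ)) = √(σ / (2 * π)) := by
    rw [Real.sq_sqrt (by positivity)]
    rw [eq_comm, Real.sqrt_eq_iff_mul_self_eq (by positivity) (by positivity)]
    rw [mul_mul_mul_comm, Real.mul_self_sqrt (by positivity)]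
    field_simp
  rw [← this]
  ring

lemma hasDerivAt_heatK {σ : ℝ} (hσ : 0 < σ) (z : E3) :
    HasDerivAt (fun s => heatK s z) ((3 / (2 * σ) - ‖z‖ ^ 2) * heatK σ z) σ := by
  unfold heatK
  have h1 : HasDerivAt (fun s : ℝ => √(s / π)) ((1 / π) / (2 * √(σ / π))) σ :=
    ((hasDerivAt_id σ).div_const π).sqrt (by positivity)
  have h2 : HasDerivAt (fun s : ℝ => rexp (-s * ‖z‖ ^ 2))
      (rexp (-σ * ‖z‖ ^ 2) * (-1 * ‖z‖ ^ 2)) σ :=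
    ((hasDerivAt_id σ).neg.mul_const (‖z‖ ^ 2)).exp
  refine ((h1.fun_pow 3).mul h2).congr_deriv ?_
  have hs : √(σ / π) ^ 2 = σ / π := Real.sq_sqrt (by positivity)
  have hs0 : 0 < √(σ / π) := by positivity
  have h3 : (1 / π) / (2 * √(σ / π)) = √(σ / π) / (2 * σ) := by
    rw [div_eq_div_iff (by positivity) (by positivity)]
    have : √(σ / π) * (2 * √(σ / π)) = 2 * (σ / π) := by
      linear_combination 2 * hs
    rw [this]; ring
  rw [h3]
  simp only [Nat.add_one_sub_one, Nat.cast_ofNat]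
  generalize √(σ / π) = q
  field_simp
  ring

lemma pd_norm_sq (j : Fin 3) : pd j (fun z : E3 => ‖z‖ ^ 2) = fun z => 2 * z j := by
  ext z
  have h := (hasStrictFDerivAt_norm_sq z).hasFDerivAt
  rw [pd, h.fderiv]
  simp [EuclideanSpace.inner_single_right]

lemma pd_coord (j : Fin 3) : pd j (fun z : E3 => z j) = fun _ => 1 := by
  ext z
  have h : HasFDerivAt (fun z : E3 => z j) (EuclideanSpace.proj (𝕜 := ℝ) j : E3 →L[ℝ] ℝ) z :=
    (EuclideanSpace.proj (𝕜 := ℝ) j : E3 →L[ℝ] ℝ).hasFDerivAt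
  rw [pd, h.fderiv]
  simp

lemma contDiff_coord (j : Fin 3) : ContDiff ℝ ∞ (fun z : E3 => z j) :=
  (EuclideanSpace.proj (𝕜 := ℝ) j : E3 →L[ℝ] ℝ).contDiff

lemma pd_heatK (σ : ℝ) (j : Fin 3) :
    pd j (heatK σ) = fun z => (-2 * σ) * (z j * heatK σ z) := by
  have h := pd_eq_deriv_comp (φ := fun r => √(σ / π) ^ 3 * rexp (-σ * r))
    (φ' := fun r => √(σ / π) ^ 3 * (rexp (-σ * r) * (-σ * 1))) (f := fun z : E3 => ‖z‖ ^ 2)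
    (contDiff_norm_sq ℝ).differentiable_infty
    (fun z => (((hasDerivAt_id _).const_mul (-σ)).exp).const_mul _) j
  rw [pd_norm_sq] at h
  have e : heatK σ = fun z => √(σ / π) ^ 3 * rexp (-σ * ‖z‖ ^ 2) := rfl
  rw [e, h]
  ext z
  ring

lemma lap_heatK (σ : ℝ) (z : E3) :
    lap (heatK σ) z = (4 * σ ^ 2 * ‖z‖ ^ 2 - 6 * σ) * heatK σ z := by
  have hj : ∀ j, pd j (pd j (heatK σ)) z =
      (-2 * σ) * (heatK σ z + z j * ((-2 * σ) * (z j * heatK σ z))) := by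
    intro j
    rw [pd_heatK, pd_const_mul
      ((contDiff_coord j).mul (contDiff_heatK σ)).differentiable_infty,
      pd_mul (contDiff_coord j).differentiable_infty (contDiff_heatK σ).differentiable_infty,
      pd_coord, pd_heatK]
    ring
  simp only [lap, hj, Fin.sum_univ_three, EuclideanSpace.real_norm_sq_eq]
  ring

/-- The heat equation, in the inverse time variable. -/
lemma hasDerivAt_heat_flow {h : E3 → ℝ} (hh : ContDiff ℝ ∞ h) (hc : HasCompactSupport h)
    {σ : ℝ} (hσ : 0 < σ) (x : E3) :
    HasDerivAt (fun s => cv (heatK s) h x) (-(1 / (4 * σ ^ 2)) * cv (heatK σ) (lap h) x) σ := by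
  obtain ⟨r, hr⟩ := hc.isCompact.isBounded.subset_closedBall (0 : E3)
  have hbd : ∀ z, h z ≠ 0 → ‖x - z‖ ^ 2 ≤ (‖x‖ + r) ^ 2 := by
    intro z hz
    have h1 : z ∈ closedBall (0 : E3) r := hr (subset_tsupport _ hz)
    have h2 := norm_sub_le x z
    rw [mem_closedBall_zero_iff] at h1
    gcongr
    linarith
  have key := (hasDerivAt_integral_of_dominated_loc_of_deriv_le (μ := (volume : Measure E3))
    (F := fun s z => heatK s (x - z) * h z)
    (F' := fun s z => ((3 / (2 * s) - ‖x - z‖ ^ 2) * heatK s (x - z)) * h z)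
    (x₀ := σ) (s := Set.Ioo (σ / 2) (2 * σ))
    (bound := fun z => ((3 / σ + (‖x‖ + r) ^ 2) * √(2 * σ / π) ^ 3) * |h z|)
    (Ioo_mem_nhds (by linarith) (by linarith))
    (Eventually.of_forall fun s =>
      (integrable_cv_integrand (contDiff_heatK s).continuous hh hc x).aestronglyMeasurable)
    (integrable_cv_integrand (contDiff_heatK σ).continuous hh hc x)
    (by
      refine Continuous.aestronglyMeasurable ?_
      have h1 := (contDiff_heatK σ).continuous
      have h2 := hh.continuous
      fun_prop)
    (Eventually.of_forall fun z s hs => ?_)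
    (((hh.integrable_of_compact hc).abs).const_mul _)
    (Eventually.of_forall fun z s hs =>
      (hasDerivAt_heatK (by linarith [hs.1]) (x - z)).mul_const (h z))).2
  · refine key.congr_deriv ?_
    rw [cv_lap (contDiff_heatK σ) hh hc, cv, ← integral_const_mul]
    congr with z
    rw [lap_heatK]
    field_simp
    ring
  · have hs0 : 0 < s := by linarith [hs.1]
    by_cases hz : h z = 0
    · simp [hz]
    rw [norm_mul, norm_mul, Real.norm_eq_abs, Real.norm_eq_abs, Real.norm_eq_abs]
    gcongr
    · have h1 := hbd z hz
      have h2 : 3 / (2 * s) ≤ 3 / σ := by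
        apply div_le_div_of_nonneg_left <;> linarith [hs.1]
      have h3 : 0 ≤ 3 / (2 * s) := by positivity
      have h4 : 0 ≤ ‖x - z‖ ^ 2 := by positivity
      rw [abs_le]
      constructor <;> linarith
    · rw [abs_of_pos (heatK_pos hs0 _)]
      refine (heatK_le hs0.le _).trans ?_
      gcongr
      exact hs.2.le

lemma integrable_heatK_sub {σ : ℝ} (hσ : 0 < σ) (x : E3) :
    Integrable fun z => heatK σ (x - z) :=
  (integrable_heatK hσ).comp_sub_left x

lemma abs_cv_heatK_le {h : E3 → ℝ} {M : ℝ} (hM : ∀ z, |h z| ≤ M) {σ : ℝ} (hσ : 0 < σ) (x : E3) :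
    |cv (heatK σ) h x| ≤ M := by
  rw [cv, ← Real.norm_eq_abs]
  have h1 : ∫ z, heatK σ (x - z) * M = M := by
    rw [integral_mul_const, integral_sub_left_eq_self (heatK σ), integral_heatK hσ, one_mul]
  rw [← h1]
  refine norm_integral_le_of_norm_le ((integrable_heatK_sub hσ x).mul_const M)
    (Eventually.of_forall fun z => ?_)
  rw [norm_mul, Real.norm_of_nonneg (heatK_pos hσ _).le]
  exact mul_le_mul_of_nonneg_left (hM z) (heatK_pos hσ _).le

/-- The heat flow is a contraction in `L^p`, pointwise form. -/
lemma abs_cv_heatK_rpow_le {h : E3 → ℝ} (hh : Continuous h) (hc : HasCompactSupport h)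
    {p : ℝ} (hp : 1 ≤ p) {σ : ℝ} (hσ : 0 < σ) (x : E3) :
    |cv (heatK σ) h x| ^ p ≤ ∫ z, heatK σ (x - z) * |h z| ^ p := by
  set w : E3 → ENNReal := fun z => ENNReal.ofReal (heatK σ (x - z)) with hw
  have hcont : Continuous fun z => heatK σ (x - z) :=
    (contDiff_heatK σ).continuous.comp (continuous_const.sub continuous_id)
  have hwm : Measurable w := hcont.measurable.ennreal_ofReal
  have hprob : IsProbabilityMeasure (volume.withDensity w) := by
    refine ⟨?_⟩
    rw [withDensity_apply _ .univ, Measure.restrict_univ]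
    rw [hw, ← ofReal_integral_eq_lintegral_ofReal (integrable_heatK_sub hσ x)
      (Eventually.of_forall fun z => (heatK_pos hσ _).le),
      integral_sub_left_eq_self (heatK σ), integral_heatK hσ, ENNReal.ofReal_one]
  have hfin : ∀ᵐ z, w z < ⊤ := Eventually.of_forall fun z => ENNReal.ofReal_lt_top
  have hint : ∀ f : E3 → ℝ, ∫ z, f z ∂(volume.withDensity w) = ∫ z, heatK σ (x - z) * f z := by
    intro f
    rw [integral_withDensity_eq_integral_toReal_smul hwm hfin]
    congr with z
    rw [hw, ENNReal.toReal_ofReal (heatK_pos hσ _).le, smul_eq_mul]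
  have hInt : ∀ f : E3 → ℝ, Continuous f → HasCompactSupport f →
      Integrable f (volume.withDensity w) := fun f hf hfc =>
    hf.integrable_of_hasCompactSupport hfc
  have hp0 : 0 < p := by linarith
  have hcp : Continuous fun z => |h z| ^ p := hh.abs.rpow_const fun _ => Or.inr hp0.le
  have hsp : HasCompactSupport fun z => |h z| ^ p :=
    hc.comp_left (g := fun t => |t| ^ p) (by simp [hp0.ne'])
  have hsa : HasCompactSupport fun z => |h z| := hc.comp_left (g := fun t => |t|) (by simp)
  have hJ := (convexOn_rpow hp).map_integral_le (μ := volume.withDensity w) (f := fun z => |h z|)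
    ((Real.continuous_rpow_const hp0.le).continuousOn) isClosed_Ici
    (Eventually.of_forall fun z => Set.mem_Ici.mpr (abs_nonneg _)) (hInt _ hh.abs hsa) (hInt _ hcp hsp)
  rw [hint, hint] at hJ
  refine le_trans ?_ hJ
  refine Real.rpow_le_rpow (abs_nonneg _) ?_ hp0.le
  rw [cv, ← Real.norm_eq_abs]
  refine (norm_integral_le_integral_norm _).trans (le_of_eq ?_)
  congr with z
  rw [norm_mul, Real.norm_of_nonneg (heatK_pos hσ _).le, Real.norm_eq_abs]

/-- The heat flow is a contraction in `L^p`. -/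
lemma integral_abs_cv_heatK_rpow_le {h : E3 → ℝ} (hh : ContDiff ℝ ∞ h) (hc : HasCompactSupport h)
    {p : ℝ} (hp : 1 ≤ p) {σ : ℝ} (hσ : 0 < σ) :
    Integrable (fun x => |cv (heatK σ) h x| ^ p) ∧
      ∫ x, |cv (heatK σ) h x| ^ p ≤ ∫ x, |h x| ^ p := by
  have hp0 : 0 < p := by linarith
  have hcp : Continuous fun z => |h z| ^ p := hh.continuous.abs.rpow_const fun _ => Or.inr hp0.le
  have hsp : HasCompactSupport fun z => |h z| ^ p :=
    hc.comp_left (g := fun t => |t| ^ p) (by simp [hp0.ne'])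
  have hi := hcp.integrable_of_hasCompactSupport (μ := volume) hsp
  have e : (fun x => ∫ z, heatK σ (x - z) * |h z| ^ p) =
      ((fun z => |h z| ^ p) ⋆[ContinuousLinearMap.mul ℝ ℝ, volume] heatK σ) := by
    ext x
    simp [convolution, mul_comm]
  have hci : Integrable (fun x => ∫ z, heatK σ (x - z) * |h z| ^ p) := by
    rw [e]
    exact hi.integrable_convolution _ (integrable_heatK hσ)
  have hcont : Continuous fun x => |cv (heatK σ) h x| ^ p :=
    (contDiff_cv (contDiff_heatK σ).continuous hh hc).continuous.abs.rpow_const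
      fun _ => Or.inr hp0.le
  have hint : Integrable (fun x => |cv (heatK σ) h x| ^ p) := by
    refine hci.mono' hcont.aestronglyMeasurable (Eventually.of_forall fun x => ?_)
    rw [Real.norm_of_nonneg (by positivity)]
    exact abs_cv_heatK_rpow_le hh.continuous hc hp hσ x
  refine ⟨hint, ?_⟩
  calc ∫ x, |cv (heatK σ) h x| ^ p ≤ ∫ x, ∫ z, heatK σ (x - z) * |h z| ^ p :=
        integral_mono hint hci fun x => abs_cv_heatK_rpow_le hh.continuous hc hp hσ x
    _ = ∫ x, |h x| ^ p := by
        rw [e, integral_convolution _ hi (integrable_heatK hσ), integral_heatK hσ]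
        simp

end HeatKernel

section Bellman

lemma continuous_heat_flow {h : E3 → ℝ} (hh : ContDiff ℝ ∞ h) (hc : HasCompactSupport h) :
    Continuous fun q : ℝ × E3 => cv (heatK q.1) h q.2 := by
  have h1 : ∀ q : ℝ × E3, cv (heatK q.1) h q.2 =
      ∫ z in tsupport h, heatK q.1 (q.2 - z) * h z := by
    intro q
    rw [cv, setIntegral_eq_integral_of_forall_compl_eq_zero]
    intro z hz
    rw [image_eq_zero_of_notMem_tsupport hz, mul_zero]
  simp_rw [h1]
  refine continuous_parametric_integral_of_continuous ?_ hc.isCompact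
  have := hh.continuous
  unfold heatK Function.uncurry
  fun_prop

lemma hasDerivAt_mul_sqrt {s : ℝ} (hs : 0 < s) :
    HasDerivAt (fun s => s * √s) (3 / 2 * √s) s := by
  have h := (hasDerivAt_id s).mul ((hasDerivAt_id s).sqrt hs.ne')
  refine h.congr_deriv ?_
  have h2 : √s * √s = s := Real.mul_self_sqrt hs.le
  have h3 : 0 < √s := Real.sqrt_pos.mpr hs
  simp only [id]
  field_simp
  linear_combination (-1 : ℝ) * h2

lemma contDiff_mul_sqrt {S : E3 → ℝ} (hS : ContDiff ℝ ∞ S) (hpos : ∀ x, 0 < S x) :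
    ContDiff ℝ ∞ fun x => S x * √(S x) :=
  hS.mul (hS.sqrt fun x => (hpos x).ne')

lemma pd_mul_sqrt {S : E3 → ℝ} (hS : ContDiff ℝ ∞ S) (hpos : ∀ x, 0 < S x) (j : Fin 3) :
    pd j (fun x => S x * √(S x)) = fun x => 3 / 2 * √(S x) * pd j S x :=
  pd_eq_deriv_comp (φ := fun s => s * √s) (φ' := fun s => 3 / 2 * √s)
    hS.differentiable_infty (fun x => hasDerivAt_mul_sqrt (hpos x)) j

lemma lap_mul_sqrt {S : E3 → ℝ} (hS : ContDiff ℝ ∞ S) (hpos : ∀ x, 0 < S x) (x : E3) :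
    lap (fun x => S x * √(S x)) x =
      3 / 2 * √(S x) * lap S x + 3 / 4 / √(S x) * ∑ j, pd j S x ^ 2 := by
  simp only [lap, Finset.mul_sum, ← Finset.sum_add_distrib]
  refine Finset.sum_congr rfl fun j _ => ?_
  have h1 : Differentiable ℝ fun x => 3 / 2 * √(S x) :=
    (contDiff_const.mul (hS.sqrt fun x => (hpos x).ne')).differentiable_infty
  rw [pd_mul_sqrt hS hpos, pd_mul h1 (hS.pd j).differentiable_infty,
    pd_eq_deriv_comp (φ := fun s => 3 / 2 * √s) (φ' := fun s => 3 / 2 * (1 / (2 * √s)))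
      hS.differentiable_infty
      (fun x => (Real.hasDerivAt_sqrt (hpos x).ne').const_mul _) j]
  have h3 : 0 < √(S x) := Real.sqrt_pos.mpr (hpos x)
  field_simp
  ring

/-- A regularized Bellman function for the bilinear heat flow estimate. -/
def bell (δ X Y : ℝ) : ℝ := (X ^ 2 + Y + δ) * √(X ^ 2 + Y + δ) + (Y + δ) * √(Y + δ)

lemma mul_sqrt_le_add {a b c : ℝ} (ha : 0 ≤ a) (hb : 0 ≤ b) (hc : 0 ≤ c) :
    (a + b + c) * √(a + b + c) ≤ 6 * (a * √a + b * √b + c * √c) := by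
  have key : ∀ m : ℝ, 0 ≤ m → a ≤ m → b ≤ m → c ≤ m →
      (a + b + c) * √(a + b + c) ≤ 6 * (m * √m) := by
    intro m hm h1 h2 h3
    have h4 : √(a + b + c) ≤ 2 * √m := by
      rw [show (2 : ℝ) * √m = √(4 * m) by
        rw [Real.sqrt_mul (by norm_num), show (4 : ℝ) = 2 ^ 2 by norm_num,
          Real.sqrt_sq (by norm_num)]]
      exact Real.sqrt_le_sqrt (by linarith)
    calc (a + b + c) * √(a + b + c) ≤ (3 * m) * (2 * √m) := by
          gcongr
          linarith
      _ = 6 * (m * √m) := by ring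
  have pa : 0 ≤ a * √a := by positivity
  have pb : 0 ≤ b * √b := by positivity
  have pc : 0 ≤ c * √c := by positivity
  rcases le_total a b with h1 | h1 <;> rcases le_total b c with h2 | h2 <;>
    rcases le_total a c with h3 | h3
  · linarith [key c hc h3 h2 le_rfl]
  · linarith [key c hc (h1.trans h2) h2 le_rfl]
  · linarith [key b hb h1 le_rfl h2]
  · linarith [key b hb h1 le_rfl h2]
  · linarith [key c hc h3 h2 le_rfl]
  · linarith [key a ha le_rfl h1 h3]
  · linarith [key a ha le_rfl h1 (h2.trans h1)]
  · linarith [key a ha le_rfl h1 h3]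

lemma bell_nonneg {δ X Y : ℝ} (hδ : 0 ≤ δ) (hY : 0 ≤ Y) : 0 ≤ bell δ X Y := by
  unfold bell; positivity

lemma mul_sqrt_eq_rpow {a : ℝ} (ha : 0 ≤ a) : a * √a = a ^ (3 / 2 : ℝ) := by
  rw [← sqrt_pow_three_eq_rpow ha, pow_succ, Real.sq_sqrt ha]

lemma bell_le {δ X Y : ℝ} (hδ : 0 ≤ δ) (hY : 0 ≤ Y) :
    bell δ X Y ≤ 12 * (|X| ^ (3 : ℝ) + |Y| ^ (3 / 2 : ℝ) + δ * √δ) := by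
  have h1 := mul_sqrt_le_add (sq_nonneg X) hY hδ
  have h2 := mul_sqrt_le_add le_rfl hY hδ
  have h3 : X ^ 2 * √(X ^ 2) = |X| ^ (3 : ℝ) := by
    rw [Real.sqrt_sq_eq_abs, ← sq_abs]
    norm_cast
  rw [h3] at h1
  rw [abs_of_nonneg hY, ← mul_sqrt_eq_rpow hY]
  simp only [zero_add, zero_mul] at h2
  have : 0 ≤ |X| ^ (3 : ℝ) := by positivity
  unfold bell
  linarith

lemma contDiff_bell {δ : ℝ} (hδ : 0 < δ) {X Y : E3 → ℝ} (hX : ContDiff ℝ ∞ X)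
    (hY : ContDiff ℝ ∞ Y) (hY0 : ∀ x, 0 ≤ Y x) : ContDiff ℝ ∞ fun x => bell δ (X x) (Y x) := by
  refine (contDiff_mul_sqrt (((hX.pow 2).add hY).add contDiff_const) fun x => ?_).add
    (contDiff_mul_sqrt (hY.add contDiff_const) fun x => ?_)
  · have := hY0 x
    positivity
  · have := hY0 x
    positivity

lemma le_lap_bell {δ : ℝ} (hδ : 0 < δ) {X Y : E3 → ℝ} (hX : ContDiff ℝ ∞ X)
    (hY : ContDiff ℝ ∞ Y) (hY0 : ∀ x, 0 ≤ Y x) (i j : Fin 3) (x : E3) :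
    3 / 2 * √(X x ^ 2 + Y x + δ) * (2 * X x * lap X x + lap Y x) +
      3 / 2 * √(Y x + δ) * lap Y x + 3 * (|pd i Y x| * |pd j X x|) ≤
      lap (fun x => bell δ (X x) (Y x)) x := by
  set S₁ : E3 → ℝ := fun x => X x ^ 2 + Y x + δ with hS₁
  set S₂ : E3 → ℝ := fun x => Y x + δ with hS₂
  have c₁ : ContDiff ℝ ∞ S₁ := ((hX.pow 2).add hY).add contDiff_const
  have c₂ : ContDiff ℝ ∞ S₂ := hY.add contDiff_const
  have p₁ : ∀ x, 0 < S₁ x := fun x => by have := hY0 x; positivity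
  have p₂ : ∀ x, 0 < S₂ x := fun x => by have := hY0 x; positivity
  have d₁ : ∀ j, pd j S₁ = fun x => 2 * X x * pd j X x + pd j Y x := by
    intro j
    rw [hS₁, pd_add_const δ j,
      pd_add (hX.pow 2).differentiable_infty hY.differentiable_infty]
    have : (fun x => X x ^ 2) = fun x => X x * X x := by ext; ring
    rw [this, pd_mul hX.differentiable_infty hX.differentiable_infty]
    ext x
    ring
  have d₂ : ∀ j, pd j S₂ = pd j Y := fun j => pd_add_const δ j
  have l₁ : lap S₁ x = 2 * X x * lap X x + lap Y x + 2 * ∑ j, pd j X x ^ 2 := by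
    simp only [lap, d₁, Finset.mul_sum, ← Finset.sum_add_distrib]
    refine Finset.sum_congr rfl fun j _ => ?_
    have h2X : ContDiff ℝ ∞ fun x => 2 * X x := contDiff_const.mul hX
    rw [pd_add (h2X.mul (hX.pd j)).differentiable_infty (hY.pd j).differentiable_infty,
      pd_mul h2X.differentiable_infty (hX.pd j).differentiable_infty,
      pd_const_mul hX.differentiable_infty]
    ring
  have l₂ : lap S₂ x = lap Y x := by simp only [lap, d₂]
  have e : lap (fun x => bell δ (X x) (Y x)) x =
      lap (fun x => S₁ x * √(S₁ x)) x + lap (fun x => S₂ x * √(S₂ x)) x := by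
    have f₁ := contDiff_mul_sqrt c₁ p₁
    have f₂ := contDiff_mul_sqrt c₂ p₂
    simp only [lap, ← Finset.sum_add_distrib]
    refine Finset.sum_congr rfl fun j _ => ?_
    rw [show (fun x => bell δ (X x) (Y x)) =
      fun x => S₁ x * √(S₁ x) + S₂ x * √(S₂ x) from rfl,
      pd_add f₁.differentiable_infty f₂.differentiable_infty,
      pd_add (f₁.pd j).differentiable_infty (f₂.pd j).differentiable_infty]
  rw [e, lap_mul_sqrt c₁ p₁, lap_mul_sqrt c₂ p₂, l₁, l₂]
  have q₁ : 0 < √(S₁ x) := Real.sqrt_pos.mpr (p₁ x)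
  have q₂ : 0 < √(S₂ x) := Real.sqrt_pos.mpr (p₂ x)
  have q₁₂ : √(S₂ x) ≤ √(S₁ x) := Real.sqrt_le_sqrt (by simp only [hS₁, hS₂]; nlinarith [sq_nonneg (X x)])
  have t₁ : 0 ≤ 3 / 4 / √(S₁ x) * ∑ j, pd j S₁ x ^ 2 := by positivity
  have t₂ : pd j X x ^ 2 ≤ ∑ j, pd j X x ^ 2 :=
    Finset.single_le_sum (f := fun j => pd j X x ^ 2) (fun j _ => sq_nonneg _) (Finset.mem_univ j)
  have t₃ : pd i Y x ^ 2 ≤ ∑ j, pd j S₂ x ^ 2 := by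
    simp only [d₂]
    exact Finset.single_le_sum (f := fun j => pd j Y x ^ 2) (fun j _ => sq_nonneg _)
      (Finset.mem_univ i)
  have t₄ : 3 * (|pd i Y x| * |pd j X x|) ≤
      3 * √(S₁ x) * pd j X x ^ 2 + 3 / 4 / √(S₂ x) * pd i Y x ^ 2 := by
    have h1 : 3 * √(S₂ x) * pd j X x ^ 2 ≤ 3 * √(S₁ x) * pd j X x ^ 2 := by gcongr
    have h2 : 3 * √(S₂ x) * pd j X x ^ 2 + 3 / 4 / √(S₂ x) * pd i Y x ^ 2 -
        3 * (|pd i Y x| * |pd j X x|) =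
        3 / √(S₂ x) * (√(S₂ x) * |pd j X x| - |pd i Y x| / 2) ^ 2 := by
      rw [← sq_abs (pd j X x), ← sq_abs (pd i Y x)]
      field_simp
      ring
    have h3 : 0 ≤ 3 / √(S₂ x) * (√(S₂ x) * |pd j X x| - |pd i Y x| / 2) ^ 2 := by positivity
    linarith
  have t₅ : 3 * √(S₁ x) * pd j X x ^ 2 ≤ 3 * √(S₁ x) * ∑ j, pd j X x ^ 2 := by gcongr
  have t₆ : 3 / 4 / √(S₂ x) * pd i Y x ^ 2 ≤ 3 / 4 / √(S₂ x) * ∑ j, pd j S₂ x ^ 2 := by gcongr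
  have t₇ : √(X x ^ 2 + Y x + δ) = √(S₁ x) := rfl
  have t₈ : √(Y x + δ) = √(S₂ x) := rfl
  rw [t₇, t₈]
  linarith

end Bellman

section FlowEstimate

lemma hasDerivAt_integral_cutoff {η : E3 → ℝ} (hη : Continuous η) (hηc : HasCompactSupport η)
    {b b' : ℝ → E3 → ℝ} (hb : ∀ σ, Continuous (b σ))
    (hb' : ContinuousOn (Function.uncurry b') (Set.Ioi 0 ×ˢ Set.univ))
    (hd : ∀ σ, 0 < σ → ∀ x, HasDerivAt (fun s => b s x) (b' σ x) σ) {σ : ℝ} (hσ : 0 < σ) :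
    HasDerivAt (fun s => ∫ x, η x * b s x) (∫ x, η x * b' σ x) σ := by
  obtain ⟨M, hM⟩ := (isCompact_Icc (a := σ / 2) (b := 2 * σ)).prod hηc.isCompact
    |>.exists_bound_of_continuousOn (f := Function.uncurry b') (hb'.mono (by
      rintro ⟨s, x⟩ ⟨hs, -⟩
      exact ⟨lt_of_lt_of_le (by linarith) hs.1, trivial⟩))
  refine (hasDerivAt_integral_of_dominated_loc_of_deriv_le (μ := (volume : Measure E3))
    (F := fun s x => η x * b s x) (F' := fun s x => η x * b' s x)
    (x₀ := σ) (s := Set.Ioo (σ / 2) (2 * σ)) (bound := fun x => |η x| * M)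
    (Ioo_mem_nhds (by linarith) (by linarith))
    (Eventually.of_forall fun s => (hη.mul (hb s)).aestronglyMeasurable)
    ((hη.mul (hb σ)).integrable_of_hasCompactSupport hηc.mul_right)
    ?_ (Eventually.of_forall fun z s hs => ?_)
    ((hη.abs.integrable_of_hasCompactSupport (hηc.comp_left (g := abs) abs_zero)).mul_const M)
    (Eventually.of_forall fun z s hs => (hd s (by linarith [hs.1]) z).const_mul (η z))).2
  · refine (hη.mul ?_).aestronglyMeasurable
    exact hb'.comp_continuous (f := fun x : E3 => (σ, x)) (by fun_prop) fun x => ⟨hσ, trivial⟩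
  · rw [norm_mul, Real.norm_eq_abs]
    by_cases hz : z ∈ tsupport η
    · exact mul_le_mul_of_nonneg_left (hM (s, z) ⟨⟨hs.1.le, hs.2.le⟩, hz⟩) (abs_nonneg _)
    · simp [image_eq_zero_of_notMem_tsupport hz]

variable {g y : E3 → ℝ}

/-- The Bellman function along the heat flow controls a localized bilinear expression. -/
lemma heat_flow_bilinear_cutoff (hg : ContDiff ℝ ∞ g) (hgc : HasCompactSupport g)
    (hy : ContDiff ℝ ∞ y) (hyc : HasCompactSupport y) (hy0 : ∀ x, 0 ≤ y x)
    {η : E3 → ℝ} (hη : ContDiff ℝ ∞ η) (hηc : HasCompactSupport η) (hη0 : ∀ x, 0 ≤ η x)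
    (hη1 : ∀ x, η x ≤ 1) {L : ℝ} (hL : ∀ x, |lap η x| ≤ L) {δ : ℝ} (hδ : 0 < δ) (i j : Fin 3)
    {a b : ℝ} (ha : 0 < a) (hab : a ≤ b) :
    ∫ σ in a..b, 1 / (4 * σ ^ 2) *
        (3 * ∫ x, η x * (|cv (heatK σ) (pd i y) x| * |cv (heatK σ) (pd j g) x|)) ≤
      12 * (((∫ x, |g x| ^ (3 : ℝ)) + ∫ x, |y x| ^ (3 / 2 : ℝ)) + δ * √δ * ∫ x, η x) +
      (b - a) * (1 / (4 * a ^ 2) * (12 * (L * ((∫ x, |g x| ^ (3 : ℝ)) + ∫ x, |y x| ^ (3 / 2 : ℝ)) +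
        δ * √δ * ∫ x, |lap η x|))) := by
  set X : ℝ → E3 → ℝ := fun σ x => cv (heatK σ) g x with hX
  set Y : ℝ → E3 → ℝ := fun σ x => cv (heatK σ) y x with hY
  set M₀ : ℝ := (∫ x, |g x| ^ (3 : ℝ)) + ∫ x, |y x| ^ (3 / 2 : ℝ) with hM₀
  set D : ℝ := 12 * (L * M₀ + δ * √δ * ∫ x, |lap η x|) with hD
  have heat0 : ∀ σ z, 0 ≤ heatK σ z := fun σ z => by unfold heatK; positivity
  have Y0 : ∀ σ x, 0 ≤ Y σ x := fun σ x =>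
    integral_nonneg fun z => mul_nonneg (heat0 σ _) (hy0 z)
  have cX : ∀ σ, ContDiff ℝ ∞ (X σ) := fun σ => contDiff_cv (contDiff_heatK σ).continuous hg hgc
  have cY : ∀ σ, ContDiff ℝ ∞ (Y σ) := fun σ => contDiff_cv (contDiff_heatK σ).continuous hy hyc
  have cb : ∀ σ, ContDiff ℝ ∞ fun x => bell δ (X σ x) (Y σ x) := fun σ =>
    contDiff_bell hδ (cX σ) (cY σ) (Y0 σ)
  have jX : Continuous fun q : ℝ × E3 => cv (heatK q.1) g q.2 := continuous_heat_flow hg hgc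
  have jY : Continuous fun q : ℝ × E3 => cv (heatK q.1) y q.2 := continuous_heat_flow hy hyc
  have jlX := continuous_heat_flow hg.lap hgc.lap
  have jlY := continuous_heat_flow hy.lap hyc.lap
  have jdX := continuous_heat_flow (hg.pd j) (hgc.pd j)
  have jdY := continuous_heat_flow (hy.pd i) (hyc.pd i)
  set b' : ℝ → E3 → ℝ := fun σ x =>
    3 / 2 * √(X σ x ^ 2 + Y σ x + δ) *
      (2 * X σ x * (-(1 / (4 * σ ^ 2)) * cv (heatK σ) (lap g) x) +
        -(1 / (4 * σ ^ 2)) * cv (heatK σ) (lap y) x) +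
      3 / 2 * √(Y σ x + δ) * (-(1 / (4 * σ ^ 2)) * cv (heatK σ) (lap y) x) with hb'
  have hderiv : ∀ σ : ℝ, 0 < σ → ∀ x, HasDerivAt (fun s => bell δ (X s x) (Y s x)) (b' σ x) σ := by
    intro σ hσ x
    have hXd : HasDerivAt (fun s => X s x) _ σ := hasDerivAt_heat_flow hg hgc hσ x
    have hYd : HasDerivAt (fun s => Y s x) _ σ := hasDerivAt_heat_flow hy hyc hσ x
    have h₂ : HasDerivAt (fun s => Y s x + δ) _ σ := hYd.add_const δ
    have h₁ : HasDerivAt (fun s => X s x ^ 2 + Y s x + δ) _ σ :=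
      ((hXd.fun_pow 2).fun_add hYd).add_const δ
    have r₁ : 0 < X σ x ^ 2 + Y σ x + δ := by have := Y0 σ x; positivity
    have r₂ : 0 < Y σ x + δ := by have := Y0 σ x; positivity
    refine (((hasDerivAt_mul_sqrt r₁).comp σ h₁).add
      ((hasDerivAt_mul_sqrt r₂).comp σ h₂)).congr_deriv ?_
    simp only [hb', Nat.cast_ofNat, Nat.add_one_sub_one, pow_one]
  have hb'cont : ContinuousOn (Function.uncurry b') (Set.Ioi 0 ×ˢ Set.univ) := by
    have hs : ContinuousOn (fun q : ℝ × E3 => -(1 / (4 * q.1 ^ 2))) (Set.Ioi 0 ×ˢ Set.univ) := by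
      refine (ContinuousOn.div continuousOn_const (by fun_prop) ?_).neg
      rintro ⟨s, x⟩ ⟨hs, -⟩
      have : 0 < s := hs
      positivity
    have e : Function.uncurry b' = fun q : ℝ × E3 =>
        3 / 2 * √(cv (heatK q.1) g q.2 ^ 2 + cv (heatK q.1) y q.2 + δ) *
        (2 * cv (heatK q.1) g q.2 * (-(1 / (4 * q.1 ^ 2)) * cv (heatK q.1) (lap g) q.2) +
        -(1 / (4 * q.1 ^ 2)) * cv (heatK q.1) (lap y) q.2) +
      3 / 2 * √(cv (heatK q.1) y q.2 + δ) *
        (-(1 / (4 * q.1 ^ 2)) * cv (heatK q.1) (lap y) q.2) := rfl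
    rw [e]
    have a1 := jX.continuousOn (s := Set.Ioi 0 ×ˢ Set.univ)
    have a2 := jY.continuousOn (s := Set.Ioi 0 ×ˢ Set.univ)
    have a3 := jlX.continuousOn (s := Set.Ioi 0 ×ˢ Set.univ)
    have a4 := jlY.continuousOn (s := Set.Ioi 0 ×ˢ Set.univ)
    fun_prop
  have hΦ : ∀ σ : ℝ, 0 < σ → HasDerivAt (fun s => ∫ x, η x * bell δ (X s x) (Y s x))
      (∫ x, η x * b' σ x) σ := fun σ hσ =>
    hasDerivAt_integral_cutoff hη.continuous hηc (fun σ => (cb σ).continuous) hb'cont hderiv hσ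
  have lpX := fun (σ : ℝ) (hσ : 0 < σ) =>
    integral_abs_cv_heatK_rpow_le hg hgc (p := 3) (by norm_num) hσ
  have lpY := fun (σ : ℝ) (hσ : 0 < σ) =>
    integral_abs_cv_heatK_rpow_le hy hyc (p := 3 / 2) (by norm_num) hσ
  have hM₀0 : 0 ≤ M₀ := add_nonneg (integral_nonneg fun x => by positivity)
    (integral_nonneg fun x => by positivity)
  have hint : ∀ (w : E3 → ℝ), Continuous w → HasCompactSupport w → (∀ x, 0 ≤ w x) → ∀ l : ℝ,
      (∀ x, w x ≤ l) → ∀ σ : ℝ, 0 < σ →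
      ∫ x, w x * bell δ (X σ x) (Y σ x) ≤ 12 * (l * M₀ + δ * √δ * ∫ x, w x) := by
    intro w hw hwc hw0 l hl σ hσ
    have hl0 : 0 ≤ l := (hw0 0).trans (hl 0)
    have hwi := hw.integrable_of_hasCompactSupport (μ := volume) hwc
    have hI : Integrable fun x => (12 * l) * |X σ x| ^ (3 : ℝ) + (12 * l) * |Y σ x| ^ (3 / 2 : ℝ) :=
      ((lpX σ hσ).1.const_mul (12 * l)).add ((lpY σ hσ).1.const_mul (12 * l))
    have hI' := hwi.const_mul (12 * (δ * √δ))
    calc ∫ x, w x * bell δ (X σ x) (Y σ x) ≤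
        ∫ x, ((12 * l) * |X σ x| ^ (3 : ℝ) + (12 * l) * |Y σ x| ^ (3 / 2 : ℝ)) +
          (12 * (δ * √δ)) * w x := by
          refine integral_mono
            ((hw.mul (cb σ).continuous).integrable_of_hasCompactSupport hwc.mul_right)
            (hI.add hI') fun x => ?_
          have h1 := bell_le (X := X σ x) hδ.le (Y0 σ x)
          have h2 := mul_le_mul_of_nonneg_left h1 (hw0 x)
          have h3 : w x * (|X σ x| ^ (3 : ℝ) + |Y σ x| ^ (3 / 2 : ℝ)) ≤
              l * (|X σ x| ^ (3 : ℝ) + |Y σ x| ^ (3 / 2 : ℝ)) := by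
            gcongr
            exact hl x
          dsimp only
          linarith
      _ = 12 * l * (∫ x, |X σ x| ^ (3 : ℝ)) + 12 * l * (∫ x, |Y σ x| ^ (3 / 2 : ℝ)) +
          12 * (δ * √δ) * ∫ x, w x := by
          rw [integral_add hI hI', integral_const_mul]
          congr 1
          rw [integral_add ((lpX σ hσ).1.const_mul (12 * l)) ((lpY σ hσ).1.const_mul (12 * l)),
            integral_const_mul, integral_const_mul]
      _ ≤ _ := by
          have h1 := (lpX σ hσ).2
          have h2 := (lpY σ hσ).2
          have h3 : 12 * l * (∫ x, |X σ x| ^ (3 : ℝ)) ≤ 12 * l * ∫ x, |g x| ^ (3 : ℝ) := by gcongr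
          have h4 : 12 * l * (∫ x, |Y σ x| ^ (3 / 2 : ℝ)) ≤
            12 * l * ∫ x, |y x| ^ (3 / 2 : ℝ) := by gcongr
          rw [hM₀]
          linarith
  set K : ℝ → ℝ := fun σ =>
    ∫ x, η x * (|cv (heatK σ) (pd i y) x| * |cv (heatK σ) (pd j g) x|) with hK
  have hKcont : Continuous K := by
    have e : ∀ σ, K σ = ∫ x in tsupport η,
        η x * (|cv (heatK σ) (pd i y) x| * |cv (heatK σ) (pd j g) x|) := by
      intro σ
      rw [hK]
      dsimp only
      rw [setIntegral_eq_integral_of_forall_compl_eq_zero]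
      intro z hz
      rw [image_eq_zero_of_notMem_tsupport hz, zero_mul]
    rw [show K = _ from funext e]
    refine continuous_parametric_integral_of_continuous ?_ hηc.isCompact
    have := hη.continuous
    unfold Function.uncurry
    fun_prop
  have hD0 : 0 ≤ D := by
    have hL0 : 0 ≤ L := (abs_nonneg _).trans (hL 0)
    have : 0 ≤ ∫ x, |lap η x| := integral_nonneg fun x => abs_nonneg _
    positivity
  have hmain := intervalIntegral.integral_le_sub_of_hasDeriv_right_of_le
    (g := fun s => ∫ x, η x * bell δ (X s x) (Y s x)) (g' := fun σ => ∫ x, η x * b' σ x)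
    (φ := fun σ => 1 / (4 * σ ^ 2) * (3 * K σ) - 1 / (4 * a ^ 2) * D) hab
    (fun σ hσ => (hΦ σ (ha.trans_le hσ.1)).continuousAt.continuousWithinAt)
    (fun σ hσ => (hΦ σ (ha.trans hσ.1)).hasDerivWithinAt)
    (by
      refine ContinuousOn.integrableOn_Icc ?_
      refine ((continuousOn_const.div (by fun_prop) fun σ hσ => ?_).mul
        (by fun_prop)).sub continuousOn_const
      have : 0 < σ := ha.trans_le hσ.1
      positivity)
    (by
      intro σ hσ
      have hσ0 : 0 < σ := ha.trans hσ.1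
      have h1 : ∫ x, η x * lap (fun x => bell δ (X σ x) (Y σ x)) x ≤ D := by
        calc ∫ x, η x * lap (fun x => bell δ (X σ x) (Y σ x)) x
            = ∫ x, lap (fun x => bell δ (X σ x) (Y σ x)) x * η x := by simp only [mul_comm]
          _ = ∫ x, bell δ (X σ x) (Y σ x) * lap η x := (integral_mul_lap (cb σ) hη hηc).symm
          _ ≤ ∫ x, |lap η x| * bell δ (X σ x) (Y σ x) := by
            refine integral_mono
              (((cb σ).mul hη.lap).integrable_of_compact hηc.lap.mul_left)
              ((hη.lap.continuous.abs.mul (cb σ).continuous).integrable_of_hasCompactSupport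
                (hηc.lap.comp_left (g := abs) abs_zero).mul_right) fun x => ?_
            dsimp only
            rw [mul_comm]
            exact mul_le_mul_of_nonneg_right (le_abs_self _) (bell_nonneg hδ.le (Y0 σ x))
          _ ≤ D := hint _ hη.lap.continuous.abs (hηc.lap.comp_left (g := abs) abs_zero)
            (fun x => abs_nonneg _) L hL σ hσ0
      have h2 : 1 / (4 * σ ^ 2) * (3 * K σ -
          ∫ x, η x * lap (fun x => bell δ (X σ x) (Y σ x)) x) ≤ ∫ x, η x * b' σ x := by
        have i1 : Integrable fun x =>
            η x * (|cv (heatK σ) (pd i y) x| * |cv (heatK σ) (pd j g) x|) := by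
          refine Continuous.integrable_of_hasCompactSupport ?_ hηc.mul_right
          have q1 := (contDiff_cv (contDiff_heatK σ).continuous (hy.pd i) (hyc.pd i)).continuous
          have q2 := (contDiff_cv (contDiff_heatK σ).continuous (hg.pd j) (hgc.pd j)).continuous
          exact hη.continuous.mul (q1.abs.mul q2.abs)
        have i2 : Integrable fun x => η x * lap (fun x => bell δ (X σ x) (Y σ x)) x :=
          (hη.mul (cb σ).lap).integrable_of_compact hηc.mul_right
        rw [hK]
        dsimp only
        rw [← integral_const_mul, ← integral_sub (i1.const_mul 3) i2, ← integral_const_mul]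
        refine integral_mono (((i1.const_mul 3).sub i2).const_mul _) ?_ fun x => ?_
        · refine Continuous.integrable_of_hasCompactSupport ?_ hηc.mul_right
          exact hη.continuous.mul (hb'cont.comp_continuous (f := fun x : E3 => (σ, x))
            (by fun_prop) fun x => ⟨hσ0, trivial⟩)
        · have h3 := le_lap_bell hδ (cX σ) (cY σ) (Y0 σ) i j x
          have e1 : lap (X σ) x = cv (heatK σ) (lap g) x :=
            congrFun (lap_cv (contDiff_heatK σ).continuous hg hgc) x
          have e2 : lap (Y σ) x = cv (heatK σ) (lap y) x :=
            congrFun (lap_cv (contDiff_heatK σ).continuous hy hyc) x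
          have e3 : pd i (Y σ) x = cv (heatK σ) (pd i y) x :=
            congrFun (pd_cv (contDiff_heatK σ).continuous hy hyc i) x
          have e4 : pd j (X σ) x = cv (heatK σ) (pd j g) x :=
            congrFun (pd_cv (contDiff_heatK σ).continuous hg hgc j) x
          rw [e1, e2, e3, e4] at h3
          have h4 := mul_le_mul_of_nonneg_left h3
            (show 0 ≤ η x * (1 / (4 * σ ^ 2)) from mul_nonneg (hη0 x) (by positivity))
          simp only [hb']
          linarith
      have h5 : 1 / (4 * σ ^ 2) * ∫ x, η x * lap (fun x => bell δ (X σ x) (Y σ x)) x ≤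
          1 / (4 * a ^ 2) * D := by
        have h6 : 1 / (4 * σ ^ 2) ≤ 1 / (4 * a ^ 2) := by
          have := hσ.1.le
          gcongr
        exact (mul_le_mul_of_nonneg_left h1 (by positivity)).trans
          (mul_le_mul_of_nonneg_right h6 hD0)
      linarith)
  have hKi : IntervalIntegrable (fun σ => 1 / (4 * σ ^ 2) * (3 * K σ)) volume a b := by
    refine ContinuousOn.intervalIntegrable ?_
    rw [Set.uIcc_of_le hab]
    refine (continuousOn_const.div (by fun_prop) fun σ hσ => ?_).mul (by fun_prop)
    have : 0 < σ := ha.trans_le hσ.1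
    positivity
  rw [intervalIntegral.integral_sub hKi intervalIntegrable_const,
    intervalIntegral.integral_const, smul_eq_mul] at hmain
  have hb := hint η hη.continuous hηc hη0 1 hη1 b (ha.trans_le hab)
  have ha' : 0 ≤ ∫ x, η x * bell δ (X a x) (Y a x) :=
    integral_nonneg fun x => mul_nonneg (hη0 x) (bell_nonneg hδ.le (Y0 a x))
  rw [one_mul] at hb
  linarith

end FlowEstimate

section FlowLimit

lemma continuous_integral_cutoff {η : E3 → ℝ} (hη : Continuous η) (hηc : HasCompactSupport η)
    {F : ℝ → E3 → ℝ} (hF : Continuous F.uncurry) : Continuous fun σ => ∫ x, η x * F σ x := by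
  have e : ∀ σ, ∫ x, η x * F σ x = ∫ x in tsupport η, η x * F σ x := by
    intro σ
    rw [setIntegral_eq_integral_of_forall_compl_eq_zero]
    intro z hz
    rw [image_eq_zero_of_notMem_tsupport hz, zero_mul]
  simp_rw [e]
  refine continuous_parametric_integral_of_continuous ?_ hηc.isCompact
  exact (hη.comp continuous_snd).mul hF

lemma exists_bound_of_compact {f : E3 → ℝ} (hf : Continuous f) (hc : HasCompactSupport f) :
    ∃ M, 0 ≤ M ∧ ∀ x, |f x| ≤ M := by
  obtain ⟨M, hM⟩ := hf.bounded_above_of_compact_support hc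
  exact ⟨M, (norm_nonneg _).trans (hM 0), hM⟩

/-- A standard cutoff function, equal to `1` on the ball of radius `r` and vanishing outside
the ball of radius `r + 1`. -/
def cut (r : {r : ℝ // 0 < r}) : ContDiffBump (0 : E3) := ⟨r, r + 1, r.2, by simp⟩

lemma contDiff_cut (r : {r : ℝ // 0 < r}) : ContDiff ℝ ∞ (cut r) := (cut r).contDiff

lemma hasCompactSupport_cut (r : {r : ℝ // 0 < r}) : HasCompactSupport (cut r) :=
  (cut r).hasCompactSupport

lemma cut_eq_one (r : {r : ℝ // 0 < r}) {x : E3} (hx : ‖x‖ ≤ r) : cut r x = 1 :=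
  (cut r).one_of_mem_closedBall (by simpa [cut] using hx)

lemma cut_eq_zero (r : {r : ℝ // 0 < r}) {x : E3} (hx : (r : ℝ) + 1 ≤ ‖x‖) : cut r x = 0 :=
  (cut r).zero_of_le_dist (by simpa [cut] using hx)

variable {g y : E3 → ℝ}

/-- The bilinear heat flow estimate. -/
lemma abs_integral_heat_flow_bilinear_le (hg : ContDiff ℝ ∞ g) (hgc : HasCompactSupport g)
    (hy : ContDiff ℝ ∞ y) (hyc : HasCompactSupport y) (hy0 : ∀ x, 0 ≤ y x) (i j : Fin 3)
    {a b : ℝ} (ha : 0 < a) (hab : a ≤ b) {w : ℝ → ℝ} (hw : Continuous w)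
    (hw1 : ∀ σ ∈ Set.Icc a b, |w σ| ≤ 1) :
    |∫ σ in a..b, w σ * (1 / (4 * σ ^ 2) *
        ∫ x, cv (heatK σ) (pd i y) x * cv (heatK σ) (pd j g) x)| ≤
      4 * ((∫ x, |g x| ^ (3 : ℝ)) + ∫ x, |y x| ^ (3 / 2 : ℝ)) := by
  set M₀ : ℝ := (∫ x, |g x| ^ (3 : ℝ)) + ∫ x, |y x| ^ (3 / 2 : ℝ) with hM₀
  set η : E3 → ℝ := ⇑(cut ⟨1, one_pos⟩) with hηdef
  have hη : ContDiff ℝ ∞ η := contDiff_cut _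
  have hηc : HasCompactSupport η := hasCompactSupport_cut _
  obtain ⟨L, hL0, hL⟩ := exists_bound_of_compact hη.lap.continuous hηc.lap
  obtain ⟨G, hG0, hG⟩ := exists_bound_of_compact (hg.pd j).continuous (hgc.pd j)
  have ct : ∀ t : ℝ, ContDiff ℝ ∞ fun x : E3 => η (t • x) := fun t =>
    hη.comp (contDiff_const_smul t)
  have ctc : ∀ t : ℝ, 0 < t → HasCompactSupport fun x : E3 => η (t • x) := fun t ht =>
    hηc.comp_smul ht.ne'
  set F : ℝ → E3 → ℝ := fun σ x => cv (heatK σ) (pd i y) x * cv (heatK σ) (pd j g) x with hF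
  have jF : Continuous F.uncurry :=
    (continuous_heat_flow (hy.pd i) (hyc.pd i)).mul (continuous_heat_flow (hg.pd j) (hgc.pd j))
  have sq_cont : ContinuousOn (fun σ : ℝ => 1 / (4 * σ ^ 2)) (Set.Icc a b) := by
    refine continuousOn_const.div (by fun_prop) fun σ hσ => ?_
    have : 0 < σ := ha.trans_le hσ.1
    positivity
  have kt : ∀ t : ℝ, 0 < t → Continuous fun σ => ∫ x, η (t • x) * F σ x := fun t ht =>
    continuous_integral_cutoff (ct t).continuous (ctc t ht) jF
  have Kt : ∀ t : ℝ, 0 < t → Continuous fun σ => ∫ x, η (t • x) * |F σ x| := fun t ht =>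
    continuous_integral_cutoff (ct t).continuous (ctc t ht) jF.abs
  have ht_scale : ∀ (f : E3 → ℝ) (t : ℝ), 0 < t → ∫ x, f (t • x) = (t ^ 3)⁻¹ * ∫ x, f x := by
    intro f t ht
    rw [Measure.integral_comp_smul, finrank_euclideanSpace_fin,
      abs_of_pos (by positivity), smul_eq_mul]
  have dY : ∀ σ : ℝ, 0 < σ → Integrable (fun x => |cv (heatK σ) (pd i y) x|) ∧
      ∫ x, |cv (heatK σ) (pd i y) x| ≤ ∫ x, |pd i y x| := by
    intro σ hσ
    simpa using integral_abs_cv_heatK_rpow_le (hy.pd i) (hyc.pd i) (p := 1) le_rfl hσ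
  have hFG : ∀ σ : ℝ, 0 < σ → ∀ x, |F σ x| ≤ |cv (heatK σ) (pd i y) x| * G := by
    intro σ hσ x
    rw [hF, abs_mul]
    exact mul_le_mul_of_nonneg_left (abs_cv_heatK_le hG hσ x) (abs_nonneg _)
  have hη01 : ∀ x, |η x| ≤ 1 := fun x => by
    rw [abs_of_nonneg (ContDiffBump.nonneg' _ _)]
    exact ContDiffBump.le_one _
  have hcut : ∀ (t : ℝ) (σ : ℝ), 0 < σ → ∀ x,
      ‖η (t • x) * F σ x‖ ≤ |cv (heatK σ) (pd i y) x| * G := by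
    intro t σ hσ x
    rw [norm_mul, Real.norm_eq_abs, Real.norm_eq_abs, ← one_mul (_ * G)]
    exact mul_le_mul (hη01 _) (hFG σ hσ x) (abs_nonneg _) zero_le_one
  have hlim : Tendsto (fun t : ℝ => ∫ σ in a..b, w σ * (1 / (4 * σ ^ 2) * ∫ x, η (t • x) * F σ x))
      (nhdsWithin 0 (Set.Ioi 0))
      (nhds (∫ σ in a..b, w σ * (1 / (4 * σ ^ 2) * ∫ x, F σ x))) := by
    refine intervalIntegral.tendsto_integral_filter_of_dominated_convergence
      (fun σ => 1 / (4 * σ ^ 2) * ((∫ x, |pd i y x|) * G)) ?_ ?_ ?_ ?_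
    · filter_upwards [self_mem_nhdsWithin] with t ht
      rw [Set.uIoc_of_le hab]
      exact (ContinuousOn.mul hw.continuousOn (sq_cont.mul (kt t ht).continuousOn)
        |>.aestronglyMeasurable measurableSet_Icc).mono_measure
          (Measure.restrict_mono Set.Ioc_subset_Icc_self le_rfl)
    · filter_upwards [self_mem_nhdsWithin] with t ht
      refine Eventually.of_forall fun σ hσ => ?_
      rw [Set.uIoc_of_le hab] at hσ
      have hσ0 : 0 < σ := ha.trans hσ.1
      have h1 : |∫ x, η (t • x) * F σ x| ≤ (∫ x, |pd i y x|) * G := by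
        refine (norm_integral_le_of_norm_le ((dY σ hσ0).1.mul_const G)
          (Eventually.of_forall (hcut t σ hσ0))).trans ?_
        rw [integral_mul_const]
        exact mul_le_mul_of_nonneg_right (dY σ hσ0).2 hG0
      rw [norm_mul, norm_mul, Real.norm_eq_abs, Real.norm_eq_abs, Real.norm_eq_abs,
        abs_of_nonneg (show 0 ≤ 1 / (4 * σ ^ 2) by positivity),
        ← one_mul (1 / (4 * σ ^ 2) * (_ * G))]
      exact mul_le_mul (hw1 σ ⟨hσ.1.le, hσ.2⟩) (mul_le_mul_of_nonneg_left h1 (by positivity))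
        (by positivity) zero_le_one
    · refine ContinuousOn.intervalIntegrable ?_
      rw [Set.uIcc_of_le hab]
      exact sq_cont.mul continuousOn_const
    · refine Eventually.of_forall fun σ hσ => ?_
      rw [Set.uIoc_of_le hab] at hσ
      have hσ0 : 0 < σ := ha.trans hσ.1
      refine (Tendsto.const_mul _ ?_).const_mul _
      refine tendsto_integral_filter_of_dominated_convergence
        (fun x => |cv (heatK σ) (pd i y) x| * G) ?_ ?_ ((dY σ hσ0).1.mul_const G) ?_
      · exact Eventually.of_forall fun t => ((ct t).continuous.mul
          (jF.comp (by fun_prop : Continuous fun x : E3 => (σ, x)))).aestronglyMeasurable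
      · exact Eventually.of_forall fun t => Eventually.of_forall (hcut t σ hσ0)
      · refine Eventually.of_forall fun x => ?_
        have h1 : Tendsto (fun t : ℝ => η (t • x)) (nhdsWithin 0 (Set.Ioi 0)) (nhds (η ((0 : ℝ) • x))) :=
          ((hη.continuous.comp (continuous_id.smul continuous_const)).tendsto 0).mono_left
            nhdsWithin_le_nhds
        rw [zero_smul, hηdef, cut_eq_one _ (by simp)] at h1
        simpa using h1.mul_const (F σ x)
  have hbound : Tendsto (fun t : ℝ => 1 / 3 * (12 * (M₀ + t ^ 3 * ∫ x, η x) +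
      (b - a) * (1 / (4 * a ^ 2) * (12 * (t ^ 2 * L * M₀ + t ^ 5 * ∫ x, |lap η x|)))))
      (nhdsWithin 0 (Set.Ioi 0)) (nhds (4 * M₀)) := by
    have h1 : Continuous (fun t : ℝ => 1 / 3 * (12 * (M₀ + t ^ 3 * ∫ x, η x) +
      (b - a) * (1 / (4 * a ^ 2) * (12 * (t ^ 2 * L * M₀ + t ^ 5 * ∫ x, |lap η x|))))) := by
      fun_prop
    convert! (h1.tendsto 0).mono_left nhdsWithin_le_nhds using 2
    simp only [ne_eq, OfNat.ofNat_ne_zero, not_false_eq_true, zero_pow, zero_mul, add_zero, mul_zero]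
    ring
  refine le_of_tendsto_of_tendsto hlim.abs hbound ?_
  filter_upwards [self_mem_nhdsWithin] with t ht
  have ht0 : (0 : ℝ) < t := ht
  have hlapη : lap (fun x => η (t • x)) = fun x => t ^ 2 * lap η (t • x) := lap_comp_smul hη t
  have h1 := heat_flow_bilinear_cutoff hg hgc hy hyc hy0 (ct t) (ctc t ht)
    (fun x => ContDiffBump.nonneg' _ _) (fun x => ContDiffBump.le_one _) (L := t ^ 2 * L)
    (fun x => by
      rw [hlapη, abs_mul, abs_of_nonneg (by positivity)]
      exact mul_le_mul_of_nonneg_left (hL _) (by positivity))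
    (δ := t ^ 4) (by positivity) i j ha hab
  have hsqrt : √(t ^ 4) = t ^ 2 := by
    rw [show t ^ 4 = (t ^ 2) ^ 2 by ring, Real.sqrt_sq (by positivity)]
  have hlapint : ∫ x, |lap (fun x => η (t • x)) x| = t ^ 2 * ((t ^ 3)⁻¹ * ∫ x, |lap η x|) := by
    rw [hlapη, ← ht_scale (fun x => |lap η x|) t ht, ← integral_const_mul]
    congr with x
    rw [abs_mul, abs_of_nonneg (by positivity)]
  rw [hlapint, hsqrt, ht_scale η t ht, ← hM₀] at h1
  have h2 : t ^ 4 * t ^ 2 * ((t ^ 3)⁻¹ * ∫ x, η x) = t ^ 3 * ∫ x, η x := by field_simp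
  have h3 : t ^ 4 * t ^ 2 * (t ^ 2 * ((t ^ 3)⁻¹ * ∫ x, |lap η x|)) = t ^ 5 * ∫ x, |lap η x| := by
    field_simp
  rw [h2, h3] at h1
  have h4 : |∫ σ in a..b, w σ * (1 / (4 * σ ^ 2) * ∫ x, η (t • x) * F σ x)| ≤
      ∫ σ in a..b, 1 / (4 * σ ^ 2) * ∫ x, η (t • x) * |F σ x| := by
    rw [← Real.norm_eq_abs]
    refine intervalIntegral.norm_integral_le_of_norm_le hab
      (Eventually.of_forall fun σ hσ => ?_) ?_
    · rw [norm_mul, norm_mul, Real.norm_eq_abs, Real.norm_eq_abs,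
        abs_of_nonneg (show 0 ≤ 1 / (4 * σ ^ 2) by positivity),
        ← one_mul (1 / (4 * σ ^ 2) * ∫ x, η (t • x) * |F σ x|)]
      refine mul_le_mul (hw1 σ ⟨hσ.1.le, hσ.2⟩) (mul_le_mul_of_nonneg_left ?_ (by positivity))
        (by positivity) zero_le_one
      refine (norm_integral_le_integral_norm (μ := (volume : Measure E3))
        (fun x => η (t • x) * F σ x)).trans (le_of_eq ?_)
      congr with x
      rw [norm_mul, Real.norm_eq_abs, Real.norm_eq_abs,
        abs_of_nonneg (ContDiffBump.nonneg' _ _)]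
    · refine ContinuousOn.intervalIntegrable ?_
      rw [Set.uIcc_of_le hab]
      exact sq_cont.mul (Kt t ht).continuousOn
  refine h4.trans ?_
  have h5 : ∫ σ in a..b, 1 / (4 * σ ^ 2) * ∫ x, η (t • x) * |F σ x| = 1 / 3 *
      ∫ σ in a..b, 1 / (4 * σ ^ 2) * (3 * ∫ x, η (t • x) *
        (|cv (heatK σ) (pd i y) x| * |cv (heatK σ) (pd j g) x|)) := by
    rw [← intervalIntegral.integral_const_mul]
    congr with σ
    simp only [hF, abs_mul]
    ring
  rw [h5]
  exact mul_le_mul_of_nonneg_left h1 (by norm_num)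

end FlowLimit

section Subordination

/-- The regularized Newtonian kernel (up to a multiplicative constant). -/
def newt (ε : ℝ) (z : E3) : ℝ := (√(‖z‖ ^ 2 + ε ^ 2))⁻¹

lemma newt_base_pos {ε : ℝ} (hε : 0 < ε) (z : E3) : 0 < ‖z‖ ^ 2 + ε ^ 2 := by positivity

lemma contDiff_newt {ε : ℝ} (hε : 0 < ε) : ContDiff ℝ ∞ (newt ε) := by
  have h1 : ContDiff ℝ ∞ fun z : E3 => ‖z‖ ^ 2 + ε ^ 2 :=
    (contDiff_norm_sq ℝ).add contDiff_const
  exact (h1.sqrt fun z => (newt_base_pos hε z).ne').inv fun z =>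
    (Real.sqrt_pos.mpr (newt_base_pos hε z)).ne'

/-- An unnormalized Gaussian, with `|σ|` so that it is bounded for every `σ`. -/
def gauss (σ : ℝ) (z : E3) : ℝ := rexp (-(|σ| / 2) * ‖z‖ ^ 2)

lemma gauss_nonneg (σ : ℝ) (z : E3) : 0 ≤ gauss σ z := (Real.exp_pos _).le

lemma gauss_le_one (σ : ℝ) (z : E3) : gauss σ z ≤ 1 := by
  unfold gauss
  rw [Real.exp_le_one_iff]
  have : 0 ≤ |σ| / 2 * ‖z‖ ^ 2 := by positivity
  linarith

/-- The weight in the subordination formula for the regularized Newtonian kernel. -/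
def subw (ε σ : ℝ) : ℝ := σ ^ (1 / 2 - 1 : ℝ) * rexp (-(ε ^ 2 / 2 * σ))

lemma integral_subw_mul {ε : ℝ} (hε : 0 < ε) (z : E3) :
    ∫ σ in Set.Ioi (0 : ℝ), subw ε σ * gauss σ z = √(2 * π) * newt ε z := by
  have h := Real.integral_rpow_mul_exp_neg_mul_Ioi (a := 1 / 2) (r := (‖z‖ ^ 2 + ε ^ 2) / 2)
    (by norm_num) (by positivity)
  have e : ∫ σ in Set.Ioi (0 : ℝ), subw ε σ * gauss σ z =
      ∫ t in Set.Ioi (0 : ℝ), t ^ (1 / 2 - 1 : ℝ) * rexp (-((‖z‖ ^ 2 + ε ^ 2) / 2 * t)) := by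
    refine setIntegral_congr_fun measurableSet_Ioi fun σ hσ => ?_
    have h0 : (0 : ℝ) < σ := hσ
    simp only [subw, gauss, abs_of_pos h0]
    rw [mul_assoc, ← Real.exp_add]
    congr 2
    ring
  rw [e, h, Real.Gamma_one_half_eq, ← Real.sqrt_eq_rpow, ← Real.sqrt_mul (by positivity), newt,
    ← Real.sqrt_inv, ← Real.sqrt_mul (by positivity)]
  congr 1
  field_simp

lemma integrableOn_subw {ε : ℝ} (hε : 0 < ε) : IntegrableOn (subw ε) (Set.Ioi 0) := by
  by_contra hcon
  have h := integral_subw_mul hε 0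
  have e : (fun σ => subw ε σ * gauss σ 0) = subw ε := by
    ext σ
    simp [gauss]
  rw [e, integral_undef hcon] at h
  have : 0 < √(2 * π) * newt ε 0 := by
    have := newt_base_pos hε 0
    unfold newt
    positivity
  linarith

variable {f h : E3 → ℝ}

lemma integral_cv_heatK_mul (hf : ContDiff ℝ ∞ f) (hfc : HasCompactSupport f)
    (hh : ContDiff ℝ ∞ h) (hhc : HasCompactSupport h) {σ : ℝ} (hσ : 0 < σ) :
    ∫ x, cv (heatK σ) f x * cv (heatK σ) h x =
      √(σ / (2 * π)) ^ 3 * ∫ a, f a * cv (gauss σ) h a := by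
  have key : ∀ (f : E3 → ℝ), ContDiff ℝ ∞ f → HasCompactSupport f → ∀ V : E3 → ℝ, Continuous V →
      (∃ M, ∀ x, |V x| ≤ M) →
      ∫ x, cv (heatK σ) f x * V x = ∫ a, f a * ∫ x, heatK σ (x - a) * V x := by
    rintro f hf hfc V hV ⟨M, hM⟩
    have h1 := ((hf.integrable_of_compact hfc).convolution_integrand
      (ContinuousLinearMap.mul ℝ ℝ) (integrable_heatK hσ)).mul_bdd (c := M)
      (hV.comp continuous_fst).aestronglyMeasurable (Eventually.of_forall fun q => hM q.1)
    calc ∫ x, cv (heatK σ) f x * V x = ∫ x, ∫ a, f a * heatK σ (x - a) * V x := by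
          congr with x
          rw [cv, ← integral_mul_const]
          congr with a
          ring
      _ = ∫ a, ∫ x, f a * heatK σ (x - a) * V x := integral_integral_swap h1
      _ = _ := by
          congr with a
          rw [← integral_const_mul]
          congr with x
          ring
  obtain ⟨M, -, hM⟩ := exists_bound_of_compact hh.continuous hhc
  rw [key f hf hfc _ (contDiff_cv (contDiff_heatK σ).continuous hh hhc).continuous
    ⟨M, fun x => abs_cv_heatK_le hM hσ x⟩, ← integral_const_mul]
  congr with a
  have e1 : ∫ x, heatK σ (x - a) * cv (heatK σ) h x =
      ∫ x, cv (heatK σ) h x * heatK σ (x - a) := by simp only [mul_comm]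
  rw [e1, key h hh hhc (fun x => heatK σ (x - a)) ((contDiff_heatK σ).continuous.comp (continuous_id.sub continuous_const))
    ⟨√(σ / π) ^ 3, fun x => by
      rw [abs_of_pos (heatK_pos hσ _)]; exact heatK_le hσ.le _⟩, mul_left_comm, cv,
    ← integral_const_mul (√(σ / (2 * π)) ^ 3)]
  congr with b
  rw [integral_heatK_mul_heatK hσ, gauss, abs_of_pos hσ, norm_sub_rev a b]
  ring

lemma continuous_cv_gauss (hh : ContDiff ℝ ∞ h) (hc : HasCompactSupport h) :
    Continuous fun q : ℝ × E3 => cv (gauss q.1) h q.2 := by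
  have h1 : ∀ q : ℝ × E3, cv (gauss q.1) h q.2 =
      ∫ z in tsupport h, gauss q.1 (q.2 - z) * h z := by
    intro q
    rw [cv, setIntegral_eq_integral_of_forall_compl_eq_zero]
    intro z hz
    rw [image_eq_zero_of_notMem_tsupport hz, mul_zero]
  simp_rw [h1]
  refine continuous_parametric_integral_of_continuous ?_ hc.isCompact
  have := hh.continuous
  unfold gauss Function.uncurry
  fun_prop

lemma abs_cv_gauss_le (hh : ContDiff ℝ ∞ h) (hc : HasCompactSupport h) (σ : ℝ) (x : E3) :
    |cv (gauss σ) h x| ≤ ∫ z, |h z| := by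
  rw [cv, ← Real.norm_eq_abs]
  refine norm_integral_le_of_norm_le (hh.integrable_of_compact hc).abs
    (Eventually.of_forall fun z => ?_)
  rw [norm_mul, Real.norm_of_nonneg (gauss_nonneg _ _)]
  exact mul_le_of_le_one_left (norm_nonneg _) (gauss_le_one _ _)

lemma cv_newt_eq (hh : ContDiff ℝ ∞ h) (hc : HasCompactSupport h) {ε : ℝ} (hε : 0 < ε) (a : E3) :
    √(2 * π) * cv (newt ε) h a = ∫ σ in Set.Ioi (0 : ℝ), subw ε σ * cv (gauss σ) h a := by
  have h1 := ((hh.integrable_of_compact hc).mul_prod (integrableOn_subw hε)).bdd_mul (c := 1)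
    (f := fun q : E3 × ℝ => gauss q.2 (a - q.1))
    (by
      refine Continuous.aestronglyMeasurable ?_
      unfold gauss
      fun_prop)
    (Eventually.of_forall fun q => by
      rw [Real.norm_of_nonneg (gauss_nonneg _ _)]
      exact gauss_le_one _ _)
  calc √(2 * π) * cv (newt ε) h a
      = ∫ b, ∫ σ in Set.Ioi (0 : ℝ), gauss σ (a - b) * (h b * subw ε σ) := by
        rw [cv, ← integral_const_mul]
        congr with b
        rw [← mul_assoc, ← integral_subw_mul hε, ← integral_mul_const]
        congr with σ
        ring
    _ = ∫ σ in Set.Ioi (0 : ℝ), ∫ b, gauss σ (a - b) * (h b * subw ε σ) :=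
        integral_integral_swap h1
    _ = _ := by
        congr with σ
        rw [cv, ← integral_const_mul]
        congr with b
        ring

lemma integral_mul_cv_newt (hf : ContDiff ℝ ∞ f) (hfc : HasCompactSupport f)
    (hh : ContDiff ℝ ∞ h) (hc : HasCompactSupport h) {ε : ℝ} (hε : 0 < ε) :
    IntegrableOn (fun σ => subw ε σ * ∫ a, f a * cv (gauss σ) h a) (Set.Ioi 0) ∧
    √(2 * π) * ∫ a, f a * cv (newt ε) h a =
      ∫ σ in Set.Ioi (0 : ℝ), subw ε σ * ∫ a, f a * cv (gauss σ) h a := by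
  have h1 := ((hf.integrable_of_compact hfc).mul_prod (integrableOn_subw hε)).bdd_mul
    (c := ∫ z, |h z|) (f := fun q : E3 × ℝ => cv (gauss q.2) h q.1)
    ((continuous_cv_gauss hh hc).comp continuous_swap).aestronglyMeasurable
    (Eventually.of_forall fun q => abs_cv_gauss_le hh hc _ _)
  have e : ∀ σ, ∫ a, cv (gauss σ) h a * (f a * subw ε σ) =
      subw ε σ * ∫ a, f a * cv (gauss σ) h a := by
    intro σ
    rw [← integral_const_mul]
    congr with a
    ring
  constructor
  · have h2 := h1.integral_prod_right
    simp only [e] at h2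
    exact h2
  · calc √(2 * π) * ∫ a, f a * cv (newt ε) h a
        = ∫ a, ∫ σ in Set.Ioi (0 : ℝ), cv (gauss σ) h a * (f a * subw ε σ) := by
          rw [← integral_const_mul]
          congr with a
          rw [mul_left_comm, cv_newt_eq hh hc hε, ← integral_const_mul]
          congr with σ
          ring
      _ = ∫ σ in Set.Ioi (0 : ℝ), ∫ a, cv (gauss σ) h a * (f a * subw ε σ) :=
          integral_integral_swap h1
      _ = _ := by simp only [e]

variable {g y : E3 → ℝ}

/-- The key bilinear estimate: second derivatives of the (regularized) Newtonian potential of `g`,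
tested against a nonnegative density `y`. -/
lemma abs_integral_mul_pd_pd_cv_newt_le (hg : ContDiff ℝ ∞ g) (hgc : HasCompactSupport g)
    (hy : ContDiff ℝ ∞ y) (hyc : HasCompactSupport y) (hy0 : ∀ x, 0 ≤ y x) (i j : Fin 3)
    {ε : ℝ} (hε : 0 < ε) :
    |∫ x, y x * pd i (pd j (cv (newt ε) g)) x| ≤
      32 * π * ((∫ x, |g x| ^ (3 : ℝ)) + ∫ x, |y x| ^ (3 / 2 : ℝ)) := by
  set M₀ : ℝ := (∫ x, |g x| ^ (3 : ℝ)) + ∫ x, |y x| ^ (3 / 2 : ℝ) with hM₀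
  have cW : ContDiff ℝ ∞ (cv (newt ε) g) := contDiff_cv (contDiff_newt hε).continuous hg hgc
  have e1 : ∫ x, y x * pd i (pd j (cv (newt ε) g)) x =
      -∫ x, pd i y x * cv (newt ε) (pd j g) x := by
    have h1 := integral_mul_pd (cW.pd j) hy hyc i
    have h2 : ∫ x, y x * pd i (pd j (cv (newt ε) g)) x =
      ∫ x, pd i (pd j (cv (newt ε) g)) x * y x := by simp only [mul_comm]
    rw [h2, ← neg_eq_iff_eq_neg, ← h1, pd_cv (contDiff_newt hε).continuous hg hgc]
    simp only [mul_comm]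
  rw [e1, abs_neg]
  obtain ⟨hI, hE⟩ := integral_mul_cv_newt (hy.pd i) (hyc.pd i) (hg.pd j) (hgc.pd j) hε
  set J : ℝ → ℝ := fun σ => subw ε σ * ∫ a, pd i y a * cv (gauss σ) (pd j g) a with hJ
  have hpi : 0 < √(2 * π) := by positivity
  have hJeq : ∀ σ : ℝ, 0 < σ → J σ = 4 * √(2 * π) ^ 3 * (rexp (-(ε ^ 2 / 2 * σ)) *
      (1 / (4 * σ ^ 2) * ∫ x, cv (heatK σ) (pd i y) x * cv (heatK σ) (pd j g) x)) := by
    intro σ hσ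
    have hs : 0 < √σ := Real.sqrt_pos.mpr hσ
    have hss : √σ * √σ = σ := Real.mul_self_sqrt hσ.le
    rw [integral_cv_heatK_mul (hy.pd i) (hyc.pd i) (hg.pd j) (hgc.pd j) hσ, hJ]
    simp only [subw]
    have h3 : σ ^ (1 / 2 - 1 : ℝ) = (√σ)⁻¹ := by
      rw [show (1 / 2 - 1 : ℝ) = -(1 / 2) by norm_num, Real.rpow_neg hσ.le, ← Real.sqrt_eq_rpow]
    have h4 : √(σ / (2 * π)) = √σ / √(2 * π) := Real.sqrt_div hσ.le _
    rw [h3, h4]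
    generalize (∫ a, pd i y a * cv (gauss σ) (pd j g) a) = I
    generalize rexp (-(ε ^ 2 / 2 * σ)) = E
    have h5 : σ ^ 2 = √σ ^ 4 := by rw [← hss]; simp only [Real.sqrt_mul_self hs.le]; ring
    rw [h5]
    field_simp
  have hbd : ∀ n : ℕ, |∫ σ in Set.Ioc (1 / ((n : ℝ) + 1)) ((n : ℝ) + 1), J σ| ≤
      4 * √(2 * π) ^ 3 * (4 * M₀) := by
    intro n
    have ha : 0 < 1 / ((n : ℝ) + 1) := by positivity
    have hab : 1 / ((n : ℝ) + 1) ≤ (n : ℝ) + 1 := by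
      rw [div_le_iff₀ (by positivity)]
      nlinarith [(Nat.cast_nonneg n : (0 : ℝ) ≤ n)]
    have h1 := abs_integral_heat_flow_bilinear_le hg hgc hy hyc hy0 i j ha hab
      (w := fun σ => rexp (-(ε ^ 2 / 2 * σ))) (by fun_prop) (fun σ hσ => by
        have : 0 < σ := ha.trans_le hσ.1
        rw [abs_of_pos (Real.exp_pos _), Real.exp_le_one_iff]
        have : 0 ≤ ε ^ 2 / 2 * σ := by positivity
        linarith)
    rw [intervalIntegral.integral_of_le hab] at h1
    rw [setIntegral_congr_fun measurableSet_Ioc fun σ hσ => hJeq σ (ha.trans hσ.1),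
      integral_const_mul, abs_mul, abs_of_pos (by positivity)]
    exact mul_le_mul_of_nonneg_left h1 (by positivity)
  have hmono : Monotone fun n : ℕ => Set.Ioc (1 / ((n : ℝ) + 1)) ((n : ℝ) + 1) := by
    intro n m hnm
    have : (n : ℝ) ≤ m := by exact_mod_cast hnm
    exact Set.Ioc_subset_Ioc (by gcongr) (by gcongr)
  have hunion : ⋃ n : ℕ, Set.Ioc (1 / ((n : ℝ) + 1)) ((n : ℝ) + 1) = Set.Ioi 0 := by
    ext σ
    simp only [Set.mem_iUnion, Set.mem_Ioc, Set.mem_Ioi]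
    constructor
    · rintro ⟨n, h1, -⟩
      exact lt_trans (by positivity) h1
    · intro hσ
      obtain ⟨n, hn⟩ := exists_nat_gt (max σ (1 / σ))
      have h1 := (le_max_left σ (1 / σ)).trans hn.le
      have h2 := (le_max_right σ (1 / σ)).trans_lt hn
      refine ⟨n, ?_, by linarith⟩
      rw [div_lt_iff₀ hσ] at h2
      rw [div_lt_iff₀ (by positivity)]
      nlinarith
  have hlim := tendsto_setIntegral_of_monotone (μ := volume) (f := J)
    (fun n : ℕ => measurableSet_Ioc) hmono (by rw [hunion]; exact hI)
  rw [hunion] at hlim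
  have h6 := le_of_tendsto hlim.abs (Eventually.of_forall hbd)
  rw [← hE, abs_mul, abs_of_pos hpi] at h6
  have h7 : √(2 * π) ^ 3 = √(2 * π) * (2 * π) := by
    rw [pow_succ', Real.sq_sqrt (by positivity)]
  rw [h7] at h6
  refine le_of_mul_le_mul_left (h6.trans (le_of_eq ?_)) hpi
  ring

end Subordination

section KernelSplitting

lemma newt_pos {ε : ℝ} (hε : 0 < ε) (z : E3) : 0 < newt ε z :=
  inv_pos.mpr (Real.sqrt_pos.mpr (newt_base_pos hε z))

lemma newt_sq_mul {ε : ℝ} (hε : 0 < ε) (z : E3) : newt ε z ^ 2 * (‖z‖ ^ 2 + ε ^ 2) = 1 := by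
  rw [newt, inv_pow, Real.sq_sqrt (newt_base_pos hε z).le,
    inv_mul_cancel₀ (newt_base_pos hε z).ne']

lemma pd_newt {ε : ℝ} (hε : 0 < ε) (j : Fin 3) :
    pd j (newt ε) = fun z => -(z j * newt ε z ^ 3) := by
  have hφ : ∀ z : E3, HasDerivAt (fun s : ℝ => (√(s + ε ^ 2))⁻¹)
      ((fun s : ℝ => -(1 / 2 * (√(s + ε ^ 2))⁻¹ ^ 3)) (‖z‖ ^ 2)) (‖z‖ ^ 2) := by
    intro z
    have hp := newt_base_pos hε z
    have h1 := (((hasDerivAt_id (‖z‖ ^ 2)).add_const (ε ^ 2)).sqrt hp.ne').inv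
      (Real.sqrt_pos.mpr hp).ne'
    have h0 : √(‖z‖ ^ 2 + ε ^ 2) ≠ 0 := (Real.sqrt_pos.mpr hp).ne'
    refine h1.congr_deriv ?_
    simp only [id_eq]
    field_simp
  have h := pd_eq_deriv_comp (f := fun z : E3 => ‖z‖ ^ 2) (φ := fun s : ℝ => (√(s + ε ^ 2))⁻¹)
    (φ' := fun s : ℝ => -(1 / 2 * (√(s + ε ^ 2))⁻¹ ^ 3))
    (contDiff_norm_sq ℝ : ContDiff ℝ ∞ _).differentiable_infty hφ j
  have e : newt ε = fun z : E3 => (√(‖z‖ ^ 2 + ε ^ 2))⁻¹ := rfl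
  rw [e, h, pd_norm_sq]
  ext z
  ring

lemma pd_newt_pow_three {ε : ℝ} (hε : 0 < ε) (j : Fin 3) :
    pd j (fun z => newt ε z ^ 3) = fun z => -(3 * z j * newt ε z ^ 5) := by
  have h := pd_eq_deriv_comp (φ := fun s => s ^ 3) (φ' := fun s => 3 * s ^ 2)
    (contDiff_newt hε).differentiable_infty
    (fun z => by simpa using hasDerivAt_pow 3 (newt ε z)) j
  rw [h, pd_newt hε]
  ext z
  ring

lemma lap_newt {ε : ℝ} (hε : 0 < ε) (z : E3) :
    lap (newt ε) z = -(3 * ε ^ 2 * newt ε z ^ 5) := by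
  have h1 : ∀ j, pd j (pd j (newt ε)) = fun z => -newt ε z ^ 3 + 3 * z j ^ 2 * newt ε z ^ 5 := by
    intro j
    rw [pd_newt hε, pd_neg (f := fun z => z j * newt ε z ^ 3),
      pd_mul (contDiff_coord j).differentiable_infty ((contDiff_newt hε).pow 3).differentiable_infty,
      pd_newt_pow_three hε, pd_coord]
    ext z
    simp
    ring
  simp only [lap, h1]
  have h2 := newt_sq_mul hε z
  have h3 : ‖z‖ ^ 2 = z 0 ^ 2 + z 1 ^ 2 + z 2 ^ 2 := by
    rw [EuclideanSpace.real_norm_sq_eq, Fin.sum_univ_three]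
  rw [Fin.sum_univ_three]
  rw [h3] at h2
  linear_combination (3 * newt ε z ^ 3) * h2

/-- A cutoff function equal to one on the unit ball and supported in the ball of radius two. -/
def unitCut : E3 → ℝ := ⇑(cut ⟨1, one_pos⟩)

lemma contDiff_unitCut : ContDiff ℝ ∞ unitCut := contDiff_cut _

lemma unitCut_eq_one {z : E3} (hz : ‖z‖ ≤ 1) : unitCut z = 1 := cut_eq_one _ hz

lemma unitCut_eq_zero {z : E3} (hz : 2 ≤ ‖z‖) : unitCut z = 0 :=
  cut_eq_zero _ (by norm_num; exact hz)

lemma unitCut_nonneg (z : E3) : 0 ≤ unitCut z := ContDiffBump.nonneg' _ _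

lemma unitCut_le_one (z : E3) : unitCut z ≤ 1 := ContDiffBump.le_one _

lemma hasCompactSupport_unitCut : HasCompactSupport unitCut := hasCompactSupport_cut _

/-- The part of the regularized Newtonian kernel near the origin. -/
def nearK (ε : ℝ) (z : E3) : ℝ := unitCut z * newt ε z

/-- The part of the regularized Newtonian kernel away from the origin. -/
def farK (ε : ℝ) (z : E3) : ℝ := (1 - unitCut z) * newt ε z

/-- A mollifier (up to normalization), the localized Laplacian of the regularized kernel. -/
def mollK (ε : ℝ) (z : E3) : ℝ := unitCut z * (3 * ε ^ 2 * newt ε z ^ 5)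

/-- The smooth remainder in the Laplacian of the localized kernel. -/
def remK (ε : ℝ) (z : E3) : ℝ := -lap (nearK ε) z - mollK ε z

lemma contDiff_nearK {ε : ℝ} (hε : 0 < ε) : ContDiff ℝ ∞ (nearK ε) :=
  contDiff_unitCut.mul (contDiff_newt hε)

lemma contDiff_farK {ε : ℝ} (hε : 0 < ε) : ContDiff ℝ ∞ (farK ε) :=
  (contDiff_const.sub contDiff_unitCut).mul (contDiff_newt hε)

lemma contDiff_mollK {ε : ℝ} (hε : 0 < ε) : ContDiff ℝ ∞ (mollK ε) :=
  contDiff_unitCut.mul (contDiff_const.mul ((contDiff_newt hε).pow 5))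

lemma contDiff_remK {ε : ℝ} (hε : 0 < ε) : ContDiff ℝ ∞ (remK ε) :=
  (contDiff_nearK hε).lap.neg.sub (contDiff_mollK hε)

lemma pd_eq_zero_of_norm_lt {f : E3 → ℝ} {r : ℝ} (hf : ∀ z, r < ‖z‖ → f z = 0) (j : Fin 3) {z : E3}
    (hz : r < ‖z‖) : pd j f z = 0 := by
  have h : f =ᶠ[nhds z] fun _ => 0 := by
    filter_upwards [(isOpen_lt continuous_const continuous_norm).mem_nhds hz] with y hy
    exact hf y hy
  rw [pd, h.fderiv_eq]
  simp

lemma lap_eq_zero_of_norm_lt {f : E3 → ℝ} {r : ℝ} (hf : ∀ z, r < ‖z‖ → f z = 0) {z : E3}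
    (hz : r < ‖z‖) : lap f z = 0 :=
  Finset.sum_eq_zero fun j _ =>
    pd_eq_zero_of_norm_lt (fun _ => pd_eq_zero_of_norm_lt hf j) j hz

lemma nearK_eq_zero {ε : ℝ} {z : E3} (hz : 2 < ‖z‖) : nearK ε z = 0 := by
  rw [nearK, unitCut_eq_zero hz.le, zero_mul]

lemma mollK_eq_zero {ε : ℝ} {z : E3} (hz : 2 < ‖z‖) : mollK ε z = 0 := by
  rw [mollK, unitCut_eq_zero hz.le, zero_mul]

lemma remK_eq_zero {ε : ℝ} {z : E3} (hz : 2 < ‖z‖) : remK ε z = 0 := by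
  rw [remK, lap_eq_zero_of_norm_lt (fun _ => nearK_eq_zero) hz, mollK_eq_zero hz, sub_zero, neg_zero]

lemma newt_eq_add (ε : ℝ) (z : E3) : newt ε z = nearK ε z + farK ε z := by
  rw [nearK, farK]; ring

lemma remK_eq {ε : ℝ} (hε : 0 < ε) (z : E3) :
    remK ε z = (1 - unitCut z) * (3 * ε ^ 2 * newt ε z ^ 5) + lap (farK ε) z := by
  have h : nearK ε = fun z => newt ε z - farK ε z := by
    ext z
    rw [newt_eq_add]; ring
  rw [remK, h, lap_sub (contDiff_newt hε) (contDiff_farK hε)]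
  simp only [lap_newt hε, mollK]
  ring

section Family

lemma ContDiff.pd_family {F : ℝ × E3 → ℝ} (hF : ContDiff ℝ ∞ F) (j : Fin 3) :
    ContDiff ℝ ∞ fun q : ℝ × E3 => _root_.pd j (fun x => F (q.1, x)) q.2 := by
  have h : (fun q : ℝ × E3 => _root_.pd j (fun x => F (q.1, x)) q.2) =
      fun q => fderiv ℝ F q (0, EuclideanSpace.single j 1) := by
    ext q
    have h1 : HasFDerivAt (fun x : E3 => (q.1, x)) (ContinuousLinearMap.inr ℝ ℝ E3) q.2 :=
      hasFDerivAt_prodMk_right q.1 q.2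
    have h2 := (hF.differentiable_infty (q.1, q.2)).hasFDerivAt.comp q.2 h1
    rw [_root_.pd]
    erw [h2.fderiv]
    simp
  rw [h]
  exact (hF.fderiv_right (m := ∞) (by simp)).clm_apply contDiff_const

lemma ContDiff.lap_family {F : ℝ × E3 → ℝ} (hF : ContDiff ℝ ∞ F) :
    ContDiff ℝ ∞ fun q : ℝ × E3 => _root_.lap (fun x => F (q.1, x)) q.2 := by
  unfold _root_.lap
  exact ContDiff.sum fun j _ => (hF.pd_family j).pd_family j

lemma exists_bound_family {F : ℝ × E3 → ℝ} (hF : Continuous F) (r : ℝ) :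
    ∃ C, 0 ≤ C ∧ ∀ ε, 0 ≤ ε → ε ≤ 1 → ∀ z : E3, ‖z‖ ≤ r → |F (ε, z)| ≤ C := by
  obtain ⟨C, hC⟩ := (isCompact_Icc.prod (isCompact_closedBall (0 : E3) r)).exists_bound_of_continuousOn
    (s := Set.Icc (0 : ℝ) 1 ×ˢ closedBall (0 : E3) r) hF.continuousOn
  refine ⟨max C 0, le_max_right _ _, fun ε h0 h1 z hz => (hC (ε, z) ⟨⟨h0, h1⟩, ?_⟩).trans
    (le_max_left _ _)⟩
  simpa using hz

lemma contDiff_one_sub_unitCut_mul {G : ℝ × E3 → ℝ}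
    (hG : ∀ q : ℝ × E3, q.2 ≠ 0 → ContDiffAt ℝ ∞ G q) :
    ContDiff ℝ ∞ fun q : ℝ × E3 => (1 - unitCut q.2) * G q := by
  rw [contDiff_iff_contDiffAt]
  intro q
  by_cases hq : q.2 = 0
  · have h : (fun q : ℝ × E3 => (1 - unitCut q.2) * G q) =ᶠ[nhds q] fun _ => 0 := by
      have ho : IsOpen {q : ℝ × E3 | ‖q.2‖ < 1} :=
        isOpen_lt continuous_snd.norm continuous_const
      filter_upwards [ho.mem_nhds (show ‖q.2‖ < 1 by simp [hq])] with y hy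
      rw [unitCut_eq_one (le_of_lt hy)]; ring
    exact contDiffAt_const.congr_of_eventuallyEq h
  · exact (contDiffAt_const.sub (contDiff_unitCut.comp contDiff_snd).contDiffAt).mul (hG q hq)

lemma contDiffAt_newt_family {q : ℝ × E3} (hq : q.2 ≠ 0) :
    ContDiffAt ℝ ∞ (fun q : ℝ × E3 => newt q.1 q.2) q := by
  have hp : 0 < ‖q.2‖ ^ 2 + q.1 ^ 2 := by
    have := norm_pos_iff.mpr hq
    positivity
  have h1 : ContDiffAt ℝ ∞ (fun q : ℝ × E3 => ‖q.2‖ ^ 2 + q.1 ^ 2) q :=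
    (((contDiff_norm_sq ℝ).comp contDiff_snd).add (contDiff_fst.pow 2)).contDiffAt
  exact (h1.sqrt hp.ne').inv (Real.sqrt_pos.mpr hp).ne'

lemma contDiff_farK_family : ContDiff ℝ ∞ fun q : ℝ × E3 => farK q.1 q.2 :=
  contDiff_one_sub_unitCut_mul fun _ => contDiffAt_newt_family

/-- Uniform bounds for the smooth parts of the kernel decomposition. -/
lemma exists_kernel_bound : ∃ C, 0 ≤ C ∧ ∀ ε, 0 < ε → ε ≤ 1 → ∀ z : E3, ‖z‖ ≤ 8 →
    (∀ i j, |pd i (pd j (farK ε)) z| ≤ C) ∧ (∀ j, |pd j (remK ε) z| ≤ C) ∧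
      |lap (remK ε) z| ≤ C := by
  have hF := contDiff_farK_family
  have hM : ContDiff ℝ ∞ fun q : ℝ × E3 =>
      (1 - unitCut q.2) * (3 * q.1 ^ 2 * newt q.1 q.2 ^ 5) + lap (fun x => farK q.1 x) q.2 := by
    refine ContDiff.add (contDiff_one_sub_unitCut_mul
      (G := fun q => 3 * q.1 ^ 2 * newt q.1 q.2 ^ 5) fun q hq => ?_)
      (ContDiff.lap_family (F := fun q => farK q.1 q.2) hF)
    exact (contDiff_const.mul (contDiff_fst.pow 2)).contDiffAt.mul
      ((contDiffAt_newt_family hq).pow 5)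
  have h1 := fun i j => exists_bound_family ((hF.pd_family j).pd_family i).continuous 8
  have h2 := fun j => exists_bound_family (hM.pd_family j).continuous 8
  obtain ⟨C₃, h30, h3⟩ := exists_bound_family hM.lap_family.continuous 8
  choose C₁ h10 h1 using h1
  choose C₂ h20 h2 using h2
  have s1 : ∀ i j, C₁ i j ≤ ∑ i, ∑ j, C₁ i j := fun i j =>
    (Finset.single_le_sum (f := fun j => C₁ i j) (fun j _ => h10 i j) (Finset.mem_univ j)).trans
      (Finset.single_le_sum (f := fun i => ∑ j, C₁ i j)
        (fun i _ => Finset.sum_nonneg fun j _ => h10 i j) (Finset.mem_univ i))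
  have s2 : ∀ j, C₂ j ≤ ∑ j, C₂ j := fun j =>
    Finset.single_le_sum (f := C₂) (fun j _ => h20 j) (Finset.mem_univ j)
  have p1 : 0 ≤ ∑ i, ∑ j, C₁ i j := Finset.sum_nonneg fun i _ => Finset.sum_nonneg fun j _ => h10 i j
  have p2 : 0 ≤ ∑ j, C₂ j := Finset.sum_nonneg fun j _ => h20 j
  refine ⟨(∑ i, ∑ j, C₁ i j) + (∑ j, C₂ j) + C₃, by positivity, fun ε hε hε1 z hz => ?_⟩
  have hr : remK ε = fun z =>
      (1 - unitCut z) * (3 * ε ^ 2 * newt ε z ^ 5) + lap (fun x => farK ε x) z :=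
    funext fun z => remK_eq hε z
  refine ⟨fun i j => ?_, fun j => ?_, ?_⟩
  · have := h1 i j ε hε.le hε1 z hz
    have h := s1 i j
    exact this.trans (by linarith)
  · have := h2 j ε hε.le hε1 z hz
    have h := s2 j
    rw [hr]
    exact this.trans (by linarith)
  · have := h3 ε hε.le hε1 z hz
    rw [hr]
    exact this.trans (by linarith)

end Family

section Mollifier

lemma mollK_nonneg {ε : ℝ} (hε : 0 < ε) (z : E3) : 0 ≤ mollK ε z := by
  have := newt_pos hε z
  have := unitCut_nonneg z
  unfold mollK
  positivity

lemma newt_smul {ε : ℝ} (hε : 0 < ε) (w : E3) : newt ε (ε • w) = ε⁻¹ * newt 1 w := by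
  rw [newt, newt, norm_smul, Real.norm_eq_abs, abs_of_pos hε]
  have : (ε * ‖w‖) ^ 2 + ε ^ 2 = ε ^ 2 * (‖w‖ ^ 2 + 1 ^ 2) := by ring
  rw [this, Real.sqrt_mul (by positivity), Real.sqrt_sq hε.le, mul_inv]

lemma integral_eq_smul (f : E3 → ℝ) {ε : ℝ} (hε : 0 < ε) :
    ∫ z, f z = ε ^ 3 * ∫ w, f (ε • w) := by
  rw [Measure.integral_comp_smul, finrank_euclideanSpace_fin,
    abs_of_pos (by positivity), smul_eq_mul, mul_inv_cancel_left₀ (by positivity)]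

lemma integrable_newt_one_pow_four : Integrable fun w : E3 => newt 1 w ^ 4 := by
  have h := integrable_rpow_neg_one_add_norm_sq (E := E3) (μ := volume) (r := 4)
    (by rw [finrank_euclideanSpace_fin]; norm_num)
  convert h using 2 with w
  rw [newt, inv_pow, show -(4 : ℝ) / 2 = -2 by norm_num, Real.rpow_neg (by positivity),
    show √(‖w‖ ^ 2 + 1 ^ 2) ^ 4 = (√(‖w‖ ^ 2 + 1 ^ 2) ^ 2) ^ 2 by ring,
    Real.sq_sqrt (by positivity)]
  norm_cast
  ring_nf

lemma norm_mul_newt_le {ε : ℝ} (hε : 0 < ε) (z : E3) : ‖z‖ * newt ε z ≤ 1 := by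
  rw [newt, ← div_eq_mul_inv, div_le_one (Real.sqrt_pos.mpr (newt_base_pos hε z))]
  exact Real.le_sqrt_of_sq_le (by nlinarith [sq_nonneg ε])

lemma integrable_mollK {ε : ℝ} (hε : 0 < ε) : Integrable (mollK ε) :=
  (contDiff_mollK hε).integrable_of_compact
    (hasCompactSupport_of_norm (r := 3) fun z hz => mollK_eq_zero (by linarith))

lemma exists_mollK_bounds : ∃ c K : ℝ, 0 < c ∧ 0 ≤ K ∧ ∀ ε, 0 < ε → ε ≤ 1 →
    c ≤ ∫ z, mollK ε z ∧ ∫ z, ‖z‖ * mollK ε z ≤ K * ε := by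
  have hpos : ∀ w : E3, 0 < newt 1 w := newt_pos one_pos
  have i4 := integrable_newt_one_pow_four
  refine ⟨∫ w in ball (0 : E3) 1, 3 * newt 1 w ^ 5, 3 * ∫ w : E3, newt 1 w ^ 4, ?_, ?_,
    fun ε hε hε1 => ⟨?_, ?_⟩⟩
  · have hc : Continuous fun w : E3 => 3 * newt 1 w ^ 5 :=
      continuous_const.mul ((contDiff_newt one_pos).continuous.pow 5)
    rw [setIntegral_pos_iff_support_of_nonneg_ae]
    · have : Function.support (fun w : E3 => 3 * newt 1 w ^ 5) = Set.univ :=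
        Set.eq_univ_of_forall fun w => by
          have := hpos w
          simp only [Function.mem_support]
          positivity
      rw [this, Set.univ_inter]
      exact measure_ball_pos _ _ one_pos
    · exact Eventually.of_forall fun w => by
        have := hpos w
        simp only [Pi.zero_apply]
        positivity
    · exact (hc.continuousOn.integrableOn_compact (isCompact_closedBall (0 : E3) 1)).mono_set
        ball_subset_closedBall
  · exact mul_nonneg (by norm_num) (integral_nonneg fun w => pow_nonneg (hpos w).le 4)
  · have e : ∀ w : E3, mollK ε (ε • w) = (ε ^ 3)⁻¹ * (unitCut (ε • w) * (3 * newt 1 w ^ 5)) := by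
      intro w
      rw [mollK, newt_smul hε]
      field_simp
    rw [integral_eq_smul _ hε]
    simp only [e]
    rw [integral_const_mul (ε ^ 3)⁻¹, mul_inv_cancel_left₀ (by positivity), ← integral_indicator measurableSet_ball]
    have hi : Integrable fun w : E3 => unitCut (ε • w) * (3 * newt 1 w ^ 5) := by
      have h1 := ((integrable_mollK hε).comp_smul hε.ne').const_mul (ε ^ 3)
      refine h1.congr (Eventually.of_forall fun w => ?_)
      simp only [e]
      rw [mul_inv_cancel_left₀ (by positivity)]
    refine integral_mono_of_nonneg (Eventually.of_forall fun w => ?_) hi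
      (Eventually.of_forall fun w => ?_)
    · have := hpos w
      exact Set.indicator_nonneg (fun w _ => by have := hpos w; positivity) w
    · have h5 := pow_pos (hpos w) 5
      by_cases hw : w ∈ ball (0 : E3) 1
      · simp only [Set.indicator_of_mem hw]
        rw [unitCut_eq_one, one_mul]
        rw [norm_smul, Real.norm_eq_abs, abs_of_pos hε]
        have : ‖w‖ < 1 := by simpa using hw
        nlinarith [norm_nonneg w]
      · simp only [Set.indicator_of_notMem hw]
        have := unitCut_nonneg (ε • w)
        positivity
  · rw [integral_eq_smul _ hε, mul_assoc, ← integral_mul_const, ← integral_const_mul,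
      ← integral_const_mul]
    refine integral_mono_of_nonneg (Eventually.of_forall fun w => ?_)
      ((i4.mul_const ε).const_mul 3) (Eventually.of_forall fun w => ?_)
    · have := mollK_nonneg hε (ε • w)
      simp only [Pi.zero_apply]
      positivity
    · simp only [mollK]
      rw [newt_smul hε, norm_smul, Real.norm_eq_abs, abs_of_pos hε]
      have h1 := norm_mul_newt_le one_pos w
      have h2 := unitCut_le_one (ε • w)
      have h3 := unitCut_nonneg (ε • w)
      have h4 := hpos w
      have h5 : ε ^ 3 * (ε * ‖w‖ * (unitCut (ε • w) * (3 * ε ^ 2 * (ε⁻¹ * newt 1 w) ^ 5))) =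
          (unitCut (ε • w) * (‖w‖ * newt 1 w)) * (3 * (newt 1 w ^ 4 * ε)) := by
        field_simp
      rw [h5]
      refine mul_le_of_le_one_left (by positivity) (mul_le_one₀ h2 (by positivity) h1)

end Mollifier

end KernelSplitting

section WeakForm

/-- The momentum flux `-ν Δ Uᵢ + (U · ∇) Uᵢ`. -/
def momentum (ν : ℝ) (U : Fin 3 → E3 → ℝ) (i : Fin 3) (x : E3) : ℝ :=
  -(ν * lap (U i) x) + ∑ j, U j x * pd j (U i) x

variable {ν : ℝ} {U : Fin 3 → E3 → ℝ} {P : E3 → ℝ}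

lemma contDiff_momentum (hU : ∀ i, ContDiff ℝ ∞ (U i)) (ν : ℝ) (i : Fin 3) :
    ContDiff ℝ ∞ (momentum ν U i) :=
  (contDiff_const.mul (hU i).lap).neg.add
    (ContDiff.sum fun j _ => (hU j).mul ((hU i).pd j))

lemma integrable_mul_of_compact {f V : E3 → ℝ} (hf : ContDiff ℝ ∞ f) (hV : ContDiff ℝ ∞ V)
    (hVc : HasCompactSupport V) : Integrable fun x => f x * V x :=
  (hf.mul hV).integrable_of_compact hVc.mul_left

lemma integral_momentum_mul (hU : ∀ i, ContDiff ℝ ∞ (U i))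
    (hdiv : ∀ x, ∑ j, pd j (U j) x = 0) (i : Fin 3) {V : E3 → ℝ} (hV : ContDiff ℝ ∞ V)
    (hVc : HasCompactSupport V) :
    ∫ x, momentum ν U i x * V x =
      -(ν * ∫ x, U i x * lap V x) - ∑ j, ∫ x, U i x * U j x * pd j V x := by
  have hc : ∀ j, ∫ x, U i x * U j x * pd j V x = -∫ x, pd j (fun x => U i x * U j x) x * V x :=
    fun j => integral_mul_pd ((hU i).mul (hU j)) hV hVc j
  have hs : ∀ x, ∑ j, pd j (fun x => U i x * U j x) x * V x =
      (∑ j, U j x * pd j (U i) x) * V x := by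
    intro x
    rw [← Finset.sum_mul]
    congr 1
    have : ∀ j, pd j (fun x => U i x * U j x) x = U j x * pd j (U i) x + U i x * pd j (U j) x := by
      intro j
      rw [pd_mul (hU i).differentiable_infty (hU j).differentiable_infty]
      ring
    simp only [this, Finset.sum_add_distrib, ← Finset.mul_sum, hdiv]
    ring
  have hi : ∀ j, Integrable fun x => pd j (fun x => U i x * U j x) x * V x := fun j =>
    integrable_mul_of_compact (((hU i).mul (hU j)).pd j) hV hVc
  simp only [hc, Finset.sum_neg_distrib]
  rw [← integral_finsetSum _ fun j _ => hi j]
  simp only [hs]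
  rw [integral_mul_lap (hU i) hV hVc, sub_neg_eq_add, ← integral_const_mul, ← integral_neg,
    ← integral_add]
  · congr with x
    rw [momentum]
    ring
  · exact ((integrable_mul_of_compact (hU i).lap hV hVc).const_mul ν).neg
  · exact integrable_mul_of_compact (ContDiff.sum fun j _ => (hU j).mul ((hU i).pd j)) hV hVc

lemma sum_integral_momentum_mul_eq_zero (hP : ContDiff ℝ ∞ P)
    (hns : ∀ i x, momentum ν U i x + pd i P x = 0) {V : Fin 3 → E3 → ℝ}
    (hV : ∀ i, ContDiff ℝ ∞ (V i)) (hVc : ∀ i, HasCompactSupport (V i))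
    (hVdiv : ∀ x, ∑ i, pd i (V i) x = 0) :
    ∑ i, ∫ x, momentum ν U i x * V i x = 0 := by
  have h1 : ∀ i, ∫ x, momentum ν U i x * V i x = ∫ x, P x * pd i (V i) x := by
    intro i
    rw [integral_mul_pd hP (hV i) (hVc i), ← integral_neg]
    congr with x
    rw [eq_neg_of_add_eq_zero_left (hns i x)]
    ring
  simp only [h1]
  rw [← integral_finsetSum _ fun i _ => integrable_mul_of_compact hP ((hV i).pd i) ((hVc i).pd i)]
  simp only [← Finset.mul_sum, hVdiv]
  simp

/-- The local energy identity. -/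
lemma sum_integral_momentum_mul_self (hU : ∀ i, ContDiff ℝ ∞ (U i))
    (hdiv : ∀ x, ∑ j, pd j (U j) x = 0) {θ : E3 → ℝ} (hθ : ContDiff ℝ ∞ θ)
    (hθc : HasCompactSupport θ) :
    ∑ i, ∫ x, momentum ν U i x * (θ x * U i x) =
      ν * (∫ x, θ x * ∑ i, ∑ j, pd j (U i) x ^ 2) - ν / 2 * (∫ x, (∑ i, U i x ^ 2) * lap θ x) -
        1 / 2 * ∫ x, (∑ i, U i x ^ 2) * ∑ j, U j x * pd j θ x := by
  set q : E3 → ℝ := fun x => ∑ i, U i x ^ 2 with hqdef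
  have hq : ContDiff ℝ ∞ q := ContDiff.sum fun i _ => (hU i).pow 2
  have pdsq : ∀ i j, pd j (fun x => U i x ^ 2) = fun x => 2 * (U i x * pd j (U i) x) := by
    intro i j
    simp only [sq]
    rw [pd_mul (hU i).differentiable_infty (hU i).differentiable_infty]
    ext x; ring
  have pdq : ∀ j, pd j q = fun x => ∑ i, 2 * (U i x * pd j (U i) x) := by
    intro j
    rw [hqdef, pd_sum fun i _ => ((hU i).pow 2).differentiable_infty]
    ext x
    simp only [pdsq]
  have lapq : ∀ x, lap q x = 2 * (∑ i, U i x * lap (U i) x) + 2 * ∑ i, ∑ j, pd j (U i) x ^ 2 := by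
    intro x
    have : ∀ j, pd j (pd j q) x = ∑ i, (2 * (U i x * pd j (pd j (U i)) x) +
        2 * pd j (U i) x ^ 2) := by
      intro j
      have hd : ∀ i, Differentiable ℝ fun x => U i x * pd j (U i) x := fun i =>
        ((hU i).mul ((hU i).pd j)).differentiable_infty
      rw [pdq, pd_sum fun i _ => (hd i).const_mul 2]
      refine Finset.sum_congr rfl fun i _ => ?_
      rw [pd_const_mul (hd i), pd_mul (hU i).differentiable_infty ((hU i).pd j).differentiable_infty]
      ring
    simp only [lap, this]
    rw [Finset.sum_comm]
    simp only [Finset.sum_add_distrib, Finset.mul_sum]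
  have e1 : ∫ x, q x * lap θ x = ∫ x, lap q x * θ x := integral_mul_lap hq hθ hθc
  have e2 : ∫ x, q x * ∑ j, U j x * pd j θ x = -∫ x, θ x * ∑ j, U j x * pd j q x := by
    have h : ∀ j, ∫ x, (q x * U j x) * pd j θ x = -∫ x, pd j (fun x => q x * U j x) x * θ x :=
      fun j => integral_mul_pd (hq.mul (hU j)) hθ hθc j
    have h' : ∀ x, q x * ∑ j, U j x * pd j θ x = ∑ j, (q x * U j x) * pd j θ x := by
      intro x
      rw [Finset.mul_sum]
      exact Finset.sum_congr rfl fun j _ => by ring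
    simp only [h']
    rw [integral_finsetSum _ fun j _ =>
      integrable_mul_of_compact (hq.mul (hU j)) (hθ.pd j) (hθc.pd j)]
    simp only [h, Finset.sum_neg_distrib]
    rw [← integral_finsetSum _ fun j _ =>
      integrable_mul_of_compact ((hq.mul (hU j)).pd j) hθ hθc]
    congr 2 with x
    have h2 : ∀ j, pd j (fun x => q x * U j x) x = U j x * pd j q x + q x * pd j (U j) x := by
      intro j
      rw [pd_mul hq.differentiable_infty (hU j).differentiable_infty]
      ring
    rw [← Finset.sum_mul]
    simp only [h2, Finset.sum_add_distrib, ← Finset.mul_sum, hdiv]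
    ring
  have ciq : ContDiff ℝ ∞ fun x => ∑ i, ∑ j, pd j (U i) x ^ 2 :=
    ContDiff.sum fun i _ => ContDiff.sum fun j _ => ((hU i).pd j).pow 2
  have ciu : ContDiff ℝ ∞ fun x => ∑ j, U j x * pd j q x :=
    ContDiff.sum fun j _ => (hU j).mul (hq.pd j)
  rw [e1, e2, ← integral_finsetSum _ fun i _ =>
    integrable_mul_of_compact (contDiff_momentum hU ν i) (hθ.mul (hU i)) hθc.mul_right,
    ← integral_const_mul, ← integral_const_mul, mul_neg, sub_neg_eq_add, ← integral_const_mul,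
    ← integral_sub, ← integral_add]
  · congr with x
    rw [lapq]
    have h3 : ∑ j, U j x * pd j q x = 2 * ∑ i, U i x * ∑ j, U j x * pd j (U i) x := by
      simp only [pdq, Finset.mul_sum]
      rw [Finset.sum_comm]
      exact Finset.sum_congr rfl fun i _ => Finset.sum_congr rfl fun j _ => by ring
    rw [h3]
    have h4 : ∑ i, momentum ν U i x * (θ x * U i x) =
        θ x * (-(ν * ∑ i, U i x * lap (U i) x) + ∑ i, U i x * ∑ j, U j x * pd j (U i) x) := by
      rw [Finset.mul_sum, ← Finset.sum_neg_distrib, ← Finset.sum_add_distrib, Finset.mul_sum]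
      refine Finset.sum_congr rfl fun i _ => ?_
      rw [momentum]
      ring
    rw [h4]
    ring
  · exact ((hθ.mul ciq).integrable_of_compact hθc.mul_right).const_mul _ |>.sub
      ((integrable_mul_of_compact hq.lap hθ hθc).const_mul _)
  · exact ((hθ.mul ciu).integrable_of_compact hθc.mul_right).const_mul _
  · exact ((hθ.mul ciq).integrable_of_compact hθc.mul_right).const_mul _
  · exact (integrable_mul_of_compact hq.lap hθ hθc).const_mul _

end WeakForm

section Mollification

lemma exists_lipschitz_of_compact {h : E3 → ℝ} (hh : ContDiff ℝ ∞ h) (hc : HasCompactSupport h) :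
    ∃ L, 0 ≤ L ∧ ∀ x z, |h (x - z) - h x| ≤ L * ‖z‖ := by
  obtain ⟨L, hL⟩ := hh.lipschitzWith_of_hasCompactSupport hc (by simp)
  refine ⟨L, L.2, fun x z => ?_⟩
  have := hL.dist_le_mul (x - z) x
  simpa [Real.dist_eq, dist_eq_norm] using this

lemma abs_cv_mollK_sub_le {h : E3 → ℝ} (hh : ContDiff ℝ ∞ h) {L ε : ℝ}
    (hε : 0 < ε) (hL : ∀ x z, |h (x - z) - h x| ≤ L * ‖z‖) (x : E3) :
    |cv (mollK ε) h x - (∫ z, mollK ε z) * h x| ≤ L * ∫ z, ‖z‖ * mollK ε z := by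
  have hk := contDiff_mollK hε
  have hkc : HasCompactSupport (mollK ε) :=
    hasCompactSupport_of_norm (r := 3) fun z hz => mollK_eq_zero (by linarith)
  have e : cv (mollK ε) h x = ∫ z, mollK ε z * h (x - z) := by
    rw [cv, ← integral_sub_left_eq_self (fun z => mollK ε z * h (x - z)) volume x]
    simp
  have i1 : Integrable fun z => mollK ε z * h (x - z) :=
    (hk.continuous.mul (hh.continuous.comp (continuous_const.sub continuous_id))).integrable_of_hasCompactSupport
      hkc.mul_right
  have i2 : Integrable fun z => ‖z‖ * mollK ε z :=
    (continuous_norm.mul hk.continuous).integrable_of_hasCompactSupport hkc.mul_left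
  rw [e, ← integral_mul_const, ← integral_sub i1 ((integrable_mollK hε).mul_const _),
    ← integral_const_mul, ← Real.norm_eq_abs]
  refine norm_integral_le_of_norm_le (i2.const_mul L) (Eventually.of_forall fun z => ?_)
  rw [← mul_sub, norm_mul, Real.norm_eq_abs, Real.norm_eq_abs, abs_of_nonneg (mollK_nonneg hε z)]
  calc mollK ε z * |h (x - z) - h x| ≤ mollK ε z * (L * ‖z‖) :=
        mul_le_mul_of_nonneg_left (hL x z) (mollK_nonneg hε z)
    _ = _ := by ring

/-- Testing against a mollified function is asymptotically the same as testing against a multiple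
of the function itself. -/
lemma exists_abs_integral_mul_cv_mollK_sub_le {f h : E3 → ℝ} (hf : ContDiff ℝ ∞ f)
    (hh : ContDiff ℝ ∞ h) (hs : ∀ z, 2 < ‖z‖ → h z = 0) :
    ∃ T, 0 ≤ T ∧ ∀ ε, 0 < ε → ε ≤ 1 →
      |(∫ x, f x * cv (mollK ε) h x) - (∫ z, mollK ε z) * ∫ x, f x * h x| ≤ T * ε := by
  have hc : HasCompactSupport h := hasCompactSupport_of_norm (r := 3) fun z hz => hs z (by linarith)
  obtain ⟨L, hL0, hL⟩ := exists_lipschitz_of_compact hh hc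
  obtain ⟨c, K, -, hK0, hK⟩ := exists_mollK_bounds
  have hfi : IntegrableOn f (closedBall (0 : E3) 6) :=
    hf.continuous.continuousOn.integrableOn_compact (isCompact_closedBall _ _)
  refine ⟨(∫ x in closedBall (0 : E3) 6, |f x|) * (L * K), by positivity, fun ε hε hε1 => ?_⟩
  have hv0 : ∀ x : E3, 6 ≤ ‖x‖ → cv (mollK ε) h x = 0 := fun x hx =>
    cv_eq_zero (r := 3) (s := 3) (fun z hz => mollK_eq_zero (by linarith))
      (fun z hz => hs z (by linarith)) (by linarith)
  have hv := contDiff_cv (contDiff_mollK hε).continuous hh hc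
  have hvc : HasCompactSupport (cv (mollK ε) h) := hasCompactSupport_of_norm hv0
  rw [← integral_const_mul, ← integral_sub (integrable_mul_of_compact hf hv hvc)
    ((integrable_mul_of_compact hf hh hc).const_mul _)]
  have hsupp : ∀ x, x ∉ closedBall (0 : E3) 6 →
      f x * cv (mollK ε) h x - (∫ z, mollK ε z) * (f x * h x) = 0 := by
    intro x hx
    have hx6 : 6 < ‖x‖ := by simpa using hx
    rw [hv0 x hx6.le, hs x (by linarith)]
    ring
  rw [← setIntegral_eq_integral_of_forall_compl_eq_zero hsupp, ← Real.norm_eq_abs, mul_assoc,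
    ← integral_mul_const]
  refine norm_integral_le_of_norm_le (hfi.abs.mul_const _) (Eventually.of_forall fun x => ?_)
  have h1 := (abs_cv_mollK_sub_le hh hε hL x).trans
    (mul_le_mul_of_nonneg_left (hK ε hε hε1).2 hL0)
  have h2 : f x * cv (mollK ε) h x - (∫ z, mollK ε z) * (f x * h x) =
      f x * (cv (mollK ε) h x - (∫ z, mollK ε z) * h x) := by ring
  rw [h2, norm_mul, Real.norm_eq_abs, Real.norm_eq_abs]
  refine mul_le_mul_of_nonneg_left (h1.trans (le_of_eq (by ring))) (abs_nonneg _)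

end Mollification

section LocalEnergy

/-- The length of a vector field given by its components. -/
def spd (U : Fin 3 → E3 → ℝ) (x : E3) : ℝ := vecNorm (fun x i => U i x) x

variable {ν : ℝ} {U : Fin 3 → E3 → ℝ} {P : E3 → ℝ}

lemma spd_nonneg (U : Fin 3 → E3 → ℝ) (x : E3) : 0 ≤ spd U x := Real.sqrt_nonneg _

lemma spd_sq (U : Fin 3 → E3 → ℝ) (x : E3) : spd U x ^ 2 = ∑ i, U i x ^ 2 :=
  Real.sq_sqrt (Finset.sum_nonneg fun _ _ => sq_nonneg _)

lemma continuous_spd (hU : ∀ i, ContDiff ℝ ∞ (U i)) : Continuous (spd U) :=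
  Real.continuous_sqrt.comp (continuous_finsetSum _ fun i _ => (hU i).continuous.pow 2)

lemma abs_le_spd (U : Fin 3 → E3 → ℝ) (i : Fin 3) (x : E3) : |U i x| ≤ spd U x := by
  refine abs_le_of_sq_le_sq ?_ (spd_nonneg U x)
  rw [spd_sq]
  exact Finset.single_le_sum (f := fun i => U i x ^ 2) (fun _ _ => sq_nonneg _) (Finset.mem_univ i)

lemma abs_le_one_add_spd (U : Fin 3 → E3 → ℝ) (i : Fin 3) (x : E3) :
    |U i x| ≤ 1 + spd U x ^ 3 := by
  have h0 := spd_nonneg U x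
  refine (abs_le_spd U i x).trans ?_
  nlinarith [mul_nonneg h0 (sq_nonneg (spd U x - 1)), sq_nonneg (spd U x - 1)]

lemma abs_mul_le_one_add_spd (U : Fin 3 → E3 → ℝ) (i j : Fin 3) (x : E3) :
    |U i x * U j x| ≤ 1 + spd U x ^ 3 := by
  have h0 := spd_nonneg U x
  rw [abs_mul]
  refine (mul_le_mul (abs_le_spd U i x) (abs_le_spd U j x) (abs_nonneg _) h0).trans ?_
  nlinarith [mul_nonneg h0 (sq_nonneg (spd U x - 1)), sq_nonneg (spd U x - 1)]

/-- The constant bounding `∫ (1 + |u|³)` over the ball of radius eight. -/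
def ballConst : ℝ := (volume (ball (0 : E3) 8)).toReal + 1

lemma ballConst_nonneg : 0 ≤ ballConst := by unfold ballConst; positivity

lemma integral_abs_le_ballConst (hU : ∀ i, ContDiff ℝ ∞ (U i))
    (hN : ∫ x in ball (0 : E3) 8, spd U x ^ 3 ≤ 1) {F : E3 → ℝ} {c : ℝ} (hc : 0 ≤ c)
    (hF : ∀ x, ‖x‖ < 8 → |F x| ≤ c * (1 + spd U x ^ 3)) (hF0 : ∀ x, 8 ≤ ‖x‖ → F x = 0) :
    ∫ x, |F x| ≤ c * ballConst := by
  have hi : IntegrableOn (fun x => spd U x ^ 3) (ball (0 : E3) 8) :=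
    (((continuous_spd hU).pow 3).continuousOn.integrableOn_compact
      (isCompact_closedBall (0 : E3) 8)).mono_set ball_subset_closedBall
  have h1 : IntegrableOn (fun _ : E3 => (1 : ℝ)) (ball (0 : E3) 8) :=
    integrableOn_const measure_ball_lt_top.ne
  rw [← setIntegral_eq_integral_of_forall_compl_eq_zero (s := ball (0 : E3) 8) fun x hx => by
    rw [hF0 x (by simpa using hx), abs_zero]]
  have h2 : ∫ x in ball (0 : E3) 8, |F x| ≤ ∫ x in ball (0 : E3) 8, c * (1 + spd U x ^ 3) := by
    refine integral_mono_of_nonneg (Eventually.of_forall fun x => abs_nonneg _)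
      ((h1.add hi).const_mul c) ?_
    filter_upwards [ae_restrict_mem measurableSet_ball] with x hx
    exact hF x (by simpa using hx)
  refine h2.trans ?_
  rw [integral_const_mul, integral_add h1 hi]
  refine mul_le_mul_of_nonneg_left ?_ hc
  rw [ballConst]
  simp only [setIntegral_const, smul_eq_mul, mul_one, Measure.real]
  linarith

lemma abs_integral_le_ballConst (hU : ∀ i, ContDiff ℝ ∞ (U i))
    (hN : ∫ x in ball (0 : E3) 8, spd U x ^ 3 ≤ 1) {F : E3 → ℝ} {c : ℝ} (hc : 0 ≤ c)
    (hF : ∀ x, ‖x‖ < 8 → |F x| ≤ c * (1 + spd U x ^ 3)) (hF0 : ∀ x, 8 ≤ ‖x‖ → F x = 0) :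
    |∫ x, F x| ≤ c * ballConst :=
  (abs_integral_le_integral_abs).trans (integral_abs_le_ballConst hU hN hc hF hF0)

/-- The contribution of the smooth remainder kernel. -/
lemma abs_integral_momentum_mul_cv_remK_le (hU : ∀ i, ContDiff ℝ ∞ (U i))
    (hdiv : ∀ x, ∑ j, pd j (U j) x = 0)
    (hN : ∫ x in ball (0 : E3) 8, spd U x ^ 3 ≤ 1) (hν : 0 < ν) {ε C H : ℝ} (hε : 0 < ε)
    (hC : 0 ≤ C) (hK1 : ∀ z : E3, ‖z‖ ≤ 8 → ∀ j, |pd j (remK ε) z| ≤ C)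
    (hK2 : ∀ z : E3, ‖z‖ ≤ 8 → |lap (remK ε) z| ≤ C) {h : E3 → ℝ} (hh : ContDiff ℝ ∞ h)
    (hs : ∀ z, 2 < ‖z‖ → h z = 0) (hH : ∫ x, |h x| ≤ H) (i : Fin 3) :
    |∫ x, momentum ν U i x * cv (remK ε) h x| ≤ 3 * (C * H) * ballConst * (ν + 1) := by
  have hc : HasCompactSupport h := hasCompactSupport_of_norm (r := 3) fun z hz => hs z (by linarith)
  have hm := contDiff_remK hε
  have hV : ContDiff ℝ ∞ (cv (remK ε) h) := contDiff_cv hm.continuous hh hc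
  have hV0 : ∀ x : E3, 5 < ‖x‖ → cv (remK ε) h x = 0 := fun x hx =>
    cv_eq_zero (r := 5 / 2) (s := 5 / 2) (fun z hz => remK_eq_zero (by linarith))
      (fun z hz => hs z (by linarith)) (by linarith)
  have hVc : HasCompactSupport (cv (remK ε) h) :=
    hasCompactSupport_of_norm (r := 6) fun z hz => hV0 z (by linarith)
  have hH0 : 0 ≤ H := (integral_nonneg fun x => abs_nonneg (h x)).trans hH
  have hCH : 0 ≤ C * H := mul_nonneg hC hH0
  have b1 : ∀ x, |lap (cv (remK ε) h) x| ≤ C * H := by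
    intro x
    by_cases hx : 5 < ‖x‖
    · rw [lap_eq_zero_of_norm_lt hV0 hx, abs_zero]; exact hCH
    · rw [lap_cv hm.continuous hh hc, cv_lap hm hh hc]
      exact (abs_cv_le (s := 3) hh hc (fun z hz => hs z (by linarith))
        fun z hz => hK2 z (by linarith)).trans (mul_le_mul_of_nonneg_left hH hC)
  have b2 : ∀ j x, |pd j (cv (remK ε) h) x| ≤ C * H := by
    intro j x
    by_cases hx : 5 < ‖x‖
    · rw [pd_eq_zero_of_norm_lt hV0 j hx, abs_zero]; exact hCH
    · rw [pd_cv hm.continuous hh hc, cv_pd hm hh hc]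
      exact (abs_cv_le (s := 3) hh hc (fun z hz => hs z (by linarith))
        fun z hz => hK1 z (by linarith) j).trans (mul_le_mul_of_nonneg_left hH hC)
  have t1 : |∫ x, U i x * lap (cv (remK ε) h) x| ≤ C * H * ballConst := by
    refine abs_integral_le_ballConst hU hN hCH (fun x _ => ?_) fun x hx => ?_
    · rw [abs_mul, mul_comm]
      exact mul_le_mul (b1 x) (abs_le_one_add_spd U i x) (abs_nonneg _) hCH
    · rw [lap_eq_zero_of_norm_lt hV0 (by linarith), mul_zero]
  have t2 : ∀ j, |∫ x, U i x * U j x * pd j (cv (remK ε) h) x| ≤ C * H * ballConst := by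
    intro j
    refine abs_integral_le_ballConst hU hN hCH (fun x _ => ?_) fun x hx => ?_
    · rw [abs_mul, mul_comm]
      exact mul_le_mul (b2 j x) (abs_mul_le_one_add_spd U i j x) (abs_nonneg _) hCH
    · rw [pd_eq_zero_of_norm_lt hV0 j (by linarith), mul_zero]
  rw [integral_momentum_mul hU hdiv i hV hVc]
  have t3 : |∑ j, ∫ x, U i x * U j x * pd j (cv (remK ε) h) x| ≤ 3 * (C * H * ballConst) := by
    refine (Finset.abs_sum_le_sum_abs _ _).trans ((Finset.sum_le_sum fun j _ => t2 j).trans ?_)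
    simp
  have hB : 0 ≤ C * H * ballConst := mul_nonneg hCH ballConst_nonneg
  have t4 : |ν * ∫ x, U i x * lap (cv (remK ε) h) x| ≤ ν * (C * H * ballConst) := by
    rw [abs_mul, abs_of_pos hν]
    exact mul_le_mul_of_nonneg_left t1 hν.le
  have t5 := abs_le.mp t3
  have t6 := abs_le.mp t4
  rw [abs_le]
  constructor <;> nlinarith [mul_nonneg hν.le hB]

lemma abs_sq_rpow_three_halves (s : ℝ) : |s ^ 2| ^ (3 / 2 : ℝ) = |s| ^ 3 := by
  rw [abs_pow, ← Real.rpow_natCast, ← Real.rpow_mul (abs_nonneg _), ← Real.rpow_natCast]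
  norm_num

/-- The contribution of the singular kernel to the convective term. -/
lemma abs_integral_mul_pd_pd_cv_nearK_le (hU : ∀ i, ContDiff ℝ ∞ (U i))
    (hN : ∫ x in ball (0 : E3) 8, spd U x ^ 3 ≤ 1) {ε C G : ℝ} (hε : 0 < ε) (hC : 0 ≤ C)
    (hK : ∀ z : E3, ‖z‖ ≤ 8 → ∀ i j, |pd i (pd j (farK ε)) z| ≤ C) {g : E3 → ℝ}
    (hg : ContDiff ℝ ∞ g) (hs : ∀ z, 2 < ‖z‖ → g z = 0) (hG : ∫ x, |g x| ≤ G)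
    (hG3 : ∫ x, |g x| ^ (3 : ℝ) ≤ G) (i j : Fin 3) :
    |∫ x, U i x * U j x * pd i (pd j (cv (nearK ε) g)) x| ≤
      48 * π * (G + 8 * ballConst) + C * G * ballConst := by
  have hc : HasCompactSupport g :=
    hasCompactSupport_of_norm (r := 3) fun z hz => hs z (by linarith)
  have hn := contDiff_newt hε
  have hfK := contDiff_farK hε
  have hG0 : 0 ≤ G := (integral_nonneg fun x => abs_nonneg (g x)).trans hG
  have hCG : 0 ≤ C * G := mul_nonneg hC hG0
  set χ : E3 → ℝ := ⇑(cut ⟨5, by norm_num⟩) with hχdef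
  have hχ : ContDiff ℝ ∞ χ := contDiff_cut _
  have hχ1 : ∀ x : E3, ‖x‖ ≤ 5 → χ x = 1 := fun x hx => cut_eq_one _ hx
  have hχ0 : ∀ x : E3, 6 ≤ ‖x‖ → χ x = 0 := fun x hx => cut_eq_zero _ (by norm_num; exact hx)
  have hχn : ∀ x, 0 ≤ χ x := fun x => ContDiffBump.nonneg' _ _
  have hχl : ∀ x, χ x ≤ 1 := fun x => ContDiffBump.le_one _
  have hW0 : ∀ x : E3, 5 < ‖x‖ → cv (nearK ε) g x = 0 := fun x hx =>
    cv_eq_zero (r := 5 / 2) (s := 5 / 2) (fun z hz => nearK_eq_zero (by linarith))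
      (fun z hz => hs z (by linarith)) (by linarith)
  have hW : cv (nearK ε) g = fun x => cv (newt ε) g x - cv (farK ε) g x := by
    ext x
    have : nearK ε = fun z => newt ε z - farK ε z := by
      ext z; rw [newt_eq_add]; ring
    rw [this, cv_sub_left hn.continuous hfK.continuous hg hc]
  have cN : ContDiff ℝ ∞ (cv (newt ε) g) := contDiff_cv hn.continuous hg hc
  have cF : ContDiff ℝ ∞ (cv (farK ε) g) := contDiff_cv hfK.continuous hg hc
  have hppW : pd i (pd j (cv (nearK ε) g)) = fun x =>
      pd i (pd j (cv (newt ε) g)) x - cv (pd i (pd j (farK ε))) g x := by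
    rw [hW, pd_sub cN.differentiable_infty cF.differentiable_infty,
      pd_sub (cN.pd j).differentiable_infty (cF.pd j).differentiable_infty,
      pd_cv hfK.continuous hg hc, cv_pd hfK hg hc, pd_cv (hfK.pd j).continuous hg hc,
      cv_pd (hfK.pd j) hg hc]
  have key : ∀ a : E3 → ℝ, ContDiff ℝ ∞ a → (∀ x, |a x| ≤ 2 * spd U x) →
      |∫ x, (χ x * a x) ^ 2 * pd i (pd j (cv (newt ε) g)) x| ≤
        32 * π * (G + 8 * ballConst) := by
    intro a ha hab
    have h1 := abs_integral_mul_pd_pd_cv_newt_le hg hc ((hχ.mul ha).pow 2)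
      (hasCompactSupport_of_norm (r := 6) fun z hz => by
        rw [hχ0 z hz]; ring) (fun x => sq_nonneg _) i j hε
    refine h1.trans (mul_le_mul_of_nonneg_left (add_le_add hG3 ?_) (by positivity))
    simp only [abs_sq_rpow_three_halves]
    have h2 : ∫ x, |(χ x * a x) ^ 3| ≤ 8 * ballConst := by
      refine integral_abs_le_ballConst hU hN (by norm_num) (fun x _ => ?_) fun x hx => ?_
      · have h3 : |χ x * a x| ≤ 2 * spd U x := by
          rw [abs_mul, abs_of_nonneg (hχn x)]
          exact (mul_le_of_le_one_left (abs_nonneg _) (hχl x)).trans (hab x)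
        rw [abs_pow]
        have h4 := pow_le_pow_left₀ (abs_nonneg _) h3 3
        nlinarith
      · rw [hχ0 x (by linarith)]; ring
    simpa only [abs_pow] using h2
  have hpol : ∀ x, U i x * U j x * pd i (pd j (cv (nearK ε) g)) x =
      1 / 2 * ((χ x * (U i x + U j x)) ^ 2 * pd i (pd j (cv (newt ε) g)) x -
        (χ x * U i x) ^ 2 * pd i (pd j (cv (newt ε) g)) x -
        (χ x * U j x) ^ 2 * pd i (pd j (cv (newt ε) g)) x) -
      χ x ^ 2 * (U i x * U j x) * cv (pd i (pd j (farK ε))) g x := by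
    intro x
    have h1 : U i x * U j x * pd i (pd j (cv (nearK ε) g)) x =
        χ x ^ 2 * (U i x * U j x) * pd i (pd j (cv (nearK ε) g)) x := by
      by_cases hx : 5 < ‖x‖
      · rw [pd_eq_zero_of_norm_lt (fun _ => pd_eq_zero_of_norm_lt hW0 j) i hx]
        ring
      · rw [hχ1 x (not_lt.mp hx)]; ring
    rw [h1, hppW]
    ring
  have iN : ∀ a : E3 → ℝ, ContDiff ℝ ∞ a →
      Integrable fun x => (χ x * a x) ^ 2 * pd i (pd j (cv (newt ε) g)) x := fun a ha =>
    ((((hχ.mul ha).pow 2).mul ((cN.pd j).pd i))).integrable_of_compact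
      (hasCompactSupport_of_norm (r := 6) fun z hz => by rw [hχ0 z hz]; ring)
  have iF : Integrable fun x => χ x ^ 2 * (U i x * U j x) * cv (pd i (pd j (farK ε))) g x :=
    (((hχ.pow 2).mul ((hU i).mul (hU j))).mul
      (contDiff_cv ((hfK.pd j).pd i).continuous hg hc)).integrable_of_compact
      (hasCompactSupport_of_norm (r := 6) fun z hz => by rw [hχ0 z hz]; ring)
  have k1 := key (fun x => U i x + U j x) ((hU i).add (hU j)) fun x => by
    have h1 := abs_le_spd U i x
    have h2 := abs_le_spd U j x
    exact (abs_add_le _ _).trans (by linarith)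
  have k2 : ∀ l, |∫ x, (χ x * U l x) ^ 2 * pd i (pd j (cv (newt ε) g)) x| ≤
      32 * π * (G + 8 * ballConst) := fun l => key (U l) (hU l) fun x => by
    have h1 := abs_le_spd U l x
    have h2 := spd_nonneg U x
    linarith
  have k3 : |∫ x, χ x ^ 2 * (U i x * U j x) * cv (pd i (pd j (farK ε))) g x| ≤
      C * G * ballConst := by
    refine abs_integral_le_ballConst hU hN hCG (fun x _ => ?_) fun x hx => ?_
    · by_cases hx : 6 ≤ ‖x‖
      · rw [hχ0 x hx]
        have := spd_nonneg U x
        simp only [ne_eq, OfNat.ofNat_ne_zero, not_false_eq_true, zero_pow, zero_mul, abs_zero]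
        positivity
      · have h1 : |cv (pd i (pd j (farK ε))) g x| ≤ C * G :=
          (abs_cv_le (s := 2 + (6 - ‖x‖)) hg hc (fun z hz => hs z (by linarith))
            fun z hz => hK z (by linarith) i j).trans (mul_le_mul_of_nonneg_left hG hC)
        have h2 : |χ x ^ 2 * (U i x * U j x)| ≤ 1 + spd U x ^ 3 := by
          rw [abs_mul, abs_pow, abs_of_nonneg (hχn x)]
          exact (mul_le_of_le_one_left (abs_nonneg _) (pow_le_one₀ (hχn x) (hχl x))).trans
            (abs_mul_le_one_add_spd U i j x)
        rw [abs_mul, mul_comm]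
        exact mul_le_mul h1 h2 (abs_nonneg _) hCG
    · rw [hχ0 x (by linarith)]; ring
  simp only [hpol]
  have i1 : Integrable fun x => (χ x * (U i x + U j x)) ^ 2 * pd i (pd j (cv (newt ε) g)) x -
      (χ x * U i x) ^ 2 * pd i (pd j (cv (newt ε) g)) x :=
    (iN _ ((hU i).add (hU j))).sub (iN _ (hU i))
  have i2 : Integrable fun x => (χ x * (U i x + U j x)) ^ 2 * pd i (pd j (cv (newt ε) g)) x -
      (χ x * U i x) ^ 2 * pd i (pd j (cv (newt ε) g)) x -
      (χ x * U j x) ^ 2 * pd i (pd j (cv (newt ε) g)) x := i1.sub (iN _ (hU j))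
  rw [integral_sub (i2.const_mul _) iF, integral_const_mul, integral_sub i1 (iN _ (hU j)),
    integral_sub (iN _ ((hU i).add (hU j))) (iN _ (hU i))]
  have a1 := abs_le.mp k1
  have a2 := abs_le.mp (k2 i)
  have a3 := abs_le.mp (k2 j)
  have a4 := abs_le.mp k3
  rw [abs_le]
  constructor <;> linarith

end LocalEnergy

section UnitScale

lemma exists_unitCut_bound : ∃ L, 0 ≤ L ∧ (∀ j x, |pd j unitCut x| ≤ L) ∧ ∀ x, |lap unitCut x| ≤ L := by
  have hθ := contDiff_unitCut
  have hθc := hasCompactSupport_unitCut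
  choose M hM0 hM using fun j => exists_bound_of_compact (hθ.pd j).continuous (hθc.pd j)
  obtain ⟨L, hL0, hL⟩ := exists_bound_of_compact hθ.lap.continuous hθc.lap
  have hs : ∀ j, M j ≤ ∑ j, M j := fun j =>
    Finset.single_le_sum (f := M) (fun j _ => hM0 j) (Finset.mem_univ j)
  have hs0 : 0 ≤ ∑ j, M j := Finset.sum_nonneg fun j _ => hM0 j
  exact ⟨(∑ j, M j) + L, by positivity, fun j x => (hM j x).trans (by linarith [hs j]),
    fun x => (hL x).trans (by linarith)⟩

variable {ν : ℝ} {U : Fin 3 → E3 → ℝ} {P : E3 → ℝ}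

lemma abs_sum_mul_pd_unitCut_le {L : ℝ} (hL : ∀ j x, |pd j unitCut x| ≤ L) (x : E3) :
    |∑ j, U j x * pd j unitCut x| ≤ 3 * L * spd U x := by
  refine (Finset.abs_sum_le_sum_abs _ _).trans
    ((Finset.sum_le_sum fun j _ => (?_ : _ ≤ spd U x * L)).trans ?_)
  · rw [abs_mul]
    exact mul_le_mul (abs_le_spd U j x) (hL j x) (abs_nonneg _) (spd_nonneg U x)
  · simp only [Finset.sum_const, Finset.card_univ, Fintype.card_fin, nsmul_eq_mul]
    exact le_of_eq (by push_cast; ring)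

lemma pd_unitCut_eq_zero (j : Fin 3) {z : E3} (hz : 2 < ‖z‖) : pd j unitCut z = 0 :=
  pd_eq_zero_of_norm_lt (fun _ h => unitCut_eq_zero (le_of_lt h)) j hz

/-- The decomposition of the localized energy flux obtained by testing the equation against a
divergence-free regularization of the localized velocity. -/
lemma sum_integral_momentum_mul_decomposition (hU : ∀ i, ContDiff ℝ ∞ (U i)) (hP : ContDiff ℝ ∞ P)
    (hdiv : ∀ x, ∑ j, pd j (U j) x = 0) (hns : ∀ i x, momentum ν U i x + pd i P x = 0)
    {ε : ℝ} (hε : 0 < ε) {h : Fin 3 → E3 → ℝ} {g : E3 → ℝ} (hh : ∀ i, ContDiff ℝ ∞ (h i))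
    (hs : ∀ i z, 2 < ‖z‖ → h i z = 0) (hg : g = fun x => ∑ i, pd i (h i) x) :
    (∑ i, ∫ x, momentum ν U i x * cv (mollK ε) (h i) x) +
      (∑ i, ∫ x, momentum ν U i x * cv (remK ε) (h i) x) -
      (∑ i, ∑ j, ∫ x, U i x * U j x * pd j (pd i (cv (nearK ε) g)) x) = 0 := by
  have hc : ∀ i, HasCompactSupport (h i) := fun i =>
    hasCompactSupport_of_norm (r := 3) fun z hz => hs i z (by linarith)
  have cg : ContDiff ℝ ∞ g := by rw [hg]; exact ContDiff.sum fun i _ => (hh i).pd i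
  have gs : ∀ z, 2 < ‖z‖ → g z = 0 := fun z hz => by
    rw [hg]
    exact Finset.sum_eq_zero fun i _ => pd_eq_zero_of_norm_lt (hs i) i hz
  have gc : HasCompactSupport g :=
    hasCompactSupport_of_norm (r := 3) fun z hz => gs z (by linarith)
  have cn := contDiff_nearK hε
  have cm := contDiff_mollK hε
  have cr := contDiff_remK hε
  set W := cv (nearK ε) g with hWdef
  have cW : ContDiff ℝ ∞ W := contDiff_cv cn.continuous cg gc
  have Wc : HasCompactSupport W := hasCompactSupport_of_norm (r := 6) fun x hx =>
    cv_eq_zero (r := 3) (s := 3) (fun z hz => nearK_eq_zero (by linarith))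
      (fun z hz => gs z (by linarith)) (by linarith)
  have ck : ∀ i, ContDiff ℝ ∞ (cv (mollK ε) (h i)) := fun i =>
    contDiff_cv cm.continuous (hh i) (hc i)
  have ckc : ∀ i, HasCompactSupport (cv (mollK ε) (h i)) := fun i =>
    hasCompactSupport_of_norm (r := 6) fun x hx =>
      cv_eq_zero (r := 3) (s := 3) (fun z hz => mollK_eq_zero (by linarith))
        (fun z hz => hs i z (by linarith)) (by linarith)
  have cρ : ∀ i, ContDiff ℝ ∞ (cv (remK ε) (h i)) := fun i =>
    contDiff_cv cr.continuous (hh i) (hc i)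
  have cρc : ∀ i, HasCompactSupport (cv (remK ε) (h i)) := fun i =>
    hasCompactSupport_of_norm (r := 6) fun x hx =>
      cv_eq_zero (r := 3) (s := 3) (fun z hz => remK_eq_zero (by linarith))
        (fun z hz => hs i z (by linarith)) (by linarith)
  have hVdiv : ∀ x, ∑ i, pd i (fun x => cv (mollK ε) (h i) x + cv (remK ε) (h i) x + pd i W x) x
      = 0 := by
    intro x
    have e1 : ∀ i, pd i (fun x => cv (mollK ε) (h i) x + cv (remK ε) (h i) x + pd i W x) x =
        cv (mollK ε) (pd i (h i)) x + cv (remK ε) (pd i (h i)) x + pd i (pd i W) x := by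
      intro i
      rw [pd_add ((ck i).add (cρ i)).differentiable_infty (cW.pd i).differentiable_infty,
        pd_add (ck i).differentiable_infty (cρ i).differentiable_infty,
        pd_cv cm.continuous (hh i) (hc i), pd_cv cr.continuous (hh i) (hc i)]
    simp only [e1, Finset.sum_add_distrib]
    rw [← cv_sum_right cm.continuous (fun i => (hh i).pd i) (fun i => (hc i).pd i),
      ← cv_sum_right cr.continuous (fun i => (hh i).pd i) (fun i => (hc i).pd i), ← hg]
    have e2 : ∑ i, pd i (pd i W) x = cv (lap (nearK ε)) g x := by
      rw [← cv_lap cn cg gc, ← lap_cv cn.continuous cg gc, ← hWdef, lap]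
    rw [e2, ← cv_add_left cm.continuous cr.continuous cg gc,
      ← cv_add_left (cm.add cr).continuous cn.lap.continuous cg gc]
    have e3 : (fun z => mollK ε z + remK ε z + lap (nearK ε) z) = fun _ => 0 := by
      ext z; rw [remK]; ring
    rw [e3]
    simp [cv]
  have h0 := sum_integral_momentum_mul_eq_zero hP hns (fun i => ((ck i).add (cρ i)).add (cW.pd i))
    (fun i => ((ckc i).add (cρc i)).add (Wc.pd i)) hVdiv
  have hf := fun i => contDiff_momentum hU ν i
  have h1 : ∀ i, ∫ x, momentum ν U i x *
      (cv (mollK ε) (h i) x + cv (remK ε) (h i) x + pd i W x) =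
      (∫ x, momentum ν U i x * cv (mollK ε) (h i) x) +
      (∫ x, momentum ν U i x * cv (remK ε) (h i) x) + ∫ x, momentum ν U i x * pd i W x := by
    intro i
    have i1 := integrable_mul_of_compact (hf i) (ck i) (ckc i)
    have i2 := integrable_mul_of_compact (hf i) (cρ i) (cρc i)
    have i3 := integrable_mul_of_compact (hf i) (cW.pd i) (Wc.pd i)
    have i12 : Integrable fun x => momentum ν U i x * cv (mollK ε) (h i) x +
        momentum ν U i x * cv (remK ε) (h i) x := i1.add i2
    rw [← integral_add i1 i2, ← integral_add i12 i3]
    congr with x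
    ring
  have h2 : ∑ i, ∫ x, U i x * lap (pd i W) x = 0 := by
    have : ∀ i, ∫ x, U i x * lap (pd i W) x = -∫ x, pd i (U i) x * lap W x := by
      intro i
      rw [← pd_lap cW, integral_mul_pd (hU i) cW.lap Wc.lap]
    simp only [this, Finset.sum_neg_distrib]
    rw [← integral_finsetSum _ fun i _ => integrable_mul_of_compact ((hU i).pd i) cW.lap Wc.lap]
    simp only [← Finset.sum_mul, hdiv]
    simp
  have h3 : ∑ i, ∫ x, momentum ν U i x * pd i W x =
      -∑ i, ∑ j, ∫ x, U i x * U j x * pd j (pd i W) x := by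
    simp only [fun i => integral_momentum_mul (ν := ν) hU hdiv i (cW.pd i) (Wc.pd i)]
    rw [Finset.sum_sub_distrib, Finset.sum_neg_distrib, ← Finset.mul_sum, h2]
    ring
  have h4 : ∑ i, ∫ x, momentum ν U i x *
      (cv (mollK ε) (h i) x + cv (remK ε) (h i) x + pd i W x) = 0 := h0
  simp only [h1, Finset.sum_add_distrib, h3] at h4
  linarith

/-- The local energy bound at unit scale. -/
lemma exists_local_energy_bound : ∃ C : ℝ, 0 ≤ C ∧ ∀ (ν : ℝ) (U : Fin 3 → E3 → ℝ) (P : E3 → ℝ),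
    0 < ν → (∀ i, ContDiff ℝ ∞ (U i)) → ContDiff ℝ ∞ P → (∀ x, ∑ j, pd j (U j) x = 0) →
    (∀ i x, momentum ν U i x + pd i P x = 0) → ∫ x in ball (0 : E3) 8, spd U x ^ 3 ≤ 1 →
    ν * ∫ x in ball (0 : E3) 1, ∑ i, ∑ j, pd j (U i) x ^ 2 ≤ C * (ν + 1) := by
  obtain ⟨C, hC0, hC⟩ := exists_kernel_bound
  obtain ⟨c, K, hc0, -, hcK⟩ := exists_mollK_bounds
  obtain ⟨L, hL0, hL, hL'⟩ := exists_unitCut_bound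
  have hB0 := ballConst_nonneg
  set B := ballConst with hB
  set G : ℝ := (3 * L + 27 * L ^ 3) * B with hG
  have hG0 : 0 ≤ G := by positivity
  set Z : ℝ := 48 * π * (G + 8 * B) + C * G * B with hZ
  have hZ0 : 0 ≤ Z := by positivity
  refine ⟨(9 * (C * B) * B + 9 * Z) / c + 2 * L * B, by positivity,
    fun ν U P hν hU hP hdiv hns hN => ?_⟩
  set h : Fin 3 → E3 → ℝ := fun i x => unitCut x * U i x with hh
  set g : E3 → ℝ := fun x => ∑ j, U j x * pd j unitCut x with hgdef
  have ch : ∀ i, ContDiff ℝ ∞ (h i) := fun i => contDiff_unitCut.mul (hU i)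
  have hs : ∀ i z, 2 < ‖z‖ → h i z = 0 := fun i z hz => by
    simp only [hh, unitCut_eq_zero hz.le, zero_mul]
  have cg : ContDiff ℝ ∞ g := ContDiff.sum fun j _ => (hU j).mul (contDiff_unitCut.pd j)
  have gs : ∀ z, 2 < ‖z‖ → g z = 0 := fun z hz =>
    Finset.sum_eq_zero fun j _ => by rw [pd_unitCut_eq_zero j hz, mul_zero]
  have hgdiv : g = fun x => ∑ i, pd i (h i) x := by
    ext x
    have : ∀ i, pd i (h i) x = pd i unitCut x * U i x + unitCut x * pd i (U i) x := by
      intro i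
      rw [hh, pd_mul contDiff_unitCut.differentiable_infty (hU i).differentiable_infty]
    simp only [this, Finset.sum_add_distrib, ← Finset.mul_sum, hdiv, mul_zero, add_zero]
    exact Finset.sum_congr rfl fun i _ => mul_comm _ _
  have hgle : ∀ x, |g x| ≤ 3 * L * spd U x := abs_sum_mul_pd_unitCut_le hL
  have hN1 : ∀ x, spd U x ≤ 1 + spd U x ^ 3 := fun x => by
    have h0 := spd_nonneg U x
    nlinarith [mul_nonneg h0 (sq_nonneg (spd U x - 1)), sq_nonneg (spd U x - 1)]
  have hN2 : ∀ x, spd U x ^ 2 ≤ 1 + spd U x ^ 3 := fun x => by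
    have h0 := spd_nonneg U x
    nlinarith [mul_nonneg h0 (sq_nonneg (spd U x - 1)), sq_nonneg (spd U x - 1)]
  have hH : ∀ i, ∫ x, |h i x| ≤ B := by
    intro i
    refine (integral_abs_le_ballConst hU hN zero_le_one (fun x _ => ?_)
      fun x hx => hs i x (by linarith)).trans (one_mul _).le
    rw [hh, abs_mul, abs_of_nonneg (unitCut_nonneg x), one_mul]
    exact (mul_le_of_le_one_left (abs_nonneg _) (unitCut_le_one x)).trans
      (abs_le_one_add_spd U i x)
  have hG1 : ∫ x, |g x| ≤ G := by
    refine (integral_abs_le_ballConst hU hN (c := 3 * L) (by positivity) (fun x _ => ?_)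
      fun x hx => gs x (by linarith)).trans ?_
    · exact (hgle x).trans (mul_le_mul_of_nonneg_left (hN1 x) (by positivity))
    · exact mul_le_mul_of_nonneg_right (by nlinarith [pow_nonneg hL0 3]) hB0
  have hG3 : ∫ x, |g x| ^ (3 : ℝ) ≤ G := by
    have e : ∀ x, |g x| ^ (3 : ℝ) = |g x ^ 3| := fun x => by
      rw [abs_pow, ← Real.rpow_natCast]; norm_num
    simp only [e]
    refine (integral_abs_le_ballConst hU hN (c := 27 * L ^ 3) (by positivity) (fun x _ => ?_)
      fun x hx => by rw [gs x (by linarith)]; ring).trans ?_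
    · rw [abs_pow]
      have h1 := pow_le_pow_left₀ (abs_nonneg _) (hgle x) 3
      have h2 : 0 ≤ L ^ 3 := by positivity
      nlinarith
    · exact mul_le_mul_of_nonneg_right (by linarith) hB0
  set E : ℝ := ∑ i, ∫ x, momentum ν U i x * h i x with hE
  choose T hT0 hT using fun i =>
    exists_abs_integral_mul_cv_mollK_sub_le (contDiff_momentum hU ν i) (ch i) (hs i)
  have hmain : ∀ ε, 0 < ε → ε ≤ 1 →
      c * |E| ≤ (9 * (C * B) * B + 9 * Z) * (ν + 1) + (∑ i, T i) * ε := by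
    intro ε hε hε1
    have hk := hC ε hε hε1
    have d := sum_integral_momentum_mul_decomposition hU hP hdiv hns hε ch hs hgdiv
    have b1 : |(∑ i, ∫ x, momentum ν U i x * cv (mollK ε) (h i) x) - (∫ z, mollK ε z) * E| ≤
        (∑ i, T i) * ε := by
      rw [hE, Finset.mul_sum, ← Finset.sum_sub_distrib, Finset.sum_mul]
      exact (Finset.abs_sum_le_sum_abs _ _).trans (Finset.sum_le_sum fun i _ => hT i ε hε hε1)
    have b2 : |∑ i, ∫ x, momentum ν U i x * cv (remK ε) (h i) x| ≤
        9 * (C * B) * B * (ν + 1) := by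
      refine (Finset.abs_sum_le_sum_abs _ _).trans ((Finset.sum_le_sum fun i _ =>
        abs_integral_momentum_mul_cv_remK_le hU hdiv hN hν hε hC0 (fun z hz => (hk z hz).2.1)
          (fun z hz => (hk z hz).2.2) (ch i) (hs i) (hH i) i).trans ?_)
      simp only [Finset.sum_const, Finset.card_univ, Fintype.card_fin, nsmul_eq_mul]
      exact le_of_eq (by push_cast; ring)
    have b3 : |∑ i, ∑ j, ∫ x, U i x * U j x * pd j (pd i (cv (nearK ε) g)) x| ≤ 9 * Z := by
      have hb : ∀ i j, |∫ x, U i x * U j x * pd j (pd i (cv (nearK ε) g)) x| ≤ Z := by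
        intro i j
        have := abs_integral_mul_pd_pd_cv_nearK_le hU hN hε hC0 (fun z hz => (hk z hz).1) cg gs
          hG1 hG3 j i
        simpa only [mul_comm (U j _)] using this
      refine (Finset.abs_sum_le_sum_abs _ _).trans ((Finset.sum_le_sum fun i _ =>
        (Finset.abs_sum_le_sum_abs _ _).trans (Finset.sum_le_sum fun j _ => hb i j)).trans ?_)
      simp only [Finset.sum_const, Finset.card_univ, Fintype.card_fin, nsmul_eq_mul]
      exact le_of_eq (by push_cast; ring)
    have hcε := (hcK ε hε hε1).1
    have b4 : c * |E| ≤ |(∫ z, mollK ε z) * E| := by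
      rw [abs_mul]
      exact mul_le_mul_of_nonneg_right (hcε.trans (le_abs_self _)) (abs_nonneg _)
    have a1 := abs_le.mp b1
    have a2 := abs_le.mp b2
    have a3 := abs_le.mp b3
    refine b4.trans (abs_le.mpr ?_)
    have hZν : 0 ≤ Z * ν := by positivity
    constructor <;> nlinarith
  have hE1 : c * |E| ≤ (9 * (C * B) * B + 9 * Z) * (ν + 1) := by
    have hT0' : 0 ≤ ∑ i, T i := Finset.sum_nonneg fun i _ => hT0 i
    refine le_of_forall_pos_le_add fun δ hδ => ?_
    set ε := min 1 (δ / ((∑ i, T i) + 1)) with hεdef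
    have hε : 0 < ε := by positivity
    refine (hmain ε hε (min_le_left _ _)).trans (add_le_add le_rfl ?_)
    have h1 : ε ≤ δ / ((∑ i, T i) + 1) := min_le_right _ _
    rw [le_div_iff₀ (by positivity)] at h1
    nlinarith
  have hE2 : |E| ≤ (9 * (C * B) * B + 9 * Z) / c * (ν + 1) := by
    rw [div_mul_eq_mul_div, le_div_iff₀ hc0]
    linarith
  have hen := sum_integral_momentum_mul_self (ν := ν) hU hdiv contDiff_unitCut
    hasCompactSupport_unitCut
  have hEeq : ∑ i, ∫ x, momentum ν U i x * (unitCut x * U i x) = E := rfl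
  rw [hEeq] at hen
  have ba : |∫ x, (∑ i, U i x ^ 2) * lap unitCut x| ≤ L * B := by
    refine abs_integral_le_ballConst hU hN hL0 (fun x _ => ?_) fun x hx => ?_
    · rw [← spd_sq, abs_mul, abs_of_nonneg (sq_nonneg _), mul_comm]
      exact mul_le_mul (hL' x) (hN2 x) (sq_nonneg _) hL0
    · rw [lap_eq_zero_of_norm_lt (fun _ h => unitCut_eq_zero (le_of_lt h)) (by linarith : 2 < ‖x‖),
        mul_zero]
  have bb : |∫ x, (∑ i, U i x ^ 2) * ∑ j, U j x * pd j unitCut x| ≤ 3 * L * B := by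
    refine abs_integral_le_ballConst hU hN (by positivity) (fun x _ => ?_) fun x hx => ?_
    · rw [← spd_sq, abs_mul, abs_of_nonneg (sq_nonneg _)]
      have h1 := mul_le_mul_of_nonneg_left (hgle x) (sq_nonneg (spd U x))
      have h2 : 0 ≤ 3 * L := by positivity
      refine h1.trans ?_
      nlinarith
    · have := gs x (by linarith)
      rw [hgdef] at this
      simp only at this
      rw [this, mul_zero]
  have cS : ContDiff ℝ ∞ fun x => ∑ i, ∑ j, pd j (U i) x ^ 2 :=
    ContDiff.sum fun i _ => ContDiff.sum fun j _ => ((hU i).pd j).pow 2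
  have hD : ∫ x in ball (0 : E3) 1, ∑ i, ∑ j, pd j (U i) x ^ 2 ≤
      ∫ x, unitCut x * ∑ i, ∑ j, pd j (U i) x ^ 2 := by
    have e : ∫ x in ball (0 : E3) 1, ∑ i, ∑ j, pd j (U i) x ^ 2 =
        ∫ x in ball (0 : E3) 1, unitCut x * ∑ i, ∑ j, pd j (U i) x ^ 2 := by
      refine setIntegral_congr_fun measurableSet_ball fun x hx => ?_
      have hx1 : ‖x‖ < 1 := by simpa using hx
      simp only [unitCut_eq_one hx1.le, one_mul]
    rw [e]
    refine setIntegral_le_integral ((contDiff_unitCut.mul cS).integrable_of_compact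
      hasCompactSupport_unitCut.mul_right) (Eventually.of_forall fun x => ?_)
    exact mul_nonneg (unitCut_nonneg x)
      (Finset.sum_nonneg fun i _ => Finset.sum_nonneg fun j _ => sq_nonneg _)
  have hD' := mul_le_mul_of_nonneg_left hD hν.le
  have a1 := abs_le.mp ba
  have a2 := abs_le.mp bb
  have a3 := abs_le.mp hE2
  have hLB : 0 ≤ L * B := by positivity
  have hνa : ν * (∫ x, (∑ i, U i x ^ 2) * lap unitCut x) ≤ ν * (L * B) :=
    mul_le_mul_of_nonneg_left a1.2 hν.le
  have hνLB : 0 ≤ ν * (L * B) := by positivity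
  nlinarith

end UnitScale

section Liouville

lemma pow_three_le_add_rpow {v l p : ℝ} (hv : 0 ≤ v) (hl : 0 < l) (hp : 3 ≤ p) :
    v ^ 3 ≤ l ^ 3 + l ^ (3 - p) * v ^ p := by
  by_cases h : v ≤ l
  · have h1 := pow_le_pow_left₀ hv h 3
    have h2 : 0 ≤ l ^ (3 - p) * v ^ p := by positivity
    linarith
  · have hlv : l < v := not_le.mp h
    have hv0 : 0 < v := hl.trans hlv
    have h1 : v ^ 3 = v ^ (3 - p) * v ^ p := by
      rw [← Real.rpow_add hv0, ← Real.rpow_natCast]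
      norm_num
    have h2 : v ^ (3 - p) ≤ l ^ (3 - p) :=
      Real.rpow_le_rpow_of_nonpos hl hlv.le (by linarith)
    have h3 := mul_le_mul_of_nonneg_right h2 (Real.rpow_nonneg hv p)
    have h4 : 0 < l ^ 3 := by positivity
    linarith

lemma volume_ball_E3_toReal {R : ℝ} (hR : 0 ≤ R) :
    (volume (ball (0 : E3) R)).toReal = R ^ 3 * (volume (ball (0 : E3) 1)).toReal := by
  rw [Measure.addHaar_ball volume (0 : E3) hR, finrank_euclideanSpace_fin, ENNReal.toReal_mul,
    ENNReal.toReal_ofReal (by positivity)]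

lemma measurableSet_ann (R : ℝ) : MeasurableSet (ann R) :=
  ((isOpen_lt continuous_const continuous_norm).inter
    (isOpen_lt continuous_norm continuous_const)).measurableSet

lemma ann_subset_ball (R : ℝ) : ann R ⊆ ball (0 : E3) R := fun x hx => by
  simpa using hx.2

lemma Continuous.integrableOn_ball_E3 {f : E3 → ℝ} (hf : Continuous f) (R : ℝ) :
    IntegrableOn f (ball (0 : E3) R) :=
  (hf.continuousOn.integrableOn_compact (isCompact_closedBall (0 : E3) R)).mono_set
    ball_subset_closedBall

/-- In the range `η ≤ 0`, the Morrey decay controls the cubic integral over annuli. -/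
lemma eventually_integral_ann_cube_le {v : E3 → ℝ} (hv : Continuous v) (hv0 : ∀ x, 0 ≤ v x)
    {γ p : ℝ} (hp : 3 ≤ p) (hη : γ / p - 3 / p + 2 / 3 ≤ 0)
    (hlim : Tendsto (fun R : ℝ => R ^ (-γ) * ∫ x in ann R, |v x| ^ p) atTop (nhds 0))
    {δ : ℝ} (hδ : 0 < δ) : ∀ᶠ R : ℝ in atTop, ∫ x in ann R, v x ^ 3 ≤ δ * R := by
  set V : ℝ := (volume (ball (0 : E3) 1)).toReal with hV
  have hV0 : 0 ≤ V := ENNReal.toReal_nonneg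
  set κ : ℝ := min 1 (δ / (2 * (V + 1))) with hκ
  have hκ0 : 0 < κ := by positivity
  have hκV : κ ^ 3 * V ≤ δ / 2 := by
    have h1 : κ ≤ 1 := min_le_left _ _
    have h2 : κ ≤ δ / (2 * (V + 1)) := min_le_right _ _
    rw [le_div_iff₀ (by positivity)] at h2
    have h3 : κ ^ 3 ≤ κ := by
      calc κ ^ 3 ≤ κ ^ 1 := pow_le_pow_of_le_one hκ0.le h1 (by norm_num)
        _ = κ := pow_one κ
    have h4 := mul_le_mul_of_nonneg_right h3 hV0
    linarith
  have hκp : 0 < κ ^ (3 - p) := Real.rpow_pos_of_pos hκ0 _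
  have hexp : γ + 2 / 3 * p - 2 ≤ 1 := by
    have hp0 : 0 < p := by linarith
    have : (γ / p - 3 / p + 2 / 3) * p ≤ 0 := mul_nonpos_of_nonpos_of_nonneg hη hp0.le
    have e : (γ / p - 3 / p + 2 / 3) * p = γ - 3 + 2 / 3 * p := by field_simp
    linarith
  have hsmall : ∀ᶠ R : ℝ in atTop, R ^ (-γ) * ∫ x in ann R, |v x| ^ p < δ / (2 * κ ^ (3 - p)) :=
    hlim.eventually_lt_const (by positivity)
  filter_upwards [hsmall, eventually_ge_atTop 1] with R hR hR1
  have hR0 : 0 < R := by linarith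
  set l : ℝ := κ * R ^ (-(2 / 3) : ℝ) with hl
  have hl0 : 0 < l := by positivity
  have l3 : l ^ 3 = κ ^ 3 * (R ^ 2)⁻¹ := by
    rw [hl, mul_pow, ← Real.rpow_natCast (R ^ _), ← Real.rpow_mul hR0.le, ← Real.rpow_natCast R 2,
      ← Real.rpow_neg hR0.le]
    norm_num
  have lp : l ^ (3 - p) = κ ^ (3 - p) * R ^ (2 / 3 * p - 2) := by
    rw [hl, Real.mul_rpow hκ0.le (by positivity), ← Real.rpow_mul hR0.le]
    ring_nf
  set I : ℝ := ∫ x in ann R, |v x| ^ p with hI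
  have hI0 : 0 ≤ I := integral_nonneg fun x => by positivity
  have hip : IntegrableOn (fun x => |v x| ^ p) (ann R) :=
    (Continuous.integrableOn_ball_E3 (hv.abs.rpow_const fun x => Or.inr (by linarith)) R).mono_set
      (ann_subset_ball R)
  have hic : IntegrableOn (fun _ : E3 => l ^ 3) (ann R) :=
    (continuous_const.integrableOn_ball_E3 R).mono_set (ann_subset_ball R)
  have h1 : ∫ x in ann R, v x ^ 3 ≤ ∫ x in ann R, (l ^ 3 + l ^ (3 - p) * |v x| ^ p) := by
    refine integral_mono_of_nonneg (Eventually.of_forall fun x => pow_nonneg (hv0 x) 3)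
      (hic.add (hip.const_mul _)) (Eventually.of_forall fun x => ?_)
    simp only [abs_of_nonneg (hv0 x)]
    exact pow_three_le_add_rpow (hv0 x) hl0 hp
  rw [integral_add hic (hip.const_mul _), integral_const_mul, setIntegral_const, smul_eq_mul] at h1
  have h2 : volume.real (ann R) ≤ R ^ 3 * V := by
    rw [← volume_ball_E3_toReal hR0.le]
    exact ENNReal.toReal_mono measure_ball_lt_top.ne (measure_mono (ann_subset_ball R))
  have h3 : volume.real (ann R) * l ^ 3 ≤ δ / 2 * R := by
    refine (mul_le_mul_of_nonneg_right h2 (by positivity)).trans ?_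
    rw [l3]
    have e : R ^ 3 * V * (κ ^ 3 * (R ^ 2)⁻¹) = κ ^ 3 * V * R := by field_simp
    rw [e]
    exact mul_le_mul_of_nonneg_right hκV hR0.le
  have h4 : l ^ (3 - p) * I ≤ δ / 2 * R := by
    have h5 : I = R ^ γ * (R ^ (-γ) * I) := by
      rw [← mul_assoc, ← Real.rpow_add hR0, add_neg_cancel, Real.rpow_zero, one_mul]
    have h6 : R ^ (2 / 3 * p - 2) * R ^ γ ≤ R := by
      rw [← Real.rpow_add hR0]
      calc R ^ (2 / 3 * p - 2 + γ) ≤ R ^ (1 : ℝ) :=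
            Real.rpow_le_rpow_of_exponent_le hR1 (by linarith)
        _ = R := Real.rpow_one R
    have h7 : κ ^ (3 - p) * (R ^ (-γ) * I) ≤ δ / 2 := by
      rw [lt_div_iff₀ (by positivity)] at hR
      linarith
    have h8 : 0 ≤ κ ^ (3 - p) * (R ^ (-γ) * I) := by positivity
    calc l ^ (3 - p) * I = κ ^ (3 - p) * R ^ (2 / 3 * p - 2) * (R ^ γ * (R ^ (-γ) * I)) := by
          rw [lp, ← h5]
      _ = (κ ^ (3 - p) * (R ^ (-γ) * I)) * (R ^ (2 / 3 * p - 2) * R ^ γ) := by ring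
      _ ≤ δ / 2 * R := mul_le_mul h7 h6 (by positivity) (by positivity)
  linarith

/-- Smallness over annuli sums up to smallness over balls. -/
lemma eventually_integral_ball_le {w : E3 → ℝ} (hw : Continuous w) (hw0 : ∀ x, 0 ≤ w x)
    (h : ∀ δ : ℝ, 0 < δ → ∀ᶠ R : ℝ in atTop, ∫ x in ann R, w x ≤ δ * R) {δ : ℝ} (hδ : 0 < δ) :
    ∀ᶠ R : ℝ in atTop, ∫ x in ball (0 : E3) R, w x ≤ δ * R := by
  obtain ⟨R₁, hR₁⟩ := eventually_atTop.mp (h (δ / 6) (by positivity))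
  set R₀ := max R₁ 1 with hR₀
  have hR₀1 : 1 ≤ R₀ := le_max_right _ _
  set a : ℝ → ℝ := fun R => ∫ x in ball (0 : E3) R, w x with ha
  have hmono : ∀ R R' : ℝ, R ≤ R' → a R ≤ a R' := fun R R' hRR' =>
    setIntegral_mono_set (hw.integrableOn_ball_E3 R') (Eventually.of_forall hw0)
      (ball_subset_ball hRR').eventuallyLE
  have hstep : ∀ R, R₀ ≤ R → a R ≤ a (2 / 3 * R) + δ / 6 * R := by
    intro R hR
    have hR0 : 0 < R := by linarith
    have hsub : ball (0 : E3) R ⊆ ball (0 : E3) (2 / 3 * R) ∪ ann R := by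
      intro x hx
      have hx' : ‖x‖ < R := by simpa using hx
      by_cases h1 : ‖x‖ < 2 / 3 * R
      · exact Or.inl (by simpa using h1)
      · exact Or.inr ⟨by linarith, hx'⟩
    have i1 := hw.integrableOn_ball_E3 (2 / 3 * R)
    have i2 : IntegrableOn w (ann R) := (hw.integrableOn_ball_E3 R).mono_set (ann_subset_ball R)
    have h2 : a R ≤ ∫ x in ball (0 : E3) (2 / 3 * R) ∪ ann R, w x :=
      setIntegral_mono_set (i1.union i2) (Eventually.of_forall hw0) hsub.eventuallyLE
    have h3 : ∫ x in ball (0 : E3) (2 / 3 * R) ∪ ann R, w x ≤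
        a (2 / 3 * R) + ∫ x in ann R, w x := by
      have h4 : ∫ x in ball (0 : E3) (2 / 3 * R) ∪ ann R, w x =
          a (2 / 3 * R) + ∫ x in ann R \ ball (0 : E3) (2 / 3 * R), w x := by
        rw [← Set.union_sdiff_self, setIntegral_union Set.disjoint_sdiff_right
          ((measurableSet_ann R).diff measurableSet_ball) i1 (i2.mono_set Set.sdiff_subset)]
      rw [h4]
      exact add_le_add le_rfl (setIntegral_mono_set i2 (Eventually.of_forall hw0)
        Set.sdiff_subset.eventuallyLE)
    have h5 := hR₁ R ((le_max_left _ _).trans hR)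
    linarith
  have hind : ∀ n : ℕ, ∀ R, 0 < R → R ≤ (3 / 2) ^ n * R₀ → a R ≤ a R₀ + δ / 2 * R := by
    intro n
    induction n with
    | zero =>
      intro R hR0 hR
      have := hmono R R₀ (by simpa using hR)
      have : 0 < δ / 2 * R := by positivity
      linarith
    | succ n ih =>
      intro R hR0 hR
      by_cases hRR : R ≤ R₀
      · have := hmono R R₀ hRR
        have : 0 < δ / 2 * R := by positivity
        linarith
      · have h1 := hstep R (not_le.mp hRR).le
        have h2 := ih (2 / 3 * R) (by positivity) (by rw [pow_succ] at hR; linarith)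
        linarith
  filter_upwards [eventually_ge_atTop (max 1 (2 * a R₀ / δ))] with R hR
  have hR1 : 1 ≤ R := (le_max_left _ _).trans hR
  have hR2 : 2 * a R₀ / δ ≤ R := (le_max_right _ _).trans hR
  rw [div_le_iff₀ hδ] at hR2
  obtain ⟨n, hn⟩ := pow_unbounded_of_one_lt R (show (1 : ℝ) < 3 / 2 by norm_num)
  have h1 := hind n R (by linarith) (by nlinarith [pow_pos (show (0 : ℝ) < 3 / 2 by norm_num) n])
  have h2 : a R ≤ δ * R := by linarith
  exact h2

lemma eq_of_pd_eq_zero {f : E3 → ℝ} (hf : ContDiff ℝ ∞ f) (h : ∀ j x, pd j f x = 0) (x y : E3) :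
    f x = f y := by
  refine is_const_of_fderiv_eq_zero hf.differentiable_infty (fun x => ?_) x y
  have : (fderiv ℝ f x : E3 →ₗ[ℝ] ℝ) = 0 := by
    refine (EuclideanSpace.basisFun (Fin 3) ℝ).toBasis.ext fun j => ?_
    simpa [pd] using h j x
  ext v
  exact LinearMap.congr_fun this v

lemma setIntegral_ball_comp_smul (f : E3 → ℝ) {R r : ℝ} (hR : 0 < R) :
    ∫ x in ball (0 : E3) r, f (R • x) = (R ^ 3)⁻¹ * ∫ x in ball (0 : E3) (R * r), f x := by
  rw [Measure.setIntegral_comp_smul_of_pos volume f _ hR, finrank_euclideanSpace_fin,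
    _root_.smul_ball hR.ne', smul_zero, Real.norm_eq_abs, abs_of_pos hR, smul_eq_mul]

variable {U : Fin 3 → E3 → ℝ} {P : E3 → ℝ}

/-- The scaled local energy bound. -/
lemma exists_scaled_energy_bound : ∃ C : ℝ, 0 ≤ C ∧ ∀ (U : Fin 3 → E3 → ℝ) (P : E3 → ℝ),
    (∀ i, ContDiff ℝ ∞ (U i)) → ContDiff ℝ ∞ P → (∀ x, ∑ j, pd j (U j) x = 0) →
    (∀ i x, momentum 1 U i x + pd i P x = 0) → ∀ l R : ℝ, 0 < l → 0 < R →
    ∫ x in ball (0 : E3) (R * 8), spd U x ^ 3 ≤ l ^ 3 * R ^ 3 →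
    ∫ x in ball (0 : E3) R, ∑ i, ∑ j, pd j (U i) x ^ 2 ≤ C * (l ^ 2 * R + l ^ 3 * R ^ 2) := by
  obtain ⟨C, hC0, hC⟩ := exists_local_energy_bound
  refine ⟨C, hC0, fun U P hU hP hdiv hns l R hl hR hN => ?_⟩
  set U' : Fin 3 → E3 → ℝ := fun i x => l⁻¹ * U i (R • x) with hU'
  set P' : E3 → ℝ := fun x => (l ^ 2)⁻¹ * P (R • x) with hP'
  have cs : ∀ {f : E3 → ℝ}, ContDiff ℝ ∞ f → ContDiff ℝ ∞ fun x : E3 => f (R • x) := fun hf =>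
    hf.comp (contDiff_const_smul R)
  have pdU : ∀ i j, pd j (U' i) = fun x => l⁻¹ * (R * pd j (U i) (R • x)) := by
    intro i j
    rw [hU', pd_const_mul (cs (hU i)).differentiable_infty,
      pd_comp_smul (hU i).differentiable_infty]
  have lapU : ∀ i, lap (U' i) = fun x => l⁻¹ * (R ^ 2 * lap (U i) (R • x)) := by
    intro i
    rw [hU', lap_const_mul (cs (hU i)), lap_comp_smul (hU i)]
  have pdP : ∀ j, pd j P' = fun x => (l ^ 2)⁻¹ * (R * pd j P (R • x)) := by
    intro j
    rw [hP', pd_const_mul (cs hP).differentiable_infty, pd_comp_smul hP.differentiable_infty]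
  have hspd : ∀ x, spd U' x ^ 3 = (l ^ 3)⁻¹ * spd U (R • x) ^ 3 := by
    intro x
    have h1 : spd U' x = l⁻¹ * spd U (R • x) := by
      refine (sq_eq_sq₀ (spd_nonneg _ _) (mul_nonneg (inv_nonneg.mpr hl.le) (spd_nonneg _ _))).mp ?_
      rw [spd_sq, mul_pow, spd_sq, Finset.mul_sum]
      simp only [hU', mul_pow]
    rw [h1, mul_pow, inv_pow]
  have key := hC (l * R)⁻¹ U' P' (by positivity) (fun i => contDiff_const.mul (cs (hU i)))
    (contDiff_const.mul (cs hP)) (fun x => ?_) (fun i x => ?_) ?_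
  · have e : ∫ x in ball (0 : E3) 1, ∑ i, ∑ j, pd j (U' i) x ^ 2 =
        (l ^ 2)⁻¹ * R ^ 2 * ((R ^ 3)⁻¹ * ∫ x in ball (0 : E3) R, ∑ i, ∑ j, pd j (U i) x ^ 2) := by
      have h1 := setIntegral_ball_comp_smul (fun x => ∑ i, ∑ j, pd j (U i) x ^ 2) (r := 1) hR
      rw [mul_one] at h1
      rw [← h1, ← integral_const_mul]
      congr with x
      simp only [pdU, Finset.mul_sum]
      refine Finset.sum_congr rfl fun i _ => Finset.sum_congr rfl fun j _ => ?_
      field_simp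
    rw [e] at key
    set D := ∫ x in ball (0 : E3) R, ∑ i, ∑ j, pd j (U i) x ^ 2 with hD
    have h2 := mul_le_mul_of_nonneg_left key (show 0 ≤ l ^ 3 * R ^ 2 by positivity)
    have e1 : l ^ 3 * R ^ 2 * ((l * R)⁻¹ * ((l ^ 2)⁻¹ * R ^ 2 * ((R ^ 3)⁻¹ * D))) = D := by
      field_simp
    have e2 : l ^ 3 * R ^ 2 * (C * ((l * R)⁻¹ + 1)) = C * (l ^ 2 * R + l ^ 3 * R ^ 2) := by
      field_simp
    rwa [e1, e2] at h2
  · simp only [pdU, ← Finset.mul_sum, hdiv, mul_zero]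
  · have h1 := hns i (R • x)
    have h2 : momentum (l * R)⁻¹ U' i x + pd i P' x =
        (l ^ 2)⁻¹ * R * (momentum 1 U i (R • x) + pd i P (R • x)) := by
      have h3 : ∑ j, U' j x * pd j (U' i) x =
          (l ^ 2)⁻¹ * R * ∑ j, U j (R • x) * pd j (U i) (R • x) := by
        rw [Finset.mul_sum]
        refine Finset.sum_congr rfl fun j _ => ?_
        rw [pdU, hU']
        field_simp
      rw [momentum, momentum, h3, lapU, pdP]
      field_simp
    rw [h2, h1, mul_zero]
  · simp only [hspd]
    rw [integral_const_mul, setIntegral_ball_comp_smul (fun x => spd U x ^ 3) hR,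
      ← mul_assoc, ← mul_inv, inv_mul_le_iff₀ (by positivity), mul_one]
    exact hN

lemma pd_eq_zero_of_cube_decay (hU : ∀ i, ContDiff ℝ ∞ (U i)) (hP : ContDiff ℝ ∞ P)
    (hdiv : ∀ x, ∑ j, pd j (U j) x = 0) (hns : ∀ i x, momentum 1 U i x + pd i P x = 0)
    (h : ∀ δ : ℝ, 0 < δ → ∀ᶠ R : ℝ in atTop, ∫ x in ball (0 : E3) R, spd U x ^ 3 ≤ δ * R)
    (i j : Fin 3) (x : E3) : pd j (U i) x = 0 := by
  obtain ⟨C, hC0, hC⟩ := exists_scaled_energy_bound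
  set S : E3 → ℝ := fun x => ∑ i, ∑ j, pd j (U i) x ^ 2 with hS
  have cS : ContDiff ℝ ∞ S := ContDiff.sum fun i _ => ContDiff.sum fun j _ => ((hU i).pd j).pow 2
  have hS0 : ∀ x, 0 ≤ S x := fun x =>
    Finset.sum_nonneg fun i _ => Finset.sum_nonneg fun j _ => sq_nonneg _
  have hbound : ∀ r δ : ℝ, 0 < δ → δ ≤ 1 → ∫ x in ball (0 : E3) r, S x ≤ 2 * C * δ := by
    intro r δ hδ hδ1
    obtain ⟨R₁, hR₁⟩ := eventually_atTop.mp (h (δ ^ 3 / 8) (by positivity))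
    set s := max 1 (max R₁ r) with hs
    have hs1 : 1 ≤ s := le_max_left _ _
    have hsR : R₁ ≤ s := (le_max_left _ _).trans (le_max_right _ _)
    have hsr : r ≤ s := (le_max_right _ _).trans (le_max_right _ _)
    have hs0 : 0 < s := by linarith
    have hs3 : s ≤ s ^ 3 := le_self_pow₀ hs1 (by norm_num)
    have h1 := hC U P hU hP hdiv hns (δ / s ^ 2) (s ^ 3) (by positivity) (by positivity) (by
      have h2 := hR₁ (s ^ 3 * 8) (by linarith)
      have e : (δ / s ^ 2) ^ 3 * (s ^ 3) ^ 3 = δ ^ 3 / 8 * (s ^ 3 * 8) := by field_simp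
      rwa [e])
    have h3 : ∫ x in ball (0 : E3) r, S x ≤ ∫ x in ball (0 : E3) (s ^ 3), S x :=
      setIntegral_mono_set (cS.continuous.integrableOn_ball_E3 _) (Eventually.of_forall hS0)
        (ball_subset_ball (hsr.trans hs3)).eventuallyLE
    have e : (δ / s ^ 2) ^ 2 * s ^ 3 + (δ / s ^ 2) ^ 3 * (s ^ 3) ^ 2 = δ ^ 2 / s + δ ^ 3 := by
      field_simp
    rw [e] at h1
    have h4 : δ ^ 2 / s ≤ δ := by
      rw [div_le_iff₀ hs0]
      nlinarith
    have h5 : δ ^ 3 ≤ δ := by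
      calc δ ^ 3 ≤ δ ^ 1 := pow_le_pow_of_le_one hδ.le hδ1 (by norm_num)
        _ = δ := pow_one δ
    have h6 : C * (δ ^ 2 / s + δ ^ 3) ≤ C * (δ + δ) :=
      mul_le_mul_of_nonneg_left (add_le_add h4 h5) hC0
    linarith
  have hzero : ∫ x in ball (0 : E3) (‖x‖ + 1), S x ≤ 0 := by
    refine le_of_forall_pos_le_add fun ε hε => ?_
    set δ := min 1 (ε / (2 * C + 1)) with hδ
    have hδ0 : 0 < δ := by positivity
    refine (hbound (‖x‖ + 1) δ hδ0 (min_le_left _ _)).trans ?_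
    have h1 : δ ≤ ε / (2 * C + 1) := min_le_right _ _
    rw [le_div_iff₀ (by positivity)] at h1
    linarith
  have hSx : S x = 0 := by
    by_contra hne
    have hpos : 0 < S x := lt_of_le_of_ne (hS0 x) (Ne.symm hne)
    have h1 : 0 < ∫ x in ball (0 : E3) (‖x‖ + 1), S x := by
      rw [setIntegral_pos_iff_support_of_nonneg_ae (Eventually.of_forall hS0)
        (cS.continuous.integrableOn_ball_E3 _)]
      have ho : IsOpen (Function.support S ∩ ball (0 : E3) (‖x‖ + 1)) :=
        (isOpen_ne_fun cS.continuous continuous_const).inter isOpen_ball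
      exact ho.measure_pos volume ⟨x, hne, by simp⟩
    linarith
  have h2 : pd j (U i) x ^ 2 ≤ S x :=
    (Finset.single_le_sum (f := fun j => pd j (U i) x ^ 2) (fun _ _ => sq_nonneg _)
      (Finset.mem_univ j)).trans
      (Finset.single_le_sum (f := fun i => ∑ j, pd j (U i) x ^ 2)
        (fun _ _ => Finset.sum_nonneg fun _ _ => sq_nonneg _) (Finset.mem_univ i))
  rw [hSx] at h2
  exact pow_eq_zero_iff (two_ne_zero) |>.mp (le_antisymm h2 (sq_nonneg _))

lemma eq_zero_of_cube_decay {c : ℝ} (hc : 0 ≤ c)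
    (h : ∀ᶠ R : ℝ in atTop, ∫ _x in ball (0 : E3) R, c ≤ 1 * R) : c = 0 := by
  set V : ℝ := (volume (ball (0 : E3) 1)).toReal with hV
  have hV0 : 0 < V := ENNReal.toReal_pos (measure_ball_pos _ _ one_pos).ne' measure_ball_lt_top.ne
  by_contra hne
  have hcV : 0 < c * V := mul_pos (lt_of_le_of_ne hc (Ne.symm hne)) hV0
  obtain ⟨R, hR, hR1⟩ := (h.and (eventually_ge_atTop (max 1 (2 / (c * V))))).exists
  have h1 : 1 ≤ R := (le_max_left _ _).trans hR1
  have h2 : 2 / (c * V) ≤ R := (le_max_right _ _).trans hR1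
  rw [setIntegral_const, smul_eq_mul, Measure.real, volume_ball_E3_toReal (by linarith)] at hR
  rw [div_le_iff₀ hcV] at h2
  have h3 : 2 * R ^ 2 ≤ R * (c * V) * R ^ 2 := mul_le_mul_of_nonneg_right h2 (sq_nonneg R)
  have h4 : R ^ 3 * V * c = R * (c * V) * R ^ 2 := by ring
  nlinarith

end Liouville

theorem liouville_stationary_NS_eta_nonpos
    (u : E3 → Fin 3 → ℝ) (P : E3 → ℝ) (γ p : ℝ)
    (hu : ContDiff ℝ (⊤ : ℕ∞) u) (hP : ContDiff ℝ (⊤ : ℕ∞) P)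
    (hsol : StatNS u P)
    (hγ0 : 0 < γ) (hγ3 : γ < 3) (hp3 : 3 ≤ p)
    (hη : γ / p - 3 / p + 2 / 3 ≤ 0)
    (hum : MemMorrey0 p γ (vecNorm u)) :
    (∀ x : E3, ∀ i : Fin 3, u x i = 0) ∧ (∃ c : ℝ, ∀ x : E3, P x = c) := by
  set U : Fin 3 → E3 → ℝ := fun i x => u x i with hUdef
  have hU : ∀ i, ContDiff ℝ ∞ (U i) := fun i => contDiff_pi.mp hu i
  have hdiv : ∀ x, ∑ j, pd j (U j) x = 0 := hsol.2
  have hns : ∀ i x, momentum 1 U i x + pd i P x = 0 := fun i x => by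
    rw [momentum, one_mul]
    exact hsol.1 x i
  have hdecay : ∀ δ : ℝ, 0 < δ →
      ∀ᶠ R : ℝ in atTop, ∫ x in ball (0 : E3) R, spd U x ^ 3 ≤ δ * R := fun δ hδ =>
    eventually_integral_ball_le ((continuous_spd hU).pow 3) (fun x => pow_nonneg (spd_nonneg U x) 3)
      (fun δ hδ => eventually_integral_ann_cube_le (continuous_spd hU) (spd_nonneg U) hp3 hη
        hum.2 hδ) hδ
  have hpd := pd_eq_zero_of_cube_decay hU hP hdiv hns hdecay
  have hconst : ∀ i x, U i x = U i 0 := fun i x => eq_of_pd_eq_zero (hU i) (hpd i) x 0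
  have hspd : ∀ x, spd U x = spd U 0 := fun x => by
    refine (sq_eq_sq₀ (spd_nonneg U x) (spd_nonneg U 0)).mp ?_
    simp only [spd_sq, hconst]
  have hspd0 : spd U 0 = 0 := by
    have h1 := hdecay 1 one_pos
    simp only [hspd] at h1
    exact (pow_eq_zero_iff three_ne_zero).mp
      (eq_zero_of_cube_decay (pow_nonneg (spd_nonneg U 0) 3) h1)
  refine ⟨fun x i => ?_, P 0, fun x => eq_of_pd_eq_zero hP (fun i y => ?_) x 0⟩
  · have h1 := abs_le_spd U i x
    rw [hspd, hspd0] at h1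
    exact abs_nonpos_iff.mp h1
  · have h1 := hns i y
    have h2 : lap (U i) y = 0 := by
      have h3 : ∀ j, pd j (U i) = fun _ => 0 := fun j => funext (hpd i j)
      simp [lap, h3, pd]
    rw [momentum, h2] at h1
    simpa [hpd] using h1
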